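/- arXiv:2404.00609 — 2 statements merged into one kernel-verified Lean document; each statement's English description precedes it below -/
import Mathlib

section
/- Let Ω ⊆ ℝⁿ be a connected open set, let F, G : ℝⁿ × ℝ → ℝ satisfy 0 < λ ≤ F ≤ Λ, 0 < λ ≤ G ≤ Λ and be locally Lipschitz, and let f : Ω → ℝ be a nonnegative measurable function such that f satisfies the EDT property and the measure μ(E) = ∫_E f(x) dx satisfies the doubling condition on Ω. Let u ≥ v be convex functions on Ω that are both generalized (Aleksandrov) solutions of det D²w = f(x)·F(x,w)/G(∇w, w*∘∇w) on Ω. Then on each connected component of Ω ∖ (Σ_u ∩ Σ_v), either u ≡ v or u > v everywhere on that component. -/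
open MeasureTheory Set
open scoped RealInnerProductSpace ENNReal

noncomputable section

abbrev En (n : ℕ) := EuclideanSpace ℝ (Fin n)

/-- The EDT property for a nonnegative function `f` on `ℝ^{n+1}` (the splitting
`ℝ^{n+1} = ℝⁿ × ℝ` uses the last coordinate `x_{last}`): for every invertible affine
change of coordinates `A` there exist `l ≥ 1`, `b ≥ 0` and positive constants
`a, c₀, τ₀, M₀, S₁, …, S_l` together with vectors `Z_j` whose last coordinate is `1`,
such that, with `g = f ∘ A` and `T_{j,M,τ} x = S_j τ x + (M − S_j) τ x_last Z_j`,
`Σ_j |g(T_{j,M,τ} x)| ≥ a τ^b |g(x)|` whenever `0 < τ < τ₀`, `M > M₀`,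
`‖x‖ ≤ c₀/(Mτ)`. -/
def EDTprop {n : ℕ} (f : En (n + 1) → ℝ) : Prop :=
  ∀ A : En (n + 1) ≃ᵃ[ℝ] En (n + 1),
    ∃ (l : ℕ) (b a c₀ τ₀ M₀ : ℝ) (S : Fin l → ℝ) (Z : Fin l → En (n + 1)),
      0 < l ∧ 0 ≤ b ∧ 0 < a ∧ 0 < c₀ ∧ 0 < τ₀ ∧ 0 < M₀ ∧ (∀ j, 0 < S j) ∧
      (∀ j, Z j (Fin.last n) = 1) ∧
      ∀ (τ M : ℝ) (x : En (n + 1)),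
        0 < τ → τ < τ₀ → M₀ < M → ‖x‖ ≤ c₀ / (M * τ) →
        a * τ ^ b * |f (A x)| ≤
          ∑ j, |f (A ((S j * τ) • x + ((M - S j) * τ * x (Fin.last n)) • Z j))|

/-- The subgradient of `u` (as a convex function on `Ω`) at `x`. -/
def subgrad {n : ℕ} (Ω : Set (En n)) (u : En n → ℝ) (x : En n) : Set (En n) :=
  {p | ∀ y ∈ Ω, u x + ⟪p, y - x⟫ ≤ u y}

/-- The Monge–Ampère measure of `u` on a set `s`. -/
def MAm {n : ℕ} (Ω : Set (En n)) (u : En n → ℝ) (s : Set (En n)) : ℝ≥0∞ :=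
  volume (⋃ x ∈ s, subgrad Ω u x)

/-- `x₀` is a strictly convex point of `u` on `Ω`. -/
def IsStrictConvexPt {n : ℕ} (Ω : Set (En n)) (u : En n → ℝ) (x₀ : En n) : Prop :=
  ∀ x ∈ Ω, x ≠ x₀ → u ((1/2 : ℝ) • (x + x₀)) < (u x + u x₀) / 2

/-- `Σ_u`: the set of non-strictly convex points of `u` in `Ω`. -/
def SigmaSet {n : ℕ} (Ω : Set (En n)) (u : En n → ℝ) : Set (En n) :=
  {x ∈ Ω | ¬ IsStrictConvexPt Ω u x}

/-- The Legendre transform of `u` (as a function on `Ω`). -/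
def legendreT {n : ℕ} (Ω : Set (En n)) (u : En n → ℝ) (p : En n) : ℝ :=
  sSup ((fun x => ⟪x, p⟫ - u x) '' Ω)

/-- `w` is a generalized (Aleksandrov) solution of
`det D²w = f(x) · F(x, w) / G(∇w, w* ∘ ∇w)` on `Ω`. -/
def IsGenSol {n : ℕ} (Ω : Set (En n)) (f : En n → ℝ) (F G : En n × ℝ → ℝ)
    (w : En n → ℝ) : Prop :=
  ∀ s : Set (En n), s ⊆ Ω → MeasurableSet s →
    MAm Ω w s = ∫⁻ x in s, ENNReal.ofReal
      (f x * F (x, w x) / G (gradient w x, legendreT Ω w (gradient w x)))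

/-- The centroid (center of mass with respect to Lebesgue measure) of a set. -/
def centroid {n : ℕ} (s : Set (En n)) : En n :=
  (volume s).toReal⁻¹ • ∫ x in s, x

/-- A set function `ν` satisfies the doubling condition on `U`. -/
def Doubling {n : ℕ} (ν : Set (En n) → ℝ≥0∞) (U : Set (En n)) : Prop :=
  ∃ c b : ℝ, c ∈ Set.Ioo (0 : ℝ) 1 ∧ 0 < b ∧
    ∀ s : Set (En n), s ⊆ U → Convex ℝ s → Bornology.IsBounded s → (interior s).Nonempty →
      ENNReal.ofReal b * ν s ≤ ν ((fun y => centroid s + c • (y - centroid s)) '' s)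


section

open Filter Topology

variable {N : ℕ}

/-- `s` selects a global subgradient of `g` at each point. -/
def IsSel (g : En N → ℝ) (s : En N → En N) : Prop := ∀ x y, g x + ⟪s x, y - x⟫ ≤ g y

lemma mem_subgrad_univ {g : En N → ℝ} {x p : En N} :
    p ∈ subgrad univ g x ↔ ∀ y, g x + ⟪p, y - x⟫ ≤ g y := by
  simp [subgrad]

lemma IsSel.mem {g : En N → ℝ} {s : En N → En N} (h : IsSel g s) (x : En N) :
    s x ∈ subgrad univ g x := mem_subgrad_univ.2 (h x)

lemma IsSel.add {g h : En N → ℝ} {s t : En N → En N} (hg : IsSel g s) (hh : IsSel h t) :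
    IsSel (fun x => g x + h x) (fun x => s x + t x) := by
  intro x y
  have h1 := hg x y
  have h2 := hh x y
  simp only [inner_add_left]
  linarith

/-- Monotonicity of the subgradient. -/
lemma subgrad_monotone {g : En N → ℝ} {x y p q : En N} (hp : p ∈ subgrad univ g x)
    (hq : q ∈ subgrad univ g y) : 0 ≤ ⟪p - q, x - y⟫ := by
  rw [mem_subgrad_univ] at hp hq
  have h1 := hp y
  have h2 := hq x
  have h3 : ⟪p, y - x⟫ = - ⟪p, x - y⟫ := by rw [← inner_neg_right, neg_sub]
  rw [inner_sub_left]
  linarith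

lemma subgrad_norm_le {g : En N → ℝ} {K : NNReal} (hg : LipschitzWith K g) {x p : En N}
    (hp : p ∈ subgrad univ g x) : ‖p‖ ≤ K := by
  rw [mem_subgrad_univ] at hp
  have h1 := hp (x + p)
  have h2 := hg.dist_le_mul (x + p) x
  rw [Real.dist_eq, dist_eq_norm] at h2
  simp only [add_sub_cancel_left, real_inner_self_eq_norm_sq] at h1 h2
  have h3 := le_abs_self (g (x + p) - g x)
  by_contra hlt
  push Not at hlt
  have : 0 < ‖p‖ := lt_of_le_of_lt K.2 hlt
  nlinarith

/-- The minimizers defining the Moreau envelope have subgradient `z - x`. -/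
lemma sub_mem_subgrad_of_min {g : En N → ℝ} (hg : ConvexOn ℝ univ g) {z x : En N}
    (hx : ∀ y, g x + ‖x - z‖ ^ 2 / 2 ≤ g y + ‖y - z‖ ^ 2 / 2) :
    z - x ∈ subgrad univ g x := by
  rw [mem_subgrad_univ]
  intro y
  by_contra! hlt
  set d := y - x with hd
  set δ := g x + ⟪z - x, d⟫ - g y with hδ
  have hδ0 : 0 < δ := by simp only [hδ]; linarith
  have key : ∀ t : ℝ, 0 < t → t ≤ 1 → δ ≤ t * (‖d‖ ^ 2 / 2) := by
    intro t ht ht1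
    have h1 := hx (x + t • d)
    have h2 := hg.2 (mem_univ x) (mem_univ y) (by linarith : (0:ℝ) ≤ 1 - t) ht.le (by ring)
    have h3 : (1 - t) • x + t • y = x + t • d := by
      simp only [hd, smul_sub, sub_smul, one_smul]; abel
    rw [h3] at h2
    have h4 : x + t • d - z = (x - z) + t • d := by abel
    rw [h4, norm_add_sq_real, norm_smul, inner_smul_right] at h1
    have h5 : ⟪x - z, d⟫ = - ⟪z - x, d⟫ := by rw [← inner_neg_left, neg_sub]
    rw [h5, mul_pow, Real.norm_eq_abs, sq_abs] at h1
    simp only [smul_eq_mul] at h2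
    have h6 : t * δ ≤ t * (t * (‖d‖ ^ 2 / 2)) := by
      simp only [hδ]
      nlinarith
    exact le_of_mul_le_mul_left h6 ht
  have h1 := key 1 one_pos le_rfl
  have hq : 0 < ‖d‖ ^ 2 / 2 := by linarith
  have h2 := key (min 1 (δ / (2 * (‖d‖ ^ 2 / 2)))) (by positivity) (min_le_left _ _)
  have h3 : min 1 (δ / (2 * (‖d‖ ^ 2 / 2))) * (‖d‖ ^ 2 / 2)
      ≤ δ / (2 * (‖d‖ ^ 2 / 2)) * (‖d‖ ^ 2 / 2) := by
    gcongr; exact min_le_right _ _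
  have h4 : δ / (2 * (‖d‖ ^ 2 / 2)) * (‖d‖ ^ 2 / 2) = δ / 2 := by
    field_simp [hq.ne']
    exact div_self (by rintro h0; simp [h0] at hq)
  linarith

/-- The resolvent of the subgradient of a convex Lipschitz function. -/
lemma exists_resolvent {g : En N → ℝ} (hg : ConvexOn ℝ univ g) {K : NNReal}
    (hK : LipschitzWith K g) :
    ∃ J : En N → En N, LipschitzWith 1 J ∧ (∀ z, z - J z ∈ subgrad univ g (J z)) ∧
      ∀ x, ∀ p ∈ subgrad univ g x, J (x + p) = x := by
  have hex : ∀ z, ∃ x, ∀ y, g x + ‖x - z‖ ^ 2 / 2 ≤ g y + ‖y - z‖ ^ 2 / 2 := by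
    intro z
    have hc : Continuous fun x => g x + ‖x - z‖ ^ 2 / 2 := by
      have := hK.continuous
      fun_prop
    refine hc.exists_forall_le ?_
    have hlow : ∀ x, (g z - K ^ 2 - ‖z‖ ) + ‖x‖ ≤ g x + ‖x - z‖ ^ 2 / 2 + 1 + K  := by
      intro x
      have h2 := hK.dist_le_mul z x
      rw [Real.dist_eq, dist_eq_norm, norm_sub_rev] at h2
      have h3 := le_abs_self (g z - g x)
      have h4 : ‖x‖ ≤ ‖x - z‖ + ‖z‖ := by simpa using norm_add_le (x - z) z
      nlinarith [sq_nonneg (‖x - z‖ - K - 1), sq_nonneg (K - 1 : ℝ), K.2]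
    have h1 : Tendsto (fun x : En N => (g z - K ^ 2 - ‖z‖ - 1 - K) + ‖x‖) (cocompact _) atTop :=
      tendsto_atTop_add_const_left _ _ (tendsto_norm_cocompact_atTop)
    refine tendsto_atTop_mono (fun x => ?_) h1
    have := hlow x
    linarith
  choose J hJ using hex
  have hJ1 : ∀ z, z - J z ∈ subgrad univ g (J z) := fun z => sub_mem_subgrad_of_min hg (hJ z)
  have hLip : ∀ {x y p q : En N}, p ∈ subgrad univ g x → q ∈ subgrad univ g y →
      ‖x - y‖ ≤ ‖(x + p) - (y + q)‖ := by
    intro x y p q hp hq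
    have h1 := subgrad_monotone hp hq
    have h2 : (x + p) - (y + q) = (x - y) + (p - q) := by abel
    rw [h2]
    refine le_of_sq_le_sq ?_ (norm_nonneg _)
    rw [norm_add_sq_real, real_inner_comm]
    nlinarith [sq_nonneg ‖p - q‖]
  refine ⟨J, ?_, hJ1, ?_⟩
  · refine LipschitzWith.of_dist_le_mul fun z w => ?_
    have := hLip (hJ1 z) (hJ1 w)
    simpa [dist_eq_norm] using this
  · intro x p hp
    have := hLip (hJ1 (x + p)) hp
    simp only [add_sub_cancel, sub_self, norm_zero, norm_le_zero_iff] at this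
    exact sub_eq_zero.1 this

lemma subgrad_nonempty {g : En N → ℝ} (hg : ConvexOn ℝ univ g) (hc : Continuous g) (x : En N) :
    (subgrad univ g x).Nonempty := by
  have h1 : Convex ℝ {p : En N × ℝ | p.1 ∈ univ ∧ g p.1 < p.2} := hg.convex_strict_epigraph
  have h2 : IsOpen {p : En N × ℝ | p.1 ∈ univ ∧ g p.1 < p.2} := by
    simp only [mem_univ, true_and]
    exact isOpen_lt (by fun_prop) continuous_snd
  obtain ⟨F, hF⟩ := geometric_hahn_banach_point_open (x := (x, g x)) h1 h2 (by simp)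
  set A : En N → ℝ := fun y => F (y, 0)
  set c : ℝ := F (0, 1)
  have hsplit : ∀ y t, F (y, t) = F (y, 0) + t * c := by
    intro y t
    have : (y, t) = (y, (0:ℝ)) + t • ((0 : En N), (1:ℝ)) := by simp
    rw [this, map_add, map_smul, smul_eq_mul]
  have hc0 : 0 < c := by
    have := hF (x, g x + 1) (by simp)
    rw [hsplit x (g x), hsplit x (g x + 1)] at this
    linarith
  set L : En N →L[ℝ] ℝ := F.comp (ContinuousLinearMap.inl ℝ (En N) ℝ)
  refine ⟨(InnerProductSpace.toDual ℝ (En N)).symm ((-c⁻¹) • L), ?_⟩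
  rw [mem_subgrad_univ]
  intro y
  rw [InnerProductSpace.toDual_symm_apply]
  have h3 : ∀ t, g y < t → F (x, 0) + g x * c < F (y, 0) + t * c := by
    intro t ht
    have := hF (y, t) (by simpa using ht)
    rwa [hsplit x (g x), hsplit y t] at this
  have h4 : F (x, 0) + g x * c ≤ F (y, 0) + g y * c := by
    refine le_of_forall_pos_le_add fun ε hε => ?_
    have := h3 (g y + ε / c) (by have : 0 < ε / c := by positivity
                                 linarith)
    have h5 : (g y + ε / c) * c = g y * c + ε := by field_simp
    linarith
  have h5 : L (y - x) = F (y, 0) - F (x, 0) := by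
    simp only [L, map_sub]; rfl
  simp only [smul_apply, smul_eq_mul, h5]
  have h6 : c * (g x + -c⁻¹ * (F (y, 0) - F (x, 0))) ≤ c * g y := by
    have : c * (g x + -c⁻¹ * (F (y, 0) - F (x, 0))) = c * g x - (F (y, 0) - F (x, 0)) := by
      field_simp; ring
    rw [this]; linarith
  exact le_of_mul_le_mul_left h6 hc0

lemma exists_isSel {g : En N → ℝ} (hg : ConvexOn ℝ univ g) (hc : Continuous g) :
    ∃ s, IsSel g s := by
  choose s hs using fun x => subgrad_nonempty hg hc x
  exact ⟨s, fun x => mem_subgrad_univ.1 (hs x)⟩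

/-- A Lipschitz convex function on a convex set extends to the whole space. -/
lemma exists_convex_extension {D : Set (En N)} (hne : D.Nonempty) {g : En N → ℝ}
    (hg : ConvexOn ℝ D g) {K : NNReal} (hK : LipschitzOnWith K g D) :
    ∃ G : En N → ℝ, ConvexOn ℝ univ G ∧ LipschitzWith K G ∧ ∀ x ∈ D, G x = g x := by
  obtain ⟨x₀, hx₀⟩ := hne
  set S : En N → Set ℝ := fun x => (fun y => g y + K * ‖x - y‖) '' D
  have hSne : ∀ x, (S x).Nonempty := fun x => ⟨_, mem_image_of_mem _ hx₀⟩
  have hgK : ∀ y ∈ D, ∀ z ∈ D, g y ≤ g z + K * ‖y - z‖ := by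
    intro y hy z hz
    have := hK.dist_le_mul y hy z hz
    rw [Real.dist_eq, dist_eq_norm] at this
    have h3 := le_abs_self (g y - g z)
    linarith
  have hSb : ∀ x, BddBelow (S x) := by
    intro x
    refine ⟨g x₀ - K * ‖x - x₀‖, ?_⟩
    rintro _ ⟨y, hy, rfl⟩
    have h1 := hgK x₀ hx₀ y hy
    have h2 : ‖x₀ - y‖ ≤ ‖x - x₀‖ + ‖x - y‖ := by
      have : x₀ - y = -(x - x₀) + (x - y) := by abel
      rw [this]; exact (norm_add_le _ _).trans (by rw [norm_neg])
    have := mul_le_mul_of_nonneg_left h2 K.2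
    simp only [NNReal.val_eq_coe] at this
    dsimp only
    linarith
  have hle : ∀ x, ∀ y ∈ D, sInf (S x) ≤ g y + K * ‖x - y‖ := fun x y hy =>
    csInf_le (hSb x) (mem_image_of_mem _ hy)
  refine ⟨fun x => sInf (S x), ⟨convex_univ, ?_⟩, ?_, ?_⟩
  · intro x _ y _ a b ha hb hab
    simp only [smul_eq_mul]
    refine le_of_forall_pos_le_add fun ε hε => ?_
    obtain ⟨_, ⟨x', hx', rfl⟩, h1⟩ := exists_lt_of_csInf_lt (hSne x)
      (lt_add_of_pos_right (sInf (S x)) hε)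
    obtain ⟨_, ⟨y', hy', rfl⟩, h2⟩ := exists_lt_of_csInf_lt (hSne y)
      (lt_add_of_pos_right (sInf (S y)) hε)
    have h3 := hle (a • x + b • y) (a • x' + b • y') (hg.1 hx' hy' ha hb hab)
    have h4 := hg.2 hx' hy' ha hb hab
    have h5 : ‖a • x + b • y - (a • x' + b • y')‖ ≤ a * ‖x - x'‖ + b * ‖y - y'‖ := by
      have : a • x + b • y - (a • x' + b • y') = a • (x - x') + b • (y - y') := by
        simp only [smul_sub]; abel
      rw [this]
      refine (norm_add_le _ _).trans (le_of_eq ?_)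
      rw [norm_smul, norm_smul, Real.norm_of_nonneg ha, Real.norm_of_nonneg hb]
    have h6 := mul_le_mul_of_nonneg_left h5 K.2
    simp only [NNReal.val_eq_coe] at h6
    simp only [smul_eq_mul] at h4
    dsimp only at h1 h2
    have h7 := mul_le_mul_of_nonneg_left h1.le ha
    have h8 := mul_le_mul_of_nonneg_left h2.le hb
    nlinarith
  · refine LipschitzWith.of_le_add_mul K fun x y => ?_
    have h0 : sInf (S x) - K * dist x y ≤ sInf (S y) := by
      refine le_csInf (hSne y) ?_
      rintro _ ⟨z, hz, rfl⟩
      have h1 := hle x z hz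
      have h2 : ‖x - z‖ ≤ dist x y + ‖y - z‖ := by
        rw [dist_eq_norm]; simpa using norm_add_le (x - y) (y - z)
      have := mul_le_mul_of_nonneg_left h2 K.2
      simp only [NNReal.val_eq_coe] at this
      dsimp only
      linarith
    linarith
  · intro x hx
    refine le_antisymm (by simpa using hle x x hx) (le_csInf (hSne x) ?_)
    rintro _ ⟨z, hz, rfl⟩
    exact hgK x hx z hz

/-- Subgradients only depend on the germ of a convex function. -/
lemma mem_subgrad_of_local {Ω : Set (En N)} {g h : En N → ℝ} (hg : ConvexOn ℝ Ω g)
    {W : Set (En N)} {x p : En N} (hW : W ∈ 𝓝 x) (hx : x ∈ Ω)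
    (hle : ∀ y ∈ W, h y ≤ g y) (heq : g x = h x) (hp : ∀ y ∈ W, h x + ⟪p, y - x⟫ ≤ h y) :
    p ∈ subgrad Ω g x := by
  have hcv : ConvexOn ℝ Ω (fun y => g y + (-⟪p, y - x⟫)) := by
    refine hg.add ⟨hg.1, ?_⟩
    intro y _ z _ a b _ _ hab
    have : a • y + b • z - x = a • (y - x) + b • (z - x) := by
      have : x = (a + b) • x := by rw [hab, one_smul]
      nth_rewrite 1 [this]
      simp only [smul_sub, add_smul]; abel
    dsimp only
    rw [this, inner_add_right, inner_smul_right, inner_smul_right]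
    simp only [smul_eq_mul]; linarith
  have hmin : IsLocalMinOn (fun y => g y + (-⟪p, y - x⟫)) Ω x := by
    refine Filter.Eventually.filter_mono nhdsWithin_le_nhds ?_
    filter_upwards [hW] with y hy
    have h1 := hle y hy
    have h2 := hp y hy
    simp only [sub_self, inner_zero_right]
    linarith
  have := IsMinOn.of_isLocalMinOn_of_convexOn hx hmin hcv
  intro y hy
  have h3 := this hy
  simp only [mem_ofPred_eq, sub_self, inner_zero_right] at h3
  linarith

lemma subgrad_eq_of_eqOn {Ω Ω' : Set (En N)} {g h : En N → ℝ} (hg : ConvexOn ℝ Ω g)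
    (hh : ConvexOn ℝ Ω' h) {W : Set (En N)} {x : En N} (hW : W ∈ 𝓝 x) (hWΩ : W ⊆ Ω)
    (hWΩ' : W ⊆ Ω') (heq : ∀ y ∈ W, g y = h y) : subgrad Ω g x = subgrad Ω' h x := by
  have hxW := mem_of_mem_nhds hW
  ext p
  constructor
  · intro hp
    exact mem_subgrad_of_local hh hW (hWΩ' hxW) (fun y hy => (heq y hy).le) (heq x hxW).symm
      (fun y hy => hp y (hWΩ hy))
  · intro hp
    exact mem_subgrad_of_local hg hW (hWΩ hxW) (fun y hy => (heq y hy).ge) (heq x hxW)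
      (fun y hy => hp y (hWΩ' hy))

end

section

open Filter Topology Measure

variable {N : ℕ}

/-- Lipschitz self-maps of Euclidean space preserve null sets. -/
lemma volume_image_eq_zero {f : En N → En N} {K : NNReal} (hf : LipschitzWith K f)
    {s : Set (En N)} (hs : volume s = 0) : volume (f '' s) = 0 := by
  have h1 : (volume : Measure (En N)) = addHaarScalarFactor volume (μH[N] : Measure (En N)) •
      (μH[N] : Measure (En N)) := isAddLeftInvariant_eq_smul _ _
  have hc : addHaarScalarFactor volume (μH[N] : Measure (En N)) ≠ 0 :=
    (addHaarScalarFactor_pos_of_isAddHaarMeasure _ _).ne'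
  rw [h1, Measure.smul_apply] at hs ⊢
  simp only [smul_eq_zero, hc, false_or] at hs ⊢
  refine le_antisymm ((hf.hausdorffMeasure_image_le (Nat.cast_nonneg N) s).trans ?_) bot_le
  simp [hs]

/-- A subgradient selection is continuous wherever the subgradient is a singleton. -/
lemma IsSel.continuousAt {g : En N → ℝ} {s : En N → En N} (h : IsSel g s) {K : NNReal}
    (hK : LipschitzWith K g) {x : En N} (hx : ∀ p ∈ subgrad univ g x, p = s x) :
    ContinuousAt s x := by
  refine (isCompact_closedBall (0 : En N) K).tendsto_nhds_of_unique_mapClusterPt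
    (Eventually.of_forall fun y => by simpa using subgrad_norm_le hK (h.mem y)) ?_
  intro p _ hp
  refine hx p (mem_subgrad_univ.2 fun y => ?_)
  refine le_of_forall_pos_le_add fun ε hε => ?_
  have hcl : IsClosed {q : En N | g x + ⟪q, y - x⟫ ≤ g y + ε} :=
    isClosed_le (by fun_prop) continuous_const
  refine hcl.mem_of_mapClusterPt hp ?_
  have : ∀ᶠ z in 𝓝 x, 2 * K * ‖z - x‖ < ε := by
    have hc : ContinuousAt (fun z => 2 * K * ‖z - x‖) x := by fun_prop
    exact hc.eventually_lt continuousAt_const (by simpa using hε)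
  filter_upwards [this] with z hz
  have h1 := h z y
  have h2 := subgrad_norm_le hK (h.mem z)
  have h3 : y - x = (y - z) + (z - x) := by abel
  have h4 := (real_inner_le_norm (s z) (z - x)).trans
    (mul_le_mul_of_nonneg_right h2 (norm_nonneg _))
  have h5 := (le_abs_self _).trans (hK.dist_le_mul x z)
  rw [dist_eq_norm, norm_sub_rev] at h5
  rw [h3, inner_add_right]
  linarith

/-- A convex function is differentiable wherever a subgradient selection is continuous. -/
lemma IsSel.hasFDerivAt {g : En N → ℝ} {s : En N → En N} (h : IsSel g s) {x : En N}
    (hx : ContinuousAt s x) : HasFDerivAt g (innerSL ℝ (s x)) x := by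
  rw [hasFDerivAt_iff_isLittleO, Asymptotics.isLittleO_iff]
  intro c hc
  filter_upwards [Metric.tendsto_nhds.1 hx c hc] with y hy
  rw [dist_eq_norm] at hy
  have h1 := h x y
  have h2 := h y x
  have h3 : x - y = -(y - x) := by abel
  rw [h3, inner_neg_right] at h2
  have h4 := real_inner_le_norm (s y - s x) (y - x)
  rw [inner_sub_left] at h4
  have h5 := mul_le_mul_of_nonneg_right hy.le (norm_nonneg (y - x))
  rw [innerSL_apply_apply, Real.norm_eq_abs, abs_le]
  constructor <;> linarith

lemma IsSel.hasGradientAt {g : En N → ℝ} {s : En N → En N} (h : IsSel g s) {x : En N}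
    (hx : ContinuousAt s x) : HasGradientAt g (s x) x := by
  rw [hasGradientAt_iff_hasFDerivAt]
  exact h.hasFDerivAt hx

/-- A differentiable convex function has a unique subgradient. -/
lemma subgrad_eq_of_hasGradientAt {Ω : Set (En N)} (hΩ : IsOpen Ω) {g : En N → ℝ} {x q p : En N}
    (hx : x ∈ Ω) (hq : HasGradientAt g q x) (hp : p ∈ subgrad Ω g x) : p = q := by
  have hmin : IsLocalMin (fun y => g y - ⟪p, y⟫) x := by
    filter_upwards [hΩ.mem_nhds hx] with y hy
    have := hp y hy
    rw [inner_sub_right] at this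
    linarith
  have hd := hq.hasFDerivAt.sub (innerSL ℝ p).hasFDerivAt
  have h0 := hmin.hasFDerivAt_eq_zero hd
  have h1 : ∀ d, ⟪q - p, d⟫ = 0 := by
    intro d
    have := congrArg (fun L : En N →L[ℝ] ℝ => L d) h0
    simpa [inner_sub_left] using this
  exact (sub_eq_zero.1 (inner_self_eq_zero.1 (h1 (q - p)))).symm

/-- The derivative of a subgradient selection is positive semidefinite. -/
lemma IsSel.inner_fderiv_nonneg {g : En N → ℝ} {s : En N → En N} (h : IsSel g s) {x : En N}
    {H : En N →L[ℝ] En N} (hx : HasFDerivAt s H x) (d : En N) : 0 ≤ ⟪H d, d⟫ := by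
  have h1 := hx.lim_real d
  have h2 : Tendsto (fun c : ℝ => ⟪c • (s (x + c⁻¹ • d) - s x), d⟫) atTop (𝓝 ⟪H d, d⟫) :=
    h1.inner tendsto_const_nhds
  refine ge_of_tendsto h2 ?_
  filter_upwards [eventually_gt_atTop 0] with c hc
  have h3 := subgrad_monotone (h.mem (x + c⁻¹ • d)) (h.mem x)
  rw [add_sub_cancel_left, inner_smul_right] at h3
  rw [inner_smul_left]
  have h4 : 0 < c⁻¹ := by positivity
  exact mul_nonneg hc.le (nonneg_of_mul_nonneg_right h3 h4)

/-- If the subgradient selection is continuous then its derivative is symmetric. -/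
lemma IsSel.fderiv_symm_of_continuous {g : En N → ℝ} {s : En N → En N} (h : IsSel g s)
    (hs : Continuous s) {x : En N} {H : En N →L[ℝ] En N} (hx : HasFDerivAt s H x) (v w : En N) :
    ⟪H v, w⟫ = ⟪v, H w⟫ := by
  have h1 : ∀ᶠ y in 𝓝 x, HasFDerivAt g (innerSL ℝ (s y)) y :=
    Eventually.of_forall fun y => h.hasFDerivAt hs.continuousAt
  have h2 : HasFDerivAt (fun y => innerSL ℝ (s y)) ((innerSL ℝ).comp H) x :=
    (innerSL ℝ).hasFDerivAt.comp x hx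
  have := second_derivative_symmetric_of_eventually_of_real h1 h2 v w
  simpa [real_inner_comm] using this

/-- The resolvent is itself a subgradient selection. -/
lemma exists_isSel_resolvent {g : En N → ℝ} {J : En N → En N}
    (hJ : ∀ z, z - J z ∈ subgrad univ g (J z)) : ∃ θ, IsSel θ J := by
  refine ⟨fun z => ⟪z, J z⟫ - ‖J z‖ ^ 2 / 2 - g (J z), fun z w => ?_⟩
  have h1 := mem_subgrad_univ.1 (hJ w) (J z)
  have h2 := norm_sub_sq_real (J z) (J w)
  have h3 := sq_nonneg ‖J z - J w‖
  simp only [inner_sub_left, inner_sub_right, real_inner_self_eq_norm_sq] at h1 ⊢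
  have h4 : ⟪J z, w⟫ = ⟪w, J z⟫ := real_inner_comm _ _
  have h5 : ⟪J z, z⟫ = ⟪z, J z⟫ := real_inner_comm _ _
  have h6 : ⟪J z, J w⟫ = ⟪J w, J z⟫ := real_inner_comm _ _
  linarith

/-- **Aleksandrov's theorem**: a subgradient selection of a convex function is differentiable
almost everywhere, with symmetric derivative. -/
theorem IsSel.ae_differentiableAt {g : En N → ℝ} {s : En N → En N} (h : IsSel g s)
    (hg : ConvexOn ℝ univ g) {K : NNReal} (hK : LipschitzWith K g) :
    ∀ᵐ x : En N, DifferentiableAt ℝ s x ∧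
      ∀ v w, ⟪fderiv ℝ s x v, w⟫ = ⟪v, fderiv ℝ s x w⟫ := by
  obtain ⟨J, hJL, hJ1, hJ2⟩ := exists_resolvent hg hK
  obtain ⟨θ, hθ⟩ := exists_isSel_resolvent hJ1
  set N1 : Set (En N) := {z | ¬ DifferentiableAt ℝ J z}
  set N2 : Set (En N) := {z | DifferentiableAt ℝ J z ∧ (fderiv ℝ J z).det = 0}
  have hN1 : volume (J '' N1) = 0 := volume_image_eq_zero hJL (ae_iff.1 hJL.ae_differentiableAt)
  have hN2 : volume (J '' N2) = 0 :=
    addHaar_image_eq_zero_of_det_fderivWithin_eq_zero (f' := fderiv ℝ J) _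
      (fun z hz => hz.1.hasFDerivAt.hasFDerivWithinAt) fun z hz => hz.2
  filter_upwards [measure_eq_zero_iff_ae_notMem.1 hN1, measure_eq_zero_iff_ae_notMem.1 hN2]
    with x hx1 hx2
  set z := x + s x with hz
  have hJz : J z = x := hJ2 x _ (h.mem x)
  have hd : DifferentiableAt ℝ J z := by
    by_contra hn
    exact hx1 ⟨z, hn, hJz⟩
  have hdet : (fderiv ℝ J z).det ≠ 0 := fun hn => hx2 ⟨z, ⟨hd, hn⟩, hJz⟩
  set P := (fderiv ℝ J z).toContinuousLinearEquivOfDetNeZero hdet with hP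
  have hPe : (P : En N →L[ℝ] En N) = fderiv ℝ J z :=
    ContinuousLinearMap.coe_toContinuousLinearEquivOfDetNeZero _ _
  have hPd : HasFDerivAt J (P : En N →L[ℝ] En N) z := by rw [hPe]; exact hd.hasFDerivAt
  have huniq : ∀ p ∈ subgrad univ g x, p = s x := by
    intro p hp
    by_contra hne
    have h1 : ∀ᶠ w in 𝓝[≠] z, J w ≠ x :=
      hPd.eventually_ne ⟨_, P.antilipschitz⟩
    have h2 : Tendsto (fun t : ℝ => z + t • (p - s x)) (𝓝[>] 0) (𝓝[≠] z) := by
      refine tendsto_nhdsWithin_iff.2 ⟨?_, ?_⟩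
      · have : Continuous fun t : ℝ => z + t • (p - s x) := by fun_prop
        have := this.tendsto 0
        simp only [zero_smul, add_zero] at this
        exact this.mono_left nhdsWithin_le_nhds
      · filter_upwards [self_mem_nhdsWithin] with t ht
        simp [sub_eq_zero, hne, (ne_of_gt (show (0:ℝ) < t from ht))]
    have h3 : ∀ᶠ t : ℝ in 𝓝[>] 0, t < 1 :=
      eventually_nhdsWithin_of_eventually_nhds (gt_mem_nhds one_pos)
    obtain ⟨t, ⟨ht1, ht2⟩, ht0⟩ := (((h2.eventually h1).and h3).and self_mem_nhdsWithin).exists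
    refine ht1 ?_
    have ht0 : (0:ℝ) < t := ht0
    have : z + t • (p - s x) = x + ((1 - t) • s x + t • p) := by
      simp only [hz, smul_sub, sub_smul, one_smul]; abel
    rw [this]
    refine hJ2 x _ (mem_subgrad_univ.2 fun y => ?_)
    have h4 := h x y
    have h5 := mem_subgrad_univ.1 hp y
    rw [inner_add_left, inner_smul_left, inner_smul_left]
    simp only [conj_trivial]
    nlinarith
  have hcont : ContinuousAt s x := h.continuousAt hK huniq
  have hT : HasFDerivAt (fun y => y + s y) (P.symm : En N →L[ℝ] En N) x := by
    refine HasFDerivAt.of_local_left_inverse (f := J) (continuousAt_id.add hcont) hPd ?_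
    exact Eventually.of_forall fun y => hJ2 y _ (h.mem y)
  have hs : HasFDerivAt s ((P.symm : En N →L[ℝ] En N) - ContinuousLinearMap.id ℝ (En N)) x := by
    have := hT.sub (hasFDerivAt_id x)
    refine this.congr_of_eventuallyEq (Eventually.of_forall fun y => ?_)
    simp
  refine ⟨hs.differentiableAt, fun v w => ?_⟩
  rw [hs.fderiv]
  have hsym := fun v w => hθ.fderiv_symm_of_continuous hJL.continuous hPd v w
  have h1 := hsym (P.symm v) (P.symm w)
  simp only [ContinuousLinearEquiv.coe_coe, ContinuousLinearEquiv.apply_symm_apply] at h1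
  simp [inner_sub_left, inner_sub_right, h1]

end

section

open Filter Topology Measure

variable {N : ℕ}

/-- A symmetric positive semidefinite operator kills the isotropic vectors of its form. -/
lemma apply_eq_zero_of_inner_eq_zero {H : En N →L[ℝ] En N} (hsym : ∀ v w, ⟪H v, w⟫ = ⟪v, H w⟫)
    (hpos : ∀ d, 0 ≤ ⟪H d, d⟫) {d : En N} (hd : ⟪H d, d⟫ = 0) : H d = 0 := by
  have key : ∀ τ : ℝ, 0 ≤ 2 * τ * ‖H d‖ ^ 2 + τ ^ 2 * ⟪H (H d), H d⟫ := by
    intro τ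
    have h1 := hpos (d + τ • H d)
    have h2 : ⟪H (H d), d⟫ = ‖H d‖ ^ 2 := by rw [hsym, real_inner_self_eq_norm_sq]
    simp only [map_add, map_smul, inner_add_left, inner_add_right, inner_smul_left,
      inner_smul_right, hd, h2, real_inner_self_eq_norm_sq, conj_trivial] at h1
    linarith
  set q := ⟪H (H d), H d⟫
  have hq : 0 ≤ q := hpos (H d)
  have key2 : ∀ τ : ℝ, 0 < τ → 2 * ‖H d‖ ^ 2 ≤ τ * q := by
    intro τ hτ
    have := key (-τ)
    have h3 : 0 ≤ τ * (τ * q - 2 * ‖H d‖ ^ 2) := by nlinarith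
    have := nonneg_of_mul_nonneg_right h3 hτ
    linarith
  have h3 : ‖H d‖ ^ 2 ≤ 0 := by
    refine le_of_forall_pos_le_add fun ε hε => ?_
    have h4 := key2 (ε / (1 + q)) (by positivity)
    have h5 : ε / (1 + q) * q ≤ ε := by
      rw [div_mul_eq_mul_div, div_le_iff₀ (by positivity)]; nlinarith
    nlinarith [sq_nonneg ‖H d‖]
  have h4 : ‖H d‖ = 0 := by nlinarith [norm_nonneg (H d)]
  exact norm_eq_zero.1 h4

lemma IsSel.eq_of_det_ne_zero {g : En N → ℝ} {s : En N → En N} (h : IsSel g s) {x x' : En N}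
    (hx : DifferentiableAt ℝ s x) (hsym : ∀ v w, ⟪fderiv ℝ s x v, w⟫ = ⟪v, fderiv ℝ s x w⟫)
    (hdet : (fderiv ℝ s x).det ≠ 0) (heq : s x = s x') : x = x' := by
  set d := x' - x with hd
  have hlim : Tendsto (fun c : ℝ => ⟪c • (s (x + c⁻¹ • d) - s x), d⟫) atTop
      (𝓝 ⟪fderiv ℝ s x d, d⟫) := (hx.hasFDerivAt.lim_real d).inner tendsto_const_nhds
  have hzero : ⟪fderiv ℝ s x d, d⟫ = 0 := by
    refine tendsto_nhds_unique hlim (tendsto_const_nhds.congr' ?_)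
    filter_upwards [eventually_gt_atTop 1] with c hc
    have hc0 : 0 < c⁻¹ := by positivity
    have hc1 : c⁻¹ < 1 := inv_lt_one_of_one_lt₀ hc
    have h1 := subgrad_monotone (h.mem (x + c⁻¹ • d)) (h.mem x)
    have h2 := subgrad_monotone (h.mem x') (h.mem (x + c⁻¹ • d))
    have h3 : x' - (x + c⁻¹ • d) = (1 - c⁻¹) • d := by
      rw [hd, sub_smul, one_smul, ← hd]; simp only [hd]; abel
    rw [add_sub_cancel_left, inner_smul_right] at h1
    rw [h3, inner_smul_right, ← heq] at h2
    have h4 := nonneg_of_mul_nonneg_right h1 hc0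
    have h5 := nonneg_of_mul_nonneg_right h2 (sub_pos.2 hc1)
    rw [← neg_sub, inner_neg_left] at h5
    have h6 : ⟪s (x + c⁻¹ • d) - s x, d⟫ = 0 := by linarith
    rw [inner_smul_left, h6, mul_zero]
  have h0 := apply_eq_zero_of_inner_eq_zero hsym
    (fun d => h.inner_fderiv_nonneg hx.hasFDerivAt d) hzero
  have h1 := ((fderiv ℝ s x).toContinuousLinearEquivOfDetNeZero hdet).injective
    (a₁ := d) (a₂ := 0) (by simpa using h0)
  exact (sub_eq_zero.1 h1).symm

lemma IsSel.subgrad_eq {g : En N → ℝ} {s : En N → En N} (h : IsSel g s) {x : En N}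
    (hx : DifferentiableAt ℝ s x) : subgrad univ g x = {s x} := by
  refine Subset.antisymm (fun p hp => ?_) (singleton_subset_iff.2 (h.mem x))
  exact subgrad_eq_of_hasGradientAt isOpen_univ (mem_univ x)
    (h.hasGradientAt hx.continuousAt) hp

lemma measurable_ofReal_abs_det_fderiv (s : En N → En N) :
    Measurable fun x => ENNReal.ofReal |(fderiv ℝ s x).det| := by
  have h1 : Measurable (fderiv ℝ s) := measurable_fderiv ℝ s
  have h2 : Continuous fun A : En N →L[ℝ] En N => A.det := ContinuousLinearMap.continuous_det
  exact ENNReal.measurable_ofReal.comp (continuous_abs.measurable.comp (h2.measurable.comp h1))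

/-- The absolutely continuous part of the Monge–Ampère measure is the Hessian determinant. -/
lemma IsSel.lintegral_det_le_MAm {g : En N → ℝ} {s : En N → En N} (h : IsSel g s)
    (hg : ConvexOn ℝ univ g) {K : NNReal} (hK : LipschitzWith K g) {E : Set (En N)}
    (hE : MeasurableSet E) :
    ∫⁻ x in E, ENNReal.ofReal |(fderiv ℝ s x).det| ≤ MAm univ g E := by
  obtain ⟨T, hTs, hTm, hT0⟩ := exists_measurable_superset_of_null
    (ae_iff.1 (h.ae_differentiableAt hg hK))
  have hgood : ∀ x ∉ T, DifferentiableAt ℝ s x ∧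
      ∀ v w, ⟪fderiv ℝ s x v, w⟫ = ⟪v, fderiv ℝ s x w⟫ := by
    intro x hx
    by_contra hn
    exact hx (hTs hn)
  set Z : Set (En N) := {x | ENNReal.ofReal |(fderiv ℝ s x).det| = 0}
  have hZm : MeasurableSet Z := measurable_ofReal_abs_det_fderiv s (measurableSet_singleton 0)
  set E' := (E \ T) \ Z with hE'
  have hE'm : MeasurableSet E' := (hE.diff hTm).diff hZm
  have h1 : ∫⁻ x in E, ENNReal.ofReal |(fderiv ℝ s x).det| =
      ∫⁻ x in E', ENNReal.ofReal |(fderiv ℝ s x).det| := by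
    have e1 : ∫⁻ x in E, ENNReal.ofReal |(fderiv ℝ s x).det| =
        ∫⁻ x in E \ T, ENNReal.ofReal |(fderiv ℝ s x).det| :=
      setLIntegral_congr (sdiff_null_ae_eq_self hT0).symm
    have e2 := lintegral_inter_add_sdiff (μ := volume) (B := Z)
      (fun x => ENNReal.ofReal |(fderiv ℝ s x).det|)
      (E \ T) hZm
    have e3 : ∫⁻ x in (E \ T) ∩ Z, ENNReal.ofReal |(fderiv ℝ s x).det| = 0 := by
      rw [setLIntegral_congr_fun ((hE.diff hTm).inter hZm) (g := fun _ => 0) fun x hx => hx.2]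
      simp
    rw [e1, ← e2, e3, zero_add]
  rw [h1]
  refine (lintegral_abs_det_fderiv_le_addHaar_image volume hE'm
    (fun x hx => (hgood x hx.1.2).1.hasFDerivAt.hasFDerivWithinAt) ?_).trans ?_
  · intro x hx x' _ heq
    refine h.eq_of_det_ne_zero (hgood x hx.1.2).1 (hgood x hx.1.2).2 (fun h0 => hx.2 ?_) heq
    simp [Z, h0]
  · refine measure_mono ?_
    rintro _ ⟨x, hx, rfl⟩
    exact mem_iUnion₂.2 ⟨x, hx.1.1, h.mem x⟩

lemma IsSel.MAm_le_lintegral_det {g : En N → ℝ} {s : En N → En N} (h : IsSel g s)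
    {E : Set (En N)} (hE : MeasurableSet E) (hd : ∀ x ∈ E, DifferentiableAt ℝ s x) :
    MAm univ g E ≤ ∫⁻ x in E, ENNReal.ofReal |(fderiv ℝ s x).det| := by
  have : ⋃ x ∈ E, subgrad univ g x = s '' E := by
    ext p
    simp only [mem_iUnion, mem_image, exists_prop]
    refine exists_congr fun x => and_congr_right fun hx => ?_
    rw [h.subgrad_eq (hd x hx), mem_singleton_iff, eq_comm]
  rw [MAm, this]
  exact addHaar_image_le_lintegral_abs_det_fderiv volume hE
    fun x hx => (hd x hx).hasFDerivAt.hasFDerivWithinAt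

/-- If the Monge–Ampère measure has a density, it is the Hessian determinant. -/
lemma IsSel.det_ae_eq {g : En N → ℝ} {s : En N → En N} (h : IsSel g s)
    (hg : ConvexOn ℝ univ g) {K : NNReal} (hK : LipschitzWith K g) {O : Set (En N)}
    (hO : MeasurableSet O) {k : En N → ℝ≥0∞} (hk : AEMeasurable k (volume.restrict O))
    (hMA : ∀ E ⊆ O, MeasurableSet E → MAm univ g E = ∫⁻ x in E, k x) :
    ∀ᵐ x ∂(volume.restrict O), ENNReal.ofReal |(fderiv ℝ s x).det| = k x := by
  refine ae_eq_of_forall_setLIntegral_eq_of_sigmaFinite₀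
    (measurable_ofReal_abs_det_fderiv s).aemeasurable hk fun E hE _ => ?_
  rw [restrict_restrict hE]
  have hEO : MeasurableSet (E ∩ O) := hE.inter hO
  refine le_antisymm ?_ ?_
  · rw [← hMA _ inter_subset_right hEO]
    exact h.lintegral_det_le_MAm hg hK hEO
  · obtain ⟨T, hTs, hTm, hT0⟩ := exists_measurable_superset_of_null
      (ae_iff.1 (h.ae_differentiableAt hg hK))
    have hgood : ∀ x ∉ T, DifferentiableAt ℝ s x := by
      intro x hx
      by_contra hn
      exact hx (hTs fun h' => hn h'.1)
    calc ∫⁻ x in E ∩ O, k x = ∫⁻ x in (E ∩ O) \ T, k x :=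
          setLIntegral_congr (sdiff_null_ae_eq_self hT0).symm
      _ = MAm univ g ((E ∩ O) \ T) :=
          (hMA _ (sdiff_subset.trans inter_subset_right) (hEO.diff hTm)).symm
      _ ≤ ∫⁻ x in (E ∩ O) \ T, ENNReal.ofReal |(fderiv ℝ s x).det| :=
          h.MAm_le_lintegral_det (hEO.diff hTm) fun x hx => hgood x hx.2
      _ ≤ _ := lintegral_mono_set sdiff_subset

/-- Second order Taylor expansion along a direction. -/
def HasTaylor (φ : ℝ → ℝ) (a b c : ℝ) : Prop :=
  (fun t => φ t - (a + b * t + c / 2 * t ^ 2)) =o[𝓝[>] 0] fun t => t ^ 2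

/-- One-sided second order expansion from one-sided bounds on a derivative selection. -/
lemma le_of_slope_bound {r : ℝ → ℝ} {t₀ A B M : ℝ} (hr : ContinuousOn r (Icc 0 t₀))
    (hsl : ∀ a b, 0 ≤ a → a < b → b < t₀ → r b - r a ≤ (A + B * a + M * (b - a)) * (b - a))
    {t : ℝ} (ht0 : 0 ≤ t) (ht : t ≤ t₀) :
    r t ≤ r 0 + A * t + B / 2 * t ^ 2 := by
  have hBd : ∀ x : ℝ, HasDerivAt (fun t => r 0 + A * t + B / 2 * t ^ 2) (A + B * x) x := by
    intro x
    have h1 : HasDerivAt (fun t : ℝ => r 0 + A * t) A x := by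
      simpa using ((hasDerivAt_id x).const_mul A).const_add (r 0)
    have h2 : HasDerivAt (fun t : ℝ => B / 2 * t ^ 2) (B * x) x := by
      exact ((hasDerivAt_pow 2 x).const_mul (B / 2)).congr_deriv (by simp; ring)
    exact h1.add h2
  refine image_le_of_liminf_slope_right_le_deriv_boundary (a := 0) (b := t₀)
    (B := fun t => r 0 + A * t + B / 2 * t ^ 2) (B' := fun t => A + B * t) hr (by simp) ?_ ?_ ?_
    ⟨ht0, ht⟩
  · exact fun x _ => (hBd x).continuousAt.continuousWithinAt
  · exact fun x _ => (hBd x).hasDerivWithinAt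
  · intro x hx q hq
    have hc : ContinuousAt (fun z : ℝ => A + B * x + M * (z - x)) x := by fun_prop
    have h1 : ∀ᶠ z in 𝓝[>] x, A + B * x + M * (z - x) < q :=
      eventually_nhdsWithin_of_eventually_nhds
        (hc.eventually_lt continuousAt_const (by simpa using hq))
    have h2 : ∀ᶠ z in 𝓝[>] x, z < t₀ :=
      eventually_nhdsWithin_of_eventually_nhds (gt_mem_nhds hx.2)
    refine Eventually.frequently ?_
    filter_upwards [h1, h2, self_mem_nhdsWithin] with z hz1 hz2 hz3
    have hz3 : x < z := hz3
    have hz0 : 0 < z - x := sub_pos.2 hz3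
    rw [slope_def_field, div_lt_iff₀ hz0]
    refine (hsl x z hx.1 hz3 hz2).trans_lt ?_
    exact mul_lt_mul_of_pos_right hz1 hz0

lemma IsSel.hasTaylor {g : En N → ℝ} {s : En N → En N} (h : IsSel g s) (hc : Continuous g)
    {x : En N} {H : En N →L[ℝ] En N} (hx : HasFDerivAt s H x) (d : En N) :
    HasTaylor (fun t => g (x + t • d)) (g x) ⟪s x, d⟫ ⟪H d, d⟫ := by
  rw [HasTaylor, Asymptotics.isLittleO_iff]
  intro c hc0
  set σ : ℝ → ℝ := fun t => ⟪s (x + t • d), d⟫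
  have hσ : HasDerivAt σ ⟪H d, d⟫ 0 := by
    have h1 : HasDerivAt (fun t : ℝ => x + t • d) d 0 := by
      simpa using ((hasDerivAt_id (0:ℝ)).smul_const d).const_add x
    have hx' : HasFDerivAt s H (x + (0:ℝ) • d) := by simpa using hx
    have h2 := hx'.comp_hasDerivAt (0:ℝ) h1
    have h3 := h2.inner ℝ (hasDerivAt_const (0:ℝ) d)
    simpa using h3
  rw [hasDerivAt_iff_isLittleO, Asymptotics.isLittleO_iff] at hσ
  obtain ⟨t₀, ht₀, hball⟩ := Metric.eventually_nhds_iff.1 (hσ hc0)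
  have hσb : ∀ b, 0 < b → b < t₀ → |σ b - σ 0 - b * ⟪H d, d⟫| ≤ c * b := by
    intro b hb hb'
    have := hball (y := b) (by simpa [abs_of_pos hb] using hb')
    simpa [abs_of_pos hb] using this
  have hσ0 : σ 0 = ⟪s x, d⟫ := by simp [σ]
  have hsl : ∀ a b : ℝ, g (x + a • d) + σ a * (b - a) ≤ g (x + b • d) := by
    intro a b
    have := h (x + a • d) (x + b • d)
    have h3 : x + b • d - (x + a • d) = (b - a) • d := by rw [sub_smul]; abel
    rw [h3, inner_smul_right] at this
    linarith [mul_comm (b - a) (σ a)]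
  have hrc : Continuous fun t : ℝ => g (x + t • d) := by fun_prop
  filter_upwards [Ioo_mem_nhdsGT (half_pos ht₀)] with t ht
  have hup := le_of_slope_bound (r := fun t => g (x + t • d)) (t₀ := t₀)
    (A := σ 0) (B := ⟪H d, d⟫ + c) (M := ⟪H d, d⟫ + c) hrc.continuousOn ?_ ht.1.le
    (by linarith [ht.2])
  · have hlo := le_of_slope_bound (r := fun t => - g (x + t • d)) (t₀ := t₀) (A := - σ 0)
      (B := - (⟪H d, d⟫ - c)) (M := 0) hrc.neg.continuousOn ?_ ht.1.le (by linarith [ht.2])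
    · simp only [zero_smul, add_zero] at hup hlo
      rw [Real.norm_eq_abs, Real.norm_eq_abs, abs_of_nonneg (sq_nonneg t), abs_le, ← hσ0]
      have := sq_nonneg t
      constructor <;> nlinarith
    · intro a b ha hab hb
      have h1 := hsl a b
      have h2 : -σ a ≤ - σ 0 + -(⟪H d, d⟫ - c) * a := by
        rcases ha.eq_or_lt with rfl | ha'
        · simp
        · have := (abs_le.1 (hσb a ha' (hab.trans hb))).1
          linarith
      have h3 := mul_le_mul_of_nonneg_right h2 (sub_pos.2 hab).le
      linarith
  · intro a b ha hab hb
    have h1 := hsl b a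
    have h2 := (abs_le.1 (hσb b (ha.trans_lt hab) hb)).2
    have h3 : σ b ≤ σ 0 + (⟪H d, d⟫ + c) * a + (⟪H d, d⟫ + c) * (b - a) := by linarith
    have h4 := mul_le_mul_of_nonneg_right h3 (sub_pos.2 hab).le
    linarith

end

section

open Filter Topology Matrix

variable {N : ℕ}

lemma one_add_sum_le_prod {ι : Type*} (t : Finset ι) {w : ι → ℝ} (hw : ∀ i, 0 ≤ w i) :
    1 + ∑ i ∈ t, w i ≤ ∏ i ∈ t, (1 + w i) := by
  classical
  induction t using Finset.induction_on with
  | empty => simp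
  | insert i t hi ih =>
    rw [Finset.sum_insert hi, Finset.prod_insert hi]
    have h1 : 0 ≤ ∑ i ∈ t, w i := Finset.sum_nonneg fun i _ => hw i
    nlinarith [hw i, mul_le_mul_of_nonneg_left ih (by linarith [hw i] : 0 ≤ 1 + w i)]

lemma one_add_trace_le_det {W : Matrix (Fin N) (Fin N) ℝ} (hW : W.PosSemidef) :
    1 + W.trace ≤ (1 + W).det := by
  have h1 : (1 + W).det = ∏ i, (1 + hW.1.eigenvalues i) := by
    have e1 := W.eval_charpoly (-1)
    rw [hW.1.charpoly_eq] at e1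
    have e2 : Matrix.scalar (Fin N) (-1 : ℝ) - W = -(1 + W) := by
      simp only [map_neg, map_one]; abel
    rw [e2, det_neg, Fintype.card_fin, Polynomial.eval_prod] at e1
    simp only [Polynomial.eval_sub, Polynomial.eval_X, Polynomial.eval_C] at e1
    have e3 : ∏ i, (-1 - (hW.1.eigenvalues i : ℝ)) = (-1) ^ N * ∏ i, (1 + hW.1.eigenvalues i) := by
      have : ∀ i, (-1 - (hW.1.eigenvalues i : ℝ)) = (-1) * (1 + hW.1.eigenvalues i) := by
        intro i; ring
      simp_rw [this, Finset.prod_mul_distrib]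
      simp
    have e4 : ((-1 : ℝ) ^ N) ≠ 0 := by positivity
    have e5 := e3.symm.trans e1
    exact (mul_left_cancel₀ e4 e5).symm
  rw [h1, hW.1.trace_eq_sum_eigenvalues]
  exact one_add_sum_le_prod _ fun i => hW.eigenvalues_nonneg i

lemma det_le_trace_pow {W : Matrix (Fin N) (Fin N) ℝ} (hW : W.PosSemidef) :
    W.det ≤ W.trace ^ N := by
  rw [hW.1.det_eq_prod_eigenvalues, hW.1.trace_eq_sum_eigenvalues]
  have h0 : ∀ i, 0 ≤ hW.1.eigenvalues i := fun i => hW.eigenvalues_nonneg i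
  calc ∏ i, (hW.1.eigenvalues i : ℝ) ≤ ∏ _i : Fin N, ∑ j, hW.1.eigenvalues j :=
        Finset.prod_le_prod (fun i _ => h0 i)
          fun i _ => Finset.single_le_sum (fun j _ => h0 j) (Finset.mem_univ i)
    _ = _ := by simp

open scoped MatrixOrder ComplexOrder in
/-- A positive definite matrix is congruent to the identity. -/
lemma exists_conjTranspose_mul_self {Q : Matrix (Fin N) (Fin N) ℝ} (hQ : Q.PosSemidef)
    (hdet : Q.det ≠ 0) : ∃ S : Matrix (Fin N) (Fin N) ℝ, Q = Sᴴ * S ∧ IsUnit S.det := by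
  obtain ⟨S, hS⟩ := CStarAlgebra.nonneg_iff_eq_star_mul_self.mp hQ.nonneg
  rw [star_eq_conjTranspose] at hS
  refine ⟨S, hS, isUnit_iff_ne_zero.2 fun h0 => hdet ?_⟩
  rw [hS, det_mul, h0, mul_zero]

lemma det_add_ge {Q W : Matrix (Fin N) (Fin N) ℝ} {S : Matrix (Fin N) (Fin N) ℝ}
    (hQ : Q = Sᴴ * S) (hW : W.PosSemidef) :
    Q.det * (1 + W.trace) ≤ (Q + Sᴴ * W * S).det := by
  have h1 : Q + Sᴴ * W * S = Sᴴ * (1 + W) * S := by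
    rw [mul_add, add_mul, mul_one, hQ]
  rw [h1, det_mul, det_mul, hQ, det_mul, det_conjTranspose]
  simp only [star_trivial]
  have := one_add_trace_le_det hW
  nlinarith [mul_le_mul_of_nonneg_left this (mul_self_nonneg S.det)]

lemma eq_conj_inv {X S : Matrix (Fin N) (Fin N) ℝ} (hS : IsUnit S.det) :
    X = Sᴴ * ((S⁻¹)ᴴ * X * S⁻¹) * S := by
  have h1 : Sᴴ * (S⁻¹)ᴴ = 1 := by
    rw [← conjTranspose_mul, nonsing_inv_mul _ hS, conjTranspose_one]
  calc X = 1 * X * 1 := by simp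
    _ = (Sᴴ * (S⁻¹)ᴴ) * X * (S⁻¹ * S) := by rw [h1, nonsing_inv_mul _ hS]
    _ = _ := by simp only [Matrix.mul_assoc]

/-- The determinant is monotone on positive semidefinite matrices. -/
lemma det_le_det_add {A C : Matrix (Fin N) (Fin N) ℝ} (hA : A.PosSemidef) (hC : C.PosSemidef) :
    A.det ≤ (A + C).det := by
  rcases eq_or_ne A.det 0 with h0 | h0
  · rw [h0]; exact (hA.add hC).det_nonneg
  obtain ⟨S, hS, hu⟩ := exists_conjTranspose_mul_self hA h0
  have hW := hC.conjTranspose_mul_mul_same S⁻¹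
  have h1 := det_add_ge hS hW
  rw [← eq_conj_inv hu] at h1
  refine le_trans ?_ h1
  nlinarith [hW.trace_nonneg, hA.det_nonneg, mul_nonneg hA.det_nonneg hW.trace_nonneg]

lemma dotProduct_mulVec_le {S : Matrix (Fin N) (Fin N) ℝ} (η : Fin N → ℝ) :
    (Sᴴ *ᵥ η) ⬝ᵥ (Sᴴ *ᵥ η) ≤ (Sᴴ * S).trace * (η ⬝ᵥ η) := by
  simp only [dotProduct, mulVec, conjTranspose_apply, star_trivial, trace, diag, Matrix.mul_apply]
  rw [Finset.sum_mul]
  refine Finset.sum_le_sum fun i _ => ?_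
  have h := Finset.sum_mul_sq_le_sq_mul_sq Finset.univ (fun j => S j i) η
  calc (∑ j, S j i * η j) * (∑ j, S j i * η j) = (∑ j, S j i * η j) ^ 2 := by ring
    _ ≤ _ := h
    _ = _ := by simp only [pow_two]

/-- The quantitative determinant comparison behind the maximum principle. -/
lemma det_comparison {P Q X : Matrix (Fin N) (Fin N) ℝ} {ξ : Fin N → ℝ} {α σ C : ℝ}
    (hQ : Q.PosSemidef) (hdet : Q.det ≠ 0) (hX : X.PosSemidef) (hα : 0 ≤ α)
    (hσ : 0 < σ) (hσ2 : σ ≤ 1 / 2)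
    (hP : (P - ((1 - σ) • Q + σ • (X + α • vecMulVec ξ ξ))).PosSemidef)
    (hPQ : P.det ≤ (1 + C * σ) * Q.det) :
    X.det ≤ (2 ^ N * (C + N)) ^ N * Q.det ∧ α * (ξ ⬝ᵥ ξ) ≤ 2 ^ N * (C + N) * Q.trace := by
  obtain ⟨S, hS, hu⟩ := exists_conjTranspose_mul_self hQ hdet
  set R : Matrix (Fin N) (Fin N) ℝ := vecMulVec ξ ξ
  have hR : R.PosSemidef := by simpa using posSemidef_vecMulVec_self_star ξ
  set Y := X + α • R with hY
  have hYp : Y.PosSemidef := hX.add (hR.smul hα)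
  set Z := (S⁻¹)ᴴ * Y * S⁻¹ with hZ
  have hZp : Z.PosSemidef := hYp.conjTranspose_mul_mul_same S⁻¹
  have hQdet : 0 < Q.det := lt_of_le_of_ne hQ.det_nonneg hdet.symm
  have hσ1 : (0 : ℝ) < 1 - σ := by linarith
  have hτ : 0 ≤ σ / (1 - σ) := by positivity
  have h1 : (1 - σ) ^ N * (Q.det * (1 + σ / (1 - σ) * Z.trace)) ≤ P.det := by
    have e1 := det_add_ge hS (hZp.smul hτ)
    have e2 : (1 - σ) • Q + σ • Y = (1 - σ) • (Q + Sᴴ * ((σ / (1 - σ)) • Z) * S) := by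
      rw [Matrix.mul_smul, Matrix.smul_mul, ← eq_conj_inv hu, smul_add (1 - σ) Q, smul_smul (1 - σ),
        mul_div_cancel₀ _ hσ1.ne']
    have e3 : ((1 - σ) • Q + σ • Y).PosSemidef := (hQ.smul hσ1.le).add (hYp.smul hσ.le)
    have e4 := det_le_det_add e3 hP
    rw [add_sub_cancel, e2, det_smul, Fintype.card_fin] at e4
    rw [trace_smul, smul_eq_mul] at e1
    exact (mul_le_mul_of_nonneg_left e1 (by positivity)).trans e4
  have h2 : (1 - σ) ^ N * (1 + σ / (1 - σ) * Z.trace) ≤ 1 + C * σ := by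
    have := h1.trans hPQ
    refine le_of_mul_le_mul_right ?_ hQdet
    linarith
  have hbern : 1 - N * σ ≤ (1 - σ) ^ N := by
    have := one_add_mul_le_pow (a := -σ) (by linarith) N
    rw [← sub_eq_add_neg] at this
    linarith
  have hhalf : (1 / 2 : ℝ) ^ N ≤ (1 - σ) ^ N := pow_le_pow_left₀ (by norm_num) (by linarith) N
  have htr : 0 ≤ Z.trace := hZp.trace_nonneg
  have hστ : σ ≤ σ / (1 - σ) := by
    rw [le_div_iff₀ hσ1]; nlinarith
  have h3 : Z.trace ≤ 2 ^ N * (C + N) := by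
    have e1 : (1 / 2 : ℝ) ^ N * (σ * Z.trace) ≤ (1 - σ) ^ N * (σ / (1 - σ) * Z.trace) := by
      gcongr
    have e2 : (1 / 2 : ℝ) ^ N * (σ * Z.trace) ≤ (C + N) * σ := by linarith
    have e3 : (1 / 2 : ℝ) ^ N * Z.trace ≤ C + N := by
      refine le_of_mul_le_mul_right ?_ hσ
      linarith
    have e4 : (2 : ℝ) ^ N * ((1 / 2 : ℝ) ^ N * Z.trace) = Z.trace := by
      rw [← mul_assoc, ← mul_pow]; norm_num
    rw [← e4]
    gcongr
  have hXd : X = Sᴴ * ((S⁻¹)ᴴ * X * S⁻¹) * S := eq_conj_inv hu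
  set Z₁ := (S⁻¹)ᴴ * X * S⁻¹
  have hZ₁ : Z₁.PosSemidef := hX.conjTranspose_mul_mul_same S⁻¹
  set η := (S⁻¹)ᴴ *ᵥ ξ with hη
  have hRη : (S⁻¹)ᴴ * R * S⁻¹ = vecMulVec η η := by
    rw [hη, mul_vecMulVec, vecMulVec_mul, ← mulVec_transpose]
    rw [conjTranspose_eq_transpose_of_trivial]
  have hZsum : Z.trace = Z₁.trace + α * (η ⬝ᵥ η) := by
    have : Z = Z₁ + α • vecMulVec η η := by
      rw [hZ, hY, mul_add, add_mul, Matrix.mul_smul, Matrix.smul_mul, hRη]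
    rw [this, trace_add, trace_smul, trace_vecMulVec, smul_eq_mul]
  have hηη : 0 ≤ η ⬝ᵥ η := Finset.sum_nonneg fun i _ => mul_self_nonneg _
  have hZ₁t := hZ₁.trace_nonneg
  constructor
  · have e1 : X.det = Q.det * Z₁.det := by
      have e0 : X.det = (Sᴴ * Z₁ * S).det := congrArg _ hXd
      rw [e0, hS, det_mul, det_mul Sᴴ Z₁, det_mul Sᴴ S]; ring
    rw [e1, mul_comm]
    refine mul_le_mul_of_nonneg_right ((det_le_trace_pow hZ₁).trans ?_) hQdet.le
    refine pow_le_pow_left₀ hZ₁t ?_ N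
    have := mul_nonneg hα hηη
    linarith
  · have e1 : ξ = Sᴴ *ᵥ η := by
      rw [hη, mulVec_mulVec, ← conjTranspose_mul, nonsing_inv_mul _ hu, conjTranspose_one,
        one_mulVec]
    have e2 := dotProduct_mulVec_le (S := S) η
    rw [← e1, ← hS] at e2
    have e3 : α * (η ⬝ᵥ η) ≤ 2 ^ N * (C + N) := by linarith
    have e4 := mul_le_mul_of_nonneg_left e2 hα
    have e5 := mul_le_mul_of_nonneg_right e3 hQ.trace_nonneg
    linarith

/-- The matrix of an operator in the standard orthonormal basis. -/
def opMatrix (H : En N →L[ℝ] En N) : Matrix (Fin N) (Fin N) ℝ :=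
  LinearMap.toMatrix (EuclideanSpace.basisFun (Fin N) ℝ).toBasis
    (EuclideanSpace.basisFun (Fin N) ℝ).toBasis H

lemma opMatrix_det (H : En N →L[ℝ] En N) : (opMatrix H).det = H.det :=
  LinearMap.det_toMatrix _ _

lemma opMatrix_posSemidef {H : En N →L[ℝ] En N} (hs : ∀ v w, ⟪H v, w⟫ = ⟪v, H w⟫)
    (hp : ∀ d, 0 ≤ ⟪H d, d⟫) : (opMatrix H).PosSemidef :=
  (LinearMap.posSemidef_toMatrix_iff _).2 ⟨hs, hp⟩

lemma opMatrix_trace (H : En N →L[ℝ] En N) : (opMatrix H).trace =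
    ∑ i, ⟪H (EuclideanSpace.basisFun (Fin N) ℝ i), EuclideanSpace.basisFun (Fin N) ℝ i⟫ := by
  rw [trace]
  refine Finset.sum_congr rfl fun i _ => ?_
  rw [diag_apply, opMatrix, LinearMap.toMatrix_apply, real_inner_comm]
  simp [EuclideanSpace.inner_single_left]

lemma opMatrix_rankOne (ξ : En N) :
    opMatrix ((innerSL ℝ ξ).smulRight ξ) = vecMulVec ξ ξ := by
  ext i j
  rw [opMatrix, LinearMap.toMatrix_apply]
  simp [vecMulVec_apply, mul_comm, EuclideanSpace.inner_single_right]

lemma det_nonneg_of_psd {H : En N →L[ℝ] En N} (hs : ∀ v w, ⟪H v, w⟫ = ⟪v, H w⟫)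
    (hp : ∀ d, 0 ≤ ⟪H d, d⟫) : 0 ≤ H.det := by
  rw [← opMatrix_det]; exact (opMatrix_posSemidef hs hp).det_nonneg

lemma det_le_det_add_op {H K : En N →L[ℝ] En N} (hs : ∀ v w, ⟪H v, w⟫ = ⟪v, H w⟫)
    (hp : ∀ d, 0 ≤ ⟪H d, d⟫) (hs' : ∀ v w, ⟪K v, w⟫ = ⟪v, K w⟫) (hp' : ∀ d, 0 ≤ ⟪K d, d⟫) :
    H.det ≤ (H + K).det := by
  have h := det_le_det_add (opMatrix_posSemidef hs hp) (opMatrix_posSemidef hs' hp')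
  rw [opMatrix_det] at h
  rw [← opMatrix_det (H + K)]
  simpa [opMatrix] using h

lemma det_comparison_op {P Q X : En N →L[ℝ] En N} {ξ : En N} {α σ C : ℝ}
    (hPs : ∀ v w, ⟪P v, w⟫ = ⟪v, P w⟫) (hQs : ∀ v w, ⟪Q v, w⟫ = ⟪v, Q w⟫)
    (hXs : ∀ v w, ⟪X v, w⟫ = ⟪v, X w⟫) (hQ : ∀ d, 0 ≤ ⟪Q d, d⟫) (hX : ∀ d, 0 ≤ ⟪X d, d⟫)
    (hdet : Q.det ≠ 0) (hα : 0 ≤ α) (hσ : 0 < σ) (hσ2 : σ ≤ 1 / 2)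
    (hP : ∀ d, (1 - σ) * ⟪Q d, d⟫ + σ * (⟪X d, d⟫ + α * ⟪ξ, d⟫ ^ 2) ≤ ⟪P d, d⟫)
    (hPQ : P.det ≤ (1 + C * σ) * Q.det) :
    X.det ≤ (2 ^ N * (C + N)) ^ N * Q.det ∧ α * ‖ξ‖ ^ 2 ≤ 2 ^ N * (C + N) *
      ∑ i, ⟪Q (EuclideanSpace.basisFun (Fin N) ℝ i), EuclideanSpace.basisFun (Fin N) ℝ i⟫ := by
  have hd : (opMatrix P - ((1 - σ) • opMatrix Q + σ • (opMatrix X + α • vecMulVec ξ ξ)))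
      = opMatrix (P - ((1 - σ) • Q + σ • (X + α • (innerSL ℝ ξ).smulRight ξ))) := by
    rw [← opMatrix_rankOne]
    simp [opMatrix]
  have h := det_comparison (P := opMatrix P) (Q := opMatrix Q) (X := opMatrix X) (ξ := ξ)
    (opMatrix_posSemidef hQs hQ) (by rwa [opMatrix_det]) (opMatrix_posSemidef hXs hX) hα hσ hσ2
    (by
      rw [hd]
      refine opMatrix_posSemidef (fun v w => ?_) fun d => ?_
      · simp only [_root_.sub_apply, _root_.add_apply, _root_.smul_apply,
          ContinuousLinearMap.smulRight_apply,
          innerSL_apply_apply, inner_sub_left, inner_sub_right, inner_add_left, inner_add_right,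
          real_inner_smul_left, real_inner_smul_right, hPs v w, hQs v w, hXs v w]
        rw [real_inner_comm ξ v]; ring
      · have := hP d
        simp only [_root_.sub_apply, _root_.add_apply, _root_.smul_apply,
          ContinuousLinearMap.smulRight_apply,
          innerSL_apply_apply, inner_sub_left, inner_add_left, real_inner_smul_left]
        linarith)
    (by rwa [opMatrix_det, opMatrix_det])
  rw [opMatrix_det, opMatrix_det, opMatrix_trace] at h
  refine ⟨h.1, ?_⟩
  have e : ‖ξ‖ ^ 2 = ξ.ofLp ⬝ᵥ ξ.ofLp := by
    rw [EuclideanSpace.real_norm_sq_eq]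
    simp [dotProduct, pow_two]
  rw [e]; exact h.2

end

section

open Filter Topology Measure

variable {N : ℕ}

lemma IsSel.convexOn {g : En N → ℝ} {s : En N → En N} (h : IsSel g s) : ConvexOn ℝ univ g := by
  refine ⟨convex_univ, fun x _ y _ a b ha hb hab => ?_⟩
  have h1 := h (a • x + b • y) x
  have h2 := h (a • x + b • y) y
  set z := a • x + b • y with hz
  have h3 : a * ⟪s z, x - z⟫ + b * ⟪s z, y - z⟫ = 0 := by
    rw [← real_inner_smul_right, ← real_inner_smul_right, ← inner_add_right]
    have : a • (x - z) + b • (y - z) = 0 := by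
      have : a • (x - z) + b • (y - z) = (a • x + b • y) - (a + b) • z := by module
      rw [this, hab, one_smul, hz, sub_self]
    rw [this, inner_zero_right]
  simp only [smul_eq_mul]
  have e : g z = a * g z + b * g z := by rw [← add_mul, hab, one_mul]
  nlinarith [mul_le_mul_of_nonneg_left h1 ha, mul_le_mul_of_nonneg_left h2 hb]

lemma IsSel.lipschitzWith {g : En N → ℝ} {s : En N → En N} (h : IsSel g s) {K : NNReal}
    (hs : ∀ x, ‖s x‖ ≤ K) : LipschitzWith K g := by
  refine LipschitzWith.of_le_add_mul K fun x y => ?_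
  have h1 := h x y
  have h2 := (abs_le.1 (abs_real_inner_le_norm (s x) (y - x))).1
  have h3 := mul_le_mul_of_nonneg_right (hs x) (norm_nonneg (y - x))
  rw [dist_comm, dist_eq_norm]
  linarith

/-- The Moreau envelope of a Lipschitz convex function and its Yosida gradient. -/
lemma exists_moreau {a : En N → ℝ} (ha : ConvexOn ℝ univ a) {K : NNReal} (hK : LipschitzWith K a)
    {t : ℝ} (ht : 0 < t) :
    ∃ (g : En N → ℝ) (R : En N → En N), IsSel g R ∧ (∃ L, LipschitzWith L R) ∧
      (∀ z, ‖R z‖ ≤ K) ∧ (∀ x, ∀ p ∈ subgrad univ a x, R (x + t • p) = p) ∧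
      ∀ z, |g z - a z| ≤ t * K ^ 2 := by
  have hta : LipschitzWith (t.toNNReal * K) fun x => t * a x := by
    refine LipschitzWith.of_dist_le_mul fun x y => ?_
    rw [Real.dist_eq, ← mul_sub, abs_mul, abs_of_pos ht, ← Real.dist_eq, NNReal.coe_mul,
      Real.coe_toNNReal _ ht.le, mul_assoc]
    exact mul_le_mul_of_nonneg_left (hK.dist_le_mul x y) ht.le
  obtain ⟨J, hJ, hJs, hJx⟩ := exists_resolvent (ha.smul ht.le) hta
  set R : En N → En N := fun z => t⁻¹ • (z - J z) with hR
  have hJR : ∀ z, z - J z = t • R z := fun z => by simp [hR, smul_smul, ht.ne']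
  have hRm : ∀ z, R z ∈ subgrad univ a (J z) := by
    intro z y _
    have h1 := hJs z y (mem_univ y)
    simp only [smul_eq_mul] at h1
    rw [hJR, real_inner_smul_left] at h1
    nlinarith
  have hRn : ∀ z, ‖R z‖ ≤ K := fun z => subgrad_norm_le hK (hRm z)
  refine ⟨fun z => a (J z) + t * ‖R z‖ ^ 2 / 2, R, fun z w => ?_, ⟨t⁻¹.toNNReal * 2, ?_⟩, hRn,
    fun x p hp => ?_, fun z => ?_⟩
  · have h1 := hRm z (J w) (mem_univ _)
    have h2 : J w - J z = (w - z) - t • (R w - R z) := by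
      rw [smul_sub, ← hJR, ← hJR]; abel
    rw [h2, inner_sub_right (R z) (w - z), real_inner_smul_right, inner_sub_right (R z) (R w),
      real_inner_self_eq_norm_sq] at h1
    have h3 : 0 ≤ ‖R w - R z‖ ^ 2 := by positivity
    rw [norm_sub_sq_real, real_inner_comm] at h3
    dsimp only
    nlinarith
  · have hd : LipschitzWith (1 + 1) fun z => z - J z := LipschitzWith.id.sub hJ
    refine LipschitzWith.of_dist_le_mul fun x y => ?_
    have := hd.dist_le_mul x y
    rw [hR, dist_eq_norm, ← smul_sub, norm_smul, Real.norm_eq_abs, abs_of_pos (inv_pos.2 ht),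
      NNReal.coe_mul, Real.coe_toNNReal _ (inv_pos.2 ht).le, mul_assoc, ← dist_eq_norm]
    refine mul_le_mul_of_nonneg_left (this.trans (le_of_eq ?_)) (inv_pos.2 ht).le
    norm_num
  · have h1 : t • p ∈ subgrad univ (fun x => t • a x) x := by
      intro y hy
      have := hp y hy
      simp only [smul_eq_mul]
      rw [real_inner_smul_left]
      nlinarith
    have h2 := hJx x _ h1
    rw [hR]
    simp [h2, smul_smul, ht.ne']
  · have h1 := hRm z z (mem_univ _)
    rw [hJR, real_inner_smul_right, real_inner_self_eq_norm_sq] at h1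
    have h2 := hK.dist_le_mul z (J z)
    rw [Real.dist_eq, dist_eq_norm, hJR, norm_smul, Real.norm_eq_abs, abs_of_pos ht] at h2
    have h3 := abs_le.1 h2
    have h4 : K * (t * ‖R z‖) ≤ t * K ^ 2 := by
      have := mul_le_mul_of_nonneg_left (hRn z) (mul_nonneg ht.le K.coe_nonneg)
      linarith
    have h5 : 0 ≤ t * ‖R z‖ ^ 2 := by positivity
    rw [abs_le]
    constructor <;> dsimp only <;> nlinarith

/-- Subgradients pass to limits. -/
lemma mem_subgrad_of_tendsto {ι : Type*} {l : Filter ι} [l.NeBot] {g : En N → ℝ}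
    (hg : Continuous g) {gk : ι → En N → ℝ} {η : ι → ℝ} (hη : Tendsto η l (𝓝 0))
    (hgk : ∀ k z, |gk k z - g z| ≤ η k) {z p : ι → En N} {z₀ p₀ : En N}
    (hz : Tendsto z l (𝓝 z₀)) (hp : Tendsto p l (𝓝 p₀))
    (hm : ∀ k, p k ∈ subgrad univ (gk k) (z k)) : p₀ ∈ subgrad univ g z₀ := by
  intro y _
  have h1 : Tendsto (fun k => g (z k) + ⟪p k, y - z k⟫ - 2 * η k) l
      (𝓝 (g z₀ + ⟪p₀, y - z₀⟫ - 2 * 0)) :=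
    ((hg.tendsto z₀).comp hz |>.add (hp.inner (tendsto_const_nhds.sub hz))).sub
      (hη.const_mul 2)
  rw [mul_zero, sub_zero] at h1
  refine le_of_tendsto h1 (Eventually.of_forall fun k => ?_)
  have h2 := hm k y (mem_univ y)
  have h3 := abs_le.1 (hgk k (z k))
  have h4 := abs_le.1 (hgk k y)
  linarith

lemma isCompact_subgrad_image {g : En N → ℝ} {K : NNReal} (hK : LipschitzWith K g)
    {E : Set (En N)} (hE : IsCompact E) : IsCompact (⋃ x ∈ E, subgrad univ g x) := by
  have h1 : IsCompact (E ×ˢ Metric.closedBall (0 : En N) K) := hE.prod (isCompact_closedBall _ _)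
  have h2 : IsClosed {q : En N × En N | q.2 ∈ subgrad univ g q.1} := by
    have : {q : En N × En N | q.2 ∈ subgrad univ g q.1} =
        ⋂ y, {q : En N × En N | g q.1 + ⟪q.2, y - q.1⟫ ≤ g y} := by
      ext q; simp [subgrad]
    rw [this]
    refine isClosed_iInter fun y => isClosed_le ?_ continuous_const
    have := hK.continuous
    fun_prop
  convert (h1.inter_right h2).image continuous_snd using 1
  ext p
  simp only [mem_iUnion, mem_image, mem_inter_iff, mem_prod, Prod.exists]
  constructor
  · rintro ⟨x, hx, hp⟩
    exact ⟨x, p, ⟨⟨hx, by simpa using subgrad_norm_le hK hp⟩, hp⟩, rfl⟩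
  · rintro ⟨x, q, ⟨⟨hx, _⟩, hq⟩, rfl⟩
    exact ⟨x, hx, hq⟩

/-- Monotonicity of the Monge–Ampère mass under addition when the first gradient is Lipschitz. -/
lemma IsSel.volume_image_le_MAm_add {g b : En N → ℝ} {R : En N → En N} (h : IsSel g R)
    {L : NNReal} (hL : LipschitzWith L R) {K K' : NNReal} (hR : ∀ z, ‖R z‖ ≤ K)
    (hb : ConvexOn ℝ univ b) (hK' : LipschitzWith K' b) {E : Set (En N)} (hE : MeasurableSet E) :
    volume (R '' E) ≤ MAm univ (fun x => g x + b x) E := by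
  obtain ⟨s, hs⟩ := exists_isSel hb hK'.continuous
  have hgK := h.lipschitzWith hR
  have hadd := h.add hs
  have hKa : LipschitzWith (K + K') fun x => g x + b x := hgK.add hK'
  set T := {x | DifferentiableAt ℝ R x} with hT
  have hTm : MeasurableSet T := measurableSet_of_differentiableAt ℝ R
  have hae := h.ae_differentiableAt h.convexOn hgK
  have hnull : volume (E \ T) = 0 := by
    refine measure_mono_null (fun x hx => hx.2) (t := Tᶜ) ?_
    exact (ae_iff.1 (hae.mono fun x hx => hx.1))
  calc volume (R '' E) ≤ volume (R '' (E ∩ T) ∪ R '' (E \ T)) := by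
        rw [← image_union, inter_union_sdiff]
    _ ≤ volume (R '' (E ∩ T)) + volume (R '' (E \ T)) := measure_union_le _ _
    _ = volume (R '' (E ∩ T)) := by rw [volume_image_eq_zero hL hnull, add_zero]
    _ ≤ MAm univ g (E ∩ T) := by
        refine measure_mono ?_
        rintro _ ⟨x, hx, rfl⟩
        exact mem_iUnion₂.2 ⟨x, hx, h.mem x⟩
    _ ≤ ∫⁻ x in E ∩ T, ENNReal.ofReal |(fderiv ℝ R x).det| :=
        h.MAm_le_lintegral_det (hE.inter hTm) fun x hx => hx.2
    _ ≤ ∫⁻ x in E, ENNReal.ofReal |(fderiv ℝ R x).det| :=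
        lintegral_mono_set inter_subset_left
    _ ≤ ∫⁻ x in E, ENNReal.ofReal |(fderiv ℝ (fun x => R x + s x) x).det| := by
        refine lintegral_mono_ae (ae_restrict_of_ae ?_)
        filter_upwards [hae, hs.ae_differentiableAt hb hK'] with x h1 h2
        have p1 := h.inner_fderiv_nonneg h1.1.hasFDerivAt
        have p2 := hs.inner_fderiv_nonneg h2.1.hasFDerivAt
        have e : fderiv ℝ (fun x => R x + s x) x = fderiv ℝ R x + fderiv ℝ s x :=
          fderiv_fun_add h1.1 h2.1
        rw [e]
        have q1 := det_nonneg_of_psd h1.2 p1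
        have q2 := det_le_det_add_op h1.2 p1 h2.2 p2
        rw [abs_of_nonneg q1, abs_of_nonneg (q1.trans q2)]
        exact ENNReal.ofReal_le_ofReal q2
    _ ≤ MAm univ (fun x => g x + b x) E :=
        hadd.lintegral_det_le_MAm hadd.convexOn hKa hE

/-- The Monge–Ampère measure is monotone under addition of convex functions. -/
theorem MAm_le_MAm_add {a b : En N → ℝ} {K K' : NNReal} (ha : ConvexOn ℝ univ a)
    (hK : LipschitzWith K a) (hb : ConvexOn ℝ univ b) (hK' : LipschitzWith K' b)
    {E : Set (En N)} (hE : IsCompact E) :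
    MAm univ a E ≤ MAm univ (fun x => a x + b x) E := by
  refine ENNReal.le_of_forall_pos_le_add fun ε hε hfin => ?_
  have hKab : LipschitzWith (K + K') fun x => a x + b x := hK.add hK'
  obtain ⟨U, hU, hUo, hUm⟩ := (⋃ x ∈ E, subgrad univ (fun x => a x + b x) x).exists_isOpen_lt_add
    (μ := volume) hfin.ne (ENNReal.coe_pos.2 hε).ne'
  set t : ℕ → ℝ := fun k => 1 / ((k : ℝ) + 1) with htdef
  have ht : ∀ k, 0 < t k := fun k => by positivity
  have ht0 : Tendsto t atTop (𝓝 0) := tendsto_one_div_add_atTop_nhds_zero_nat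
  choose g R hsel hL hRn hRx hgc using fun k => exists_moreau ha hK (ht k)
  set Ek : ℕ → Set (En N) := fun k => Metric.cthickening (t k * K) E with hEk
  have hkey : ∃ k, (⋃ x ∈ Ek k, subgrad univ (fun x => g k x + b x) x) ⊆ U := by
    by_contra! hcon
    have : ∀ k, ∃ z ∈ Ek k, ∃ p ∈ subgrad univ (fun x => g k x + b x) z, p ∉ U := by
      intro k
      obtain ⟨p, hp, hpU⟩ := not_subset.1 (hcon k)
      obtain ⟨z, hz, hpz⟩ := mem_iUnion₂.1 hp
      exact ⟨z, hz, p, hpz, hpU⟩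
    choose z hz p hp hpU using this
    have hcomp : IsCompact (Metric.cthickening K E ×ˢ Metric.closedBall (0 : En N) (K + K')) :=
      hE.cthickening.prod (isCompact_closedBall _ _)
    have ht1 : ∀ k, t k ≤ 1 := fun k => by
      rw [htdef]
      exact (div_le_one (by positivity)).2 (by linarith [(Nat.cast_nonneg k : (0:ℝ) ≤ k)])
    have hmem : ∀ k, (z k, p k) ∈
        Metric.cthickening K E ×ˢ Metric.closedBall (0 : En N) (K + K') := by
      intro k
      refine ⟨Metric.cthickening_mono ?_ E (hz k), ?_⟩
      · exact mul_le_of_le_one_left K.2 (ht1 k)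
      · have := subgrad_norm_le (((hsel k).lipschitzWith (hRn k)).add hK') (hp k)
        simpa using this
    obtain ⟨⟨z₀, p₀⟩, -, φ, hφ, hlim⟩ := hcomp.tendsto_subseq hmem
    rw [nhds_prod_eq] at hlim
    have hz0 : Tendsto (fun k => z (φ k)) atTop (𝓝 z₀) := tendsto_fst.comp hlim
    have hp0 : Tendsto (fun k => p (φ k)) atTop (𝓝 p₀) := tendsto_snd.comp hlim
    have htφ : Tendsto (fun k => t (φ k)) atTop (𝓝 0) := ht0.comp hφ.tendsto_atTop
    have hsub : p₀ ∈ subgrad univ (fun x => a x + b x) z₀ := by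
      refine mem_subgrad_of_tendsto (gk := fun k x => g (φ k) x + b x)
        (η := fun k => t (φ k) * K ^ 2) hKab.continuous ?_ ?_ hz0 hp0 fun k => hp (φ k)
      · simpa using htφ.mul_const ((K : ℝ) ^ 2)
      · intro k x
        have := hgc (φ k) x
        rwa [add_sub_add_right_eq_sub]
    have hz0E : z₀ ∈ E := by
      have hd : Tendsto (fun k => Metric.infDist (z (φ k)) E) atTop (𝓝 (Metric.infDist z₀ E)) :=
        ((Metric.continuous_infDist_pt E).tendsto z₀).comp hz0
      have hne : E.Nonempty := by
        by_contra! h0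
        have := hz 0
        simp [hEk, h0] at this
      have hle : Metric.infDist z₀ E ≤ 0 := by
        have h2 : Tendsto (fun k => t (φ k) * K) atTop (𝓝 0) := by
          simpa using htφ.mul_const (K : ℝ)
        refine le_of_tendsto_of_tendsto hd h2 (Eventually.of_forall fun k => ?_)
        exact ENNReal.toReal_le_of_le_ofReal (mul_nonneg (ht _).le K.2)
          (Metric.mem_cthickening_iff.1 (hz (φ k)))
      exact (hE.isClosed.mem_iff_infDist_zero hne).2 (le_antisymm hle Metric.infDist_nonneg)
    have hU0 : U ∈ 𝓝 p₀ := hUo.mem_nhds (hU (mem_iUnion₂.2 ⟨z₀, hz0E, hsub⟩))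
    obtain ⟨k, hk⟩ := (hp0.eventually hU0).exists
    exact hpU _ hk
  obtain ⟨k, hk⟩ := hkey
  obtain ⟨L, hLk⟩ := hL k
  calc MAm univ a E ≤ volume (R k '' Ek k) := by
        refine measure_mono ?_
        intro p hp
        obtain ⟨x, hx, hpx⟩ := mem_iUnion₂.1 hp
        refine ⟨x + t k • p, ?_, hRx k x p hpx⟩
        refine Metric.mem_cthickening_of_dist_le _ x _ _ hx ?_
        rw [dist_eq_norm, add_sub_cancel_left, norm_smul, Real.norm_eq_abs, abs_of_pos (ht k)]
        exact mul_le_mul_of_nonneg_left (subgrad_norm_le hK hpx) (ht k).le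
    _ ≤ MAm univ (fun x => g k x + b x) (Ek k) :=
        (hsel k).volume_image_le_MAm_add hLk (hRn k) hb hK'
          Metric.isClosed_cthickening.measurableSet
    _ ≤ volume U := measure_mono hk
    _ ≤ _ := hUm.le

/-- The Monge–Ampère mass of a bounded measurable set vanishes if it does so on compact subsets. -/
lemma MAm_eq_zero_of_isCompact {g : En N → ℝ} (hg : ConvexOn ℝ univ g) {K : NNReal}
    (hK : LipschitzWith K g) {S : Set (En N)} (hS : MeasurableSet S) (hb : Bornology.IsBounded S)
    (h : ∀ C ⊆ S, IsCompact C → MAm univ g C = 0) : MAm univ g S = 0 := by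
  obtain ⟨J, hJ, hJs, hJx⟩ := exists_resolvent hg hK
  set R : En N → En N := fun z => z - J z with hR
  have hRL : LipschitzWith (1 + 1) R := LipschitzWith.id.sub hJ
  have hTm : MeasurableSet (J ⁻¹' S) := hJ.continuous.measurable hS
  have hTfin : volume (J ⁻¹' S) ≠ ∞ := by
    obtain ⟨M, hM⟩ := hb.exists_norm_le
    refine ((measure_mono fun z hz => ?_).trans_lt
      (measure_closedBall_lt_top (x := (0 : En N)) (r := M + K))).ne
    have h1 := subgrad_norm_le hK (hJs z)
    have h2 := norm_add_le (J z) (z - J z)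
    rw [add_sub_cancel] at h2
    simpa using h2.trans (add_le_add (hM _ hz) h1)
  have hex : ∀ j : ℕ, ∃ C ⊆ J ⁻¹' S, IsCompact C ∧
      volume (J ⁻¹' S \ C) < ENNReal.ofReal (1 / ((j : ℝ) + 1)) := fun j =>
    hTm.exists_isCompact_sdiff_lt hTfin (by simpa using by positivity)
  choose C hCT hCc hCv using hex
  have hnull : volume (J ⁻¹' S \ ⋃ j, C j) = 0 := by
    have hlim : Tendsto (fun j : ℕ => ENNReal.ofReal (1 / ((j : ℝ) + 1))) atTop (𝓝 0) := by
      have := ENNReal.tendsto_ofReal (tendsto_one_div_add_atTop_nhds_zero_nat (𝕜 := ℝ))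
      simpa using this
    refine le_antisymm (ge_of_tendsto' hlim fun j => ?_) bot_le
    exact (measure_mono (sdiff_subset_sdiff_right (subset_iUnion C j))).trans (hCv j).le
  have hsub : (⋃ x ∈ S, subgrad univ g x) ⊆
      (⋃ j, R '' C j) ∪ R '' (J ⁻¹' S \ ⋃ j, C j) := by
    intro p hp
    obtain ⟨x, hx, hpx⟩ := mem_iUnion₂.1 hp
    have h1 := hJx x p hpx
    have h2 : R (x + p) = p := by simp [hR, h1]
    rw [← image_iUnion, ← image_union]
    refine ⟨x + p, ?_, h2⟩
    rw [union_sdiff_self]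
    exact Or.inr (by simpa [h1] using hx)
  refine measure_mono_null hsub (measure_union_null (measure_iUnion_null fun j => ?_)
    (volume_image_eq_zero hRL hnull))
  refine measure_mono_null ?_ (h (J '' C j) (image_subset_iff.2 (hCT j))
    ((hCc j).image hJ.continuous))
  rintro _ ⟨z, hz, rfl⟩
  exact mem_iUnion₂.2 ⟨J z, mem_image_of_mem J hz, hJs z⟩

end

section

open Filter Topology Measure Asymptotics

variable {N : ℕ}

/-- The convex envelope of a continuous function on a compact set by planes of bounded slope. -/
lemma exists_envelope {D : Set (En N)} (hD : IsCompact D) (hne : D.Nonempty) {Φ : En N → ℝ}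
    (hΦ : ContinuousOn Φ D) (ρ : NNReal) :
    ∃ Γ : En N → ℝ, ConvexOn ℝ univ Γ ∧ LipschitzWith ρ Γ ∧ (∀ x ∈ D, Γ x ≤ Φ x) ∧
      ∀ q : En N, ‖q‖ ≤ ρ → ∃ x ∈ D, Γ x = Φ x ∧ q ∈ subgrad univ Γ x ∧
        ∀ y ∈ D, Φ x + ⟪q, y - x⟫ ≤ Φ y := by
  have hex : ∀ q : En N, ∃ x ∈ D, ∀ y ∈ D, Φ x + ⟪q, y - x⟫ ≤ Φ y := by
    intro q
    obtain ⟨x, hx, hmin⟩ := hD.exists_isMinOn hne (f := fun y => Φ y - ⟪q, y⟫)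
      (hΦ.sub (by fun_prop))
    refine ⟨x, hx, fun y hy => ?_⟩
    have := hmin hy
    simp only [mem_ofPred_eq] at this
    rw [inner_sub_right]; linarith
  choose X hXD hX using hex
  obtain ⟨x₁, hx₁⟩ := hne
  let ψ : Metric.closedBall (0 : En N) ρ → En N → ℝ := fun q z => Φ (X q) + ⟪(q : En N), z - X q⟫
  have hqn : ∀ q : Metric.closedBall (0 : En N) ρ, ‖(q : En N)‖ ≤ ρ := fun q =>
    mem_closedBall_zero_iff.1 q.2
  have hψ : ∀ q z w, ψ q z ≤ ψ q w + ρ * dist z w := by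
    intro q z w
    have h1 : ψ q z = ψ q w + ⟪(q : En N), z - w⟫ := by
      simp only [ψ, inner_sub_right]; ring
    have h2 := real_inner_le_norm (q : En N) (z - w)
    have h3 := mul_le_mul_of_nonneg_right (hqn q) (norm_nonneg (z - w))
    rw [h1, dist_eq_norm]
    linarith
  have hψΦ : ∀ q, ∀ x ∈ D, ψ q x ≤ Φ x := fun q x hx => hX q x hx
  have hbdd : ∀ z, BddAbove (range fun q => ψ q z) := by
    intro z
    refine ⟨Φ x₁ + ρ * dist z x₁, ?_⟩
    rintro _ ⟨q, rfl⟩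
    exact (hψ q z x₁).trans (by linarith [hψΦ q x₁ hx₁])
  have : Nonempty (Metric.closedBall (0 : En N) ρ) := ⟨⟨0, by simp⟩⟩
  have hle : ∀ q z, ψ q z ≤ ⨆ q, ψ q z := fun q z => le_ciSup (hbdd z) q
  have hΓΦ : ∀ x ∈ D, ⨆ q, ψ q x ≤ Φ x := fun x hx => ciSup_le fun q => hψΦ q x hx
  refine ⟨fun z => ⨆ q, ψ q z, ⟨convex_univ, fun x _ y _ a b ha hb hab => ?_⟩,
    LipschitzWith.of_le_add_mul ρ fun z w => ?_, hΓΦ, fun q hq => ?_⟩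
  · refine ciSup_le fun q => ?_
    have h1 : ψ q (a • x + b • y) = a * ψ q x + b * ψ q y := by
      simp only [ψ, inner_sub_right, inner_add_right, real_inner_smul_right]
      have : Φ (X q) - ⟪(q : En N), X q⟫ = (a + b) * (Φ (X q) - ⟪(q : En N), X q⟫) := by
        rw [hab, one_mul]
      linarith
    rw [h1]
    exact add_le_add (mul_le_mul_of_nonneg_left (hle q x) ha)
      (mul_le_mul_of_nonneg_left (hle q y) hb)
  · exact ciSup_le fun q => (hψ q z w).trans (by linarith [hle q w])
  · let q' : Metric.closedBall (0 : En N) ρ := ⟨q, by simpa using hq⟩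
    have hq0 : ψ q' (X q) = Φ (X q) := by simp [ψ, q']
    have heq : ⨆ q, ψ q (X q') = Φ (X q) :=
      le_antisymm (hΓΦ _ (hXD q)) (hq0 ▸ hle q' (X q))
    refine ⟨X q, hXD q, heq, fun y _ => ?_, hX q⟩
    have hy := hle q' y
    dsimp only at heq ⊢
    exact (le_of_eq (congrArg (· + _) heq)).trans hy

/-- A function with bounded subgradients along a convex set extends to a global convex function. -/
lemma exists_extension_of_subgrad {D : Set (En N)} (hD : Convex ℝ D) (hne : D.Nonempty)
    {b : En N → ℝ} {s : En N → En N} {K : NNReal} (hs : ∀ z ∈ D, ‖s z‖ ≤ K)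
    (hb : ∀ z ∈ D, ∀ y ∈ D, b z + ⟪s z, y - z⟫ ≤ b y) :
    ∃ B : En N → ℝ, ConvexOn ℝ univ B ∧ LipschitzWith K B ∧ ∀ x ∈ D, B x = b x := by
  refine exists_convex_extension hne ⟨hD, fun x hx y hy c e hc he hce => ?_⟩
    (LipschitzOnWith.of_le_add_mul K fun x hx y hy => ?_)
  · have hz := hD hx hy hc he hce
    have h1 := hb _ hz x hx
    have h2 := hb _ hz y hy
    set z := c • x + e • y with hzdef
    have h3 : c * ⟪s z, x - z⟫ + e * ⟪s z, y - z⟫ = 0 := by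
      rw [← real_inner_smul_right, ← real_inner_smul_right, ← inner_add_right]
      have : c • (x - z) + e • (y - z) = (c • x + e • y) - (c + e) • z := by module
      rw [this, hce, one_smul, hzdef, sub_self, inner_zero_right]
    simp only [smul_eq_mul]
    have e1 : b z = c * b z + e * b z := by rw [← add_mul, hce, one_mul]
    nlinarith [mul_le_mul_of_nonneg_left h1 hc, mul_le_mul_of_nonneg_left h2 he]
  · have h1 := hb x hx y hy
    have h2 := (abs_le.1 (abs_real_inner_le_norm (s x) (y - x))).1
    have h3 := mul_le_mul_of_nonneg_right (hs x hx) (norm_nonneg (y - x))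
    rw [dist_comm, dist_eq_norm]
    linarith

lemma HasTaylor.sub {φ ψ : ℝ → ℝ} {a b c a' b' c' : ℝ} (h : HasTaylor φ a b c)
    (h' : HasTaylor ψ a' b' c') :
    HasTaylor (fun t => φ t - ψ t) (a - a') (b - b') (c - c') := by
  refine (IsLittleO.sub h h').congr_left fun t => ?_
  ring

lemma HasTaylor.add {φ ψ : ℝ → ℝ} {a b c a' b' c' : ℝ} (h : HasTaylor φ a b c)
    (h' : HasTaylor ψ a' b' c') :
    HasTaylor (fun t => φ t + ψ t) (a + a') (b + b') (c + c') := by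
  refine (IsLittleO.add h h').congr_left fun t => ?_
  ring

lemma HasTaylor.const_mul {φ : ℝ → ℝ} {a b c : ℝ} (h : HasTaylor φ a b c) (k : ℝ) :
    HasTaylor (fun t => k * φ t) (k * a) (k * b) (k * c) := by
  refine (IsLittleO.const_mul_left h k).congr_left fun t => ?_
  ring

lemma hasTaylor_const (k : ℝ) : HasTaylor (fun _ => k) k 0 0 := by
  refine (isLittleO_zero _ _).congr_left fun t => ?_
  ring

lemma tendsto_id_nhdsGT_zero : Tendsto (fun t : ℝ => t) (𝓝[>] 0) (𝓝 0) :=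
  tendsto_id.mono_left nhdsWithin_le_nhds

lemma sq_isLittleO_id_nhdsGT : (fun t : ℝ => t ^ 2) =o[𝓝[>] 0] fun t => t := by
  have h := (isLittleO_one_iff ℝ).2 tendsto_id_nhdsGT_zero
  exact (h.mul_isBigO (isBigO_refl (fun t : ℝ => t) (𝓝[>] (0:ℝ)))).congr
    (fun t => by ring) fun t => by ring

lemma HasTaylor.sub_isBigO {φ : ℝ → ℝ} {a b c : ℝ} (h : HasTaylor φ a b c) :
    (fun t => φ t - a - b * t) =O[𝓝[>] 0] fun t => t ^ 2 := by
  have h1 : (fun t : ℝ => c / 2 * t ^ 2) =O[𝓝[>] 0] fun t => t ^ 2 :=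
    isBigO_const_mul_self _ _ _
  refine (IsBigO.add (IsLittleO.isBigO h) h1).congr_left fun t => ?_
  ring

lemma HasTaylor.exp {φ : ℝ → ℝ} {a b c : ℝ} (h : HasTaylor φ a b c) :
    HasTaylor (fun t => Real.exp (φ t)) (Real.exp a) (Real.exp a * b)
      (Real.exp a * (c + b ^ 2)) := by
  have hO2 := h.sub_isBigO
  have hO1 : (fun t => φ t - a) =O[𝓝[>] 0] fun t => t := by
    refine (IsBigO.add (hO2.trans sq_isLittleO_id_nhdsGT.isBigO)
      (isBigO_const_mul_self b (fun t : ℝ => t) (𝓝[>] 0))).congr_left fun t => ?_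
    ring
  have hlim : Tendsto (fun t => φ t - a) (𝓝[>] 0) (𝓝 0) :=
    hO1.trans_tendsto tendsto_id_nhdsGT_zero
  have h1 : (fun t => Real.exp (φ t - a) - (1 + (φ t - a) + (φ t - a) ^ 2 / 2)) =o[𝓝[>] 0]
      fun t => t ^ 2 := by
    have h2 := (Real.exp_sub_sum_range_succ_isLittleO_pow 2).comp_tendsto hlim
    refine (IsLittleO.trans_isBigO h2 (hO1.pow 2)).congr_left fun t => ?_
    simp [Finset.sum_range_succ]
  have h3 : (fun t => (φ t - a) ^ 2 / 2 - b ^ 2 / 2 * t ^ 2) =o[𝓝[>] 0] fun t => t ^ 2 := by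
    have e1 : (fun t => (φ t - a - b * t) * ((φ t - a) + b * t)) =o[𝓝[>] 0] fun t => t ^ 2 := by
      have e2 : (fun t => (φ t - a) + b * t) =o[𝓝[>] 0] fun _ => (1 : ℝ) := by
        refine (isLittleO_one_iff ℝ).2 ?_
        simpa using hlim.add (tendsto_id_nhdsGT_zero.const_mul b)
      exact (hO2.mul_isLittleO e2).congr_right fun t => by ring
    refine (e1.const_mul_left (1 / 2)).congr_left fun t => ?_
    ring
  refine (((h1.add h3).add h).const_mul_left (Real.exp a)).congr_left fun t => ?_
  have : Real.exp (φ t) = Real.exp a * Real.exp (φ t - a) := by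
    rw [← Real.exp_add]; ring_nf
  dsimp only
  rw [this]
  ring

lemma HasTaylor.nonneg_deriv {φ : ℝ → ℝ} {b c : ℝ} (h : HasTaylor φ 0 b c)
    (hφ : ∀ᶠ t in 𝓝[>] 0, 0 ≤ φ t) : 0 ≤ b := by
  have h1 : (fun t => φ t - b * t) =o[𝓝[>] 0] fun t => t := by
    have := h.sub_isBigO.trans_isLittleO sq_isLittleO_id_nhdsGT
    simpa using this
  by_contra! hb
  have h2 := h1.bound (c := -b / 2) (by linarith)
  obtain ⟨t, ht, ht2, ht3⟩ := (h2.and (hφ.and self_mem_nhdsWithin)).exists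
  have ht0 : (0 : ℝ) < t := ht3
  rw [Real.norm_eq_abs, Real.norm_eq_abs, abs_of_pos ht0] at ht
  have := (abs_le.1 ht).2
  nlinarith

lemma HasTaylor.nonneg_second {φ : ℝ → ℝ} {c : ℝ} (h : HasTaylor φ 0 0 c)
    (hφ : ∀ᶠ t in 𝓝[>] 0, 0 ≤ φ t) : 0 ≤ c := by
  by_contra! hb
  have h2 := IsLittleO.bound h (c := -c / 4) (by linarith)
  obtain ⟨t, ht, ht2, ht3⟩ := (h2.and (hφ.and self_mem_nhdsWithin)).exists
  have ht0 : (0 : ℝ) < t := ht3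
  have ht4 : 0 < t ^ 2 := by positivity
  rw [Real.norm_eq_abs, Real.norm_eq_abs, abs_of_pos ht4] at ht
  have := (abs_le.1 ht).2
  nlinarith

/-- First and second order conditions at a touching point of `U` and `V + exp (α (Γ - V)) - ε`. -/
lemma touching_conditions {U V Γ : En N → ℝ} {su sv sg : En N → En N} (hU : IsSel U su)
    (hV : IsSel V sv) (hG : IsSel Γ sg) (hUc : Continuous U) (hVc : Continuous V)
    (hGc : Continuous Γ) {α ε : ℝ} {x : En N} {HU HV HG : En N →L[ℝ] En N}
    (hu : HasFDerivAt su HU x) (hv : HasFDerivAt sv HV x) (hg : HasFDerivAt sg HG x)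
    (hle : ∀ᶠ y in 𝓝 x, V y + Real.exp (α * (Γ y - V y)) - ε ≤ U y)
    (heq : V x + Real.exp (α * (Γ x - V x)) - ε = U x) {σ : ℝ}
    (hσ : σ = α * Real.exp (α * (Γ x - V x))) :
    su x - sv x = -σ • (sv x - sg x) ∧
      ∀ d, (1 - σ) * ⟪HV d, d⟫ + σ * (⟪HG d, d⟫ + α * ⟪sv x - sg x, d⟫ ^ 2) ≤ ⟪HU d, d⟫ := by
  have hT : ∀ d, HasTaylor
      (fun t => U (x + t • d) - (V (x + t • d) +
        Real.exp (α * (Γ (x + t • d) - V (x + t • d))) + -ε)) 0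
      (⟪su x, d⟫ - (⟪sv x, d⟫ + σ * (⟪sg x, d⟫ - ⟪sv x, d⟫)))
      (⟪HU d, d⟫ - (⟪HV d, d⟫ + σ * ((⟪HG d, d⟫ - ⟪HV d, d⟫) +
        α * (⟪sg x, d⟫ - ⟪sv x, d⟫) ^ 2))) := by
    intro d
    have h1 := hU.hasTaylor hUc hu d
    have h2 := hV.hasTaylor hVc hv d
    have h3 := hG.hasTaylor hGc hg d
    have h4 := h1.sub ((h2.add ((h3.sub h2).const_mul α).exp).add (hasTaylor_const (-ε)))
    convert h4 using 1
    · linarith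
    · rw [hσ]; ring
    · rw [hσ]; ring
  have hpos : ∀ d, ∀ᶠ t in 𝓝[>] (0 : ℝ), 0 ≤ U (x + t • d) - (V (x + t • d) +
        Real.exp (α * (Γ (x + t • d) - V (x + t • d))) + -ε) := by
    intro d
    have hc : Tendsto (fun t : ℝ => x + t • d) (𝓝[>] 0) (𝓝 x) := by
      have : Continuous fun t : ℝ => x + t • d := by fun_prop
      simpa using (this.tendsto 0).mono_left nhdsWithin_le_nhds
    filter_upwards [hc.eventually hle] with t ht
    linarith
  have hgrad : su x - sv x = -σ • (sv x - sg x) := by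
    refine ext_inner_right ℝ fun d => ?_
    have h1 := (hT d).nonneg_deriv (hpos d)
    have h2 := (hT (-d)).nonneg_deriv (hpos (-d))
    simp only [inner_neg_right] at h2
    simp only [inner_sub_left, real_inner_smul_left]
    linarith
  refine ⟨hgrad, fun d => ?_⟩
  have h0 : ⟪su x, d⟫ - (⟪sv x, d⟫ + σ * (⟪sg x, d⟫ - ⟪sv x, d⟫)) = 0 := by
    have := congrArg (fun z => ⟪z, d⟫) hgrad
    simp only [inner_sub_left, real_inner_smul_left] at this
    linarith
  have h1 := hT d
  rw [h0] at h1
  have h2 := h1.nonneg_second (hpos d)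
  rw [inner_sub_left]
  linarith

end

section

open Filter Topology Measure

variable {N : ℕ}

/-- The exponential barrier splits as a multiple of `Γ` plus a convex function. -/
lemma exists_barrier_splitting {V Γ : En N → ℝ} {sv sg : En N → En N} (hV : IsSel V sv)
    (hG : IsSel Γ sg) {K ρ : NNReal} (hVK : LipschitzWith K V) (hGK : LipschitzWith ρ Γ)
    {D : Set (En N)} (hD : IsCompact D) (hDc : Convex ℝ D) (hne : D.Nonempty) {α ε : ℝ}
    (hα : 0 < α) (hbox : ∀ x ∈ D, α * Real.exp (α * (Γ x - V x)) ≤ 1) :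
    ∃ κ : ℝ, 0 < κ ∧ ∃ B : En N → ℝ, ConvexOn ℝ univ B ∧ (∃ K', LipschitzWith K' B) ∧
      ∀ x ∈ D, κ * Γ x + B x = V x + Real.exp (α * (Γ x - V x)) - ε := by
  obtain ⟨z₀, hz₀, hmin⟩ := hD.exists_isMinOn hne
    (hGK.continuous.sub hVK.continuous).continuousOn
  set E : En N → ℝ := fun z => α * Real.exp (α * (Γ z - V z)) with hE
  have hκE : ∀ z ∈ D, E z₀ ≤ E z := by
    intro z hz
    have : Γ z₀ - V z₀ ≤ Γ z - V z := hmin hz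
    simp only [hE]
    gcongr
  have hκ : 0 < E z₀ := by positivity
  obtain ⟨B, hB, hBK, hBeq⟩ := exists_extension_of_subgrad hDc hne
    (b := fun z => V z + Real.exp (α * (Γ z - V z)) - ε - E z₀ * Γ z)
    (s := fun z => (1 - E z) • sv z + (E z - E z₀) • sg z) (K := K + ρ)
    (fun z hz => by
      have h1 := hκE z hz
      have h2 := hbox z hz
      have h3 := subgrad_norm_le hVK (hV.mem z)
      have h4 := subgrad_norm_le hGK (hG.mem z)
      refine (norm_add_le _ _).trans ?_
      rw [norm_smul, norm_smul, Real.norm_eq_abs, Real.norm_eq_abs,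
        abs_of_nonneg (sub_nonneg.2 h2), abs_of_nonneg (sub_nonneg.2 h1), NNReal.coe_add]
      refine add_le_add ((mul_le_of_le_one_left (norm_nonneg _) ?_).trans h3)
        ((mul_le_of_le_one_left (norm_nonneg _) ?_).trans h4)
      · linarith
      · linarith)
    (fun z hz w hw => by
      have h1 := hκE z hz
      have h2 := hbox z hz
      have h3 := hV z w
      have h4 := hG z w
      have h5 : Real.exp (α * (Γ z - V z)) * (1 + (α * (Γ w - V w) - α * (Γ z - V z))) ≤
          Real.exp (α * (Γ w - V w)) := by
        have e1 := Real.add_one_le_exp (α * (Γ w - V w) - α * (Γ z - V z))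
        have e2 := mul_le_mul_of_nonneg_left e1 (Real.exp_pos (α * (Γ z - V z))).le
        rw [← Real.exp_add, add_sub_cancel] at e2
        linarith
      have h6 : Real.exp (α * (Γ z - V z)) * (1 + (α * (Γ w - V w) - α * (Γ z - V z))) =
          Real.exp (α * (Γ z - V z)) + E z * ((Γ w - Γ z) - (V w - V z)) := by
        simp only [hE]; ring
      have h7 : 0 ≤ (1 - E z) * (V w - V z - ⟪sv z, w - z⟫) :=
        mul_nonneg (sub_nonneg.2 h2) (by linarith)
      have h8 : 0 ≤ (E z - E z₀) * (Γ w - Γ z - ⟪sg z, w - z⟫) :=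
        mul_nonneg (sub_nonneg.2 h1) (by linarith)
      rw [inner_add_left, real_inner_smul_left, real_inner_smul_left]
      linarith)
  refine ⟨E z₀, hκ, B, hB, ⟨_, hBK⟩, fun x hx => ?_⟩
  rw [hBeq x hx]
  ring

lemma MAm_smul_eq_zero {Γ : En N → ℝ} {κ : ℝ} (hκ : 0 < κ) {S : Set (En N)}
    (h : MAm univ (fun x => κ * Γ x) S = 0) : MAm univ Γ S = 0 := by
  have hsub : (fun p : En N => κ • p) '' (⋃ x ∈ S, subgrad univ Γ x) ⊆
      ⋃ x ∈ S, subgrad univ (fun x => κ * Γ x) x := by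
    rintro _ ⟨p, hp, rfl⟩
    obtain ⟨x, hx, hpx⟩ := mem_iUnion₂.1 hp
    refine mem_iUnion₂.2 ⟨x, hx, fun y hy => ?_⟩
    have := mul_le_mul_of_nonneg_left (hpx y hy) hκ.le
    simp only [real_inner_smul_left]
    linarith
  have h1 := measure_mono_null hsub h
  rw [image_smul, Measure.addHaar_smul, mul_eq_zero] at h1
  refine h1.resolve_left ?_
  simp only [ENNReal.ofReal_eq_zero, not_le, abs_pos]
  positivity

/-- A null set for the Monge–Ampère measure of a function touched from above by the barrier is null
for the envelope. -/
lemma MAm_envelope_eq_zero {U V Γ : En N → ℝ} {su sv sg : En N → En N} (hU : IsSel U su)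
    (hV : IsSel V sv) (hG : IsSel Γ sg) {K ρ : NNReal} (hVK : LipschitzWith K V)
    (hGK : LipschitzWith ρ Γ) {x₀ : En N} {r α ε : ℝ} (hα : 0 < α)
    (hbox : ∀ x ∈ Metric.closedBall x₀ r, α * Real.exp (α * (Γ x - V x)) ≤ 1)
    (hle : ∀ x ∈ Metric.closedBall x₀ r, V x + Real.exp (α * (Γ x - V x)) - ε ≤ U x)
    {S : Set (En N)} (hS : MeasurableSet S) (hSr : S ⊆ Metric.ball x₀ r)
    (heq : ∀ x ∈ S, V x + Real.exp (α * (Γ x - V x)) - ε = U x) (h0 : MAm univ U S = 0) :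
    MAm univ Γ S = 0 := by
  rcases S.eq_empty_or_nonempty with rfl | ⟨x₁, hx₁⟩
  · simp [MAm]
  have hne : (Metric.closedBall x₀ r).Nonempty := ⟨x₁, Metric.ball_subset_closedBall (hSr hx₁)⟩
  obtain ⟨κ, hκ, B, hB, ⟨K', hBK⟩, hBeq⟩ := exists_barrier_splitting hV hG hVK hGK
    (isCompact_closedBall x₀ r) (convex_closedBall x₀ r) hne (ε := ε) hα hbox
  have hκG : ConvexOn ℝ univ fun x => κ * Γ x := hG.convexOn.smul hκ.le
  have hκK : LipschitzWith (κ.toNNReal * ρ) fun x => κ * Γ x := by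
    refine LipschitzWith.of_dist_le_mul fun x y => ?_
    rw [Real.dist_eq, ← mul_sub, abs_mul, abs_of_pos hκ, ← Real.dist_eq, NNReal.coe_mul,
      Real.coe_toNNReal _ hκ.le, mul_assoc]
    exact mul_le_mul_of_nonneg_left (hGK.dist_le_mul x y) hκ.le
  refine MAm_smul_eq_zero hκ (MAm_eq_zero_of_isCompact hκG hκK hS
    (Metric.isBounded_ball.subset hSr) fun C hCS hC => ?_)
  refine le_antisymm ((MAm_le_MAm_add hκG hκK hB hBK hC).trans ?_) bot_le
  rw [← h0]
  refine measure_mono fun p hp => ?_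
  obtain ⟨x, hx, hpx⟩ := mem_iUnion₂.1 hp
  have hxr := hSr (hCS hx)
  have hxD := Metric.ball_subset_closedBall hxr
  refine mem_iUnion₂.2 ⟨x, hCS hx, mem_subgrad_of_local hU.convexOn
    (h := fun x => κ * Γ x + B x) (Metric.isOpen_ball.mem_nhds hxr) (mem_univ x)
    (fun y hy => ?_) ?_ fun y _ => hpx y (mem_univ y)⟩
  · rw [hBeq y (Metric.ball_subset_closedBall hy)]
    exact hle y (Metric.ball_subset_closedBall hy)
  · rw [hBeq x hxD, heq x (hCS hx)]

/-- The trace of an operator in the standard basis. -/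
def opTrace (H : En N →L[ℝ] En N) : ℝ :=
  ∑ i, ⟪H (EuclideanSpace.basisFun (Fin N) ℝ i), EuclideanSpace.basisFun (Fin N) ℝ i⟫

lemma measurable_opTrace_fderiv (s : En N → En N) :
    Measurable fun x => opTrace (fderiv ℝ s x) := by
  unfold opTrace
  refine Finset.measurable_sum _ fun i _ => ?_
  exact (measurable_fderiv_apply_const ℝ s _).inner measurable_const

/-- Estimate of the mass of the envelope on the contact set. -/
lemma MAm_envelope_le {U V Γ : En N → ℝ} {su sv sg : En N → En N} (hU : IsSel U su)
    (hV : IsSel V sv) (hG : IsSel Γ sg) {K ρ : NNReal} (hUK : LipschitzWith K U)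
    (hVK : LipschitzWith K V) (hGK : LipschitzWith ρ Γ) {x₀ : En N} {r α ε L c₂ : ℝ} (hα : 1 ≤ α)
    (hε : 0 ≤ ε) (hL : 0 ≤ L) (hc₂ : 0 ≤ c₂)
    (hbox : ∀ x ∈ Metric.closedBall x₀ r, α * Real.exp (α * (Γ x - V x)) ≤ 1)
    (hle : ∀ x ∈ Metric.closedBall x₀ r, V x + Real.exp (α * (Γ x - V x)) - ε ≤ U x)
    {A : Set (En N)} (hA : MeasurableSet A) (hAr : A ⊆ Metric.ball x₀ r)
    (heq : ∀ x ∈ A, V x + Real.exp (α * (Γ x - V x)) - ε = U x)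
    (hσ : ∀ x ∈ A, α * Real.exp (α * (Γ x - V x)) ≤ 1 / 2)
    (hξ : ∀ x ∈ A, c₂ ≤ ‖sv x - sg x‖)
    (H1 : ∀ᵐ x, x ∈ Metric.ball x₀ r → (fderiv ℝ su x).det ≤
      (1 + L * ((U x - V x) + ‖su x - sv x‖)) * (fderiv ℝ sv x).det)
    (H2 : ∀ S ⊆ Metric.ball x₀ r, MeasurableSet S →
      (∀ᵐ x, x ∈ S → (fderiv ℝ sv x).det = 0) → MAm univ U S = 0) :
    MAm univ Γ A ≤ ENNReal.ofReal ((2 ^ N * (L * (1 + K + ρ) + N)) ^ N) *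
      ∫⁻ x in Metric.ball x₀ r ∩
        {x | α * c₂ ^ 2 ≤ 2 ^ N * (L * (1 + K + ρ) + N) * opTrace (fderiv ℝ sv x)},
        ENNReal.ofReal |(fderiv ℝ sv x).det| := by
  have hα0 : 0 < α := by linarith
  set C₁ : ℝ := L * (1 + K + ρ) with hC₁
  have hae := (((hU.ae_differentiableAt hU.convexOn hUK).and
    (hV.ae_differentiableAt hV.convexOn hVK)).and
    (hG.ae_differentiableAt hG.convexOn hGK)).and H1
  obtain ⟨T, hTae, hTm, hT⟩ := hae.exists_measurable_mem
  set Z : Set (En N) := {x | ENNReal.ofReal |(fderiv ℝ sv x).det| ≠ 0} with hZ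
  have hZm : MeasurableSet Z :=
    (measurableSet_eq_fun (measurable_ofReal_abs_det_fderiv sv) measurable_const).compl
  set A₁ := A ∩ T ∩ Z with hA₁
  have hA₁m : MeasurableSet A₁ := (hA.inter hTm).inter hZm
  have hdet0 : ∀ x, x ∉ Z → (fderiv ℝ sv x).det = 0 := by
    intro x hx
    simp only [hZ, ne_eq, mem_ofPred_eq, not_not, ENNReal.ofReal_eq_zero] at hx
    exact abs_eq_zero.1 (le_antisymm hx (abs_nonneg _))
  have hbad : MAm univ Γ (A \ A₁) = 0 := by
    refine MAm_envelope_eq_zero hU hV hG hVK hGK hα0 hbox hle (hA.diff hA₁m)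
      (sdiff_subset.trans hAr) (fun x hx => heq x hx.1)
      (H2 _ (sdiff_subset.trans hAr) (hA.diff hA₁m) ?_)
    filter_upwards [hTae] with x hxT hx
    by_contra hne
    exact hx.2 ⟨⟨hx.1, hxT⟩, by
      by_contra hxZ
      exact hne (hdet0 x hxZ)⟩
  have hpt : ∀ x ∈ A₁, (fderiv ℝ sg x).det ≤ (2 ^ N * (C₁ + N)) ^ N * (fderiv ℝ sv x).det ∧
      α * c₂ ^ 2 ≤ 2 ^ N * (C₁ + N) * opTrace (fderiv ℝ sv x) ∧ 0 ≤ (fderiv ℝ sg x).det ∧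
      0 ≤ (fderiv ℝ sv x).det := by
    rintro x ⟨⟨hxA, hxT⟩, hxZ⟩
    obtain ⟨⟨⟨h1, h1s⟩, h2, h2s⟩, ⟨h3, h3s⟩, hH⟩ :
      ((_ ∧ _) ∧ _ ∧ _) ∧ (_ ∧ _) ∧ _ := by
        have := hT x hxT
        exact ⟨this.1.1, this.1.2, this.2⟩
    have p1 := hU.inner_fderiv_nonneg h1.hasFDerivAt
    have p2 := hV.inner_fderiv_nonneg h2.hasFDerivAt
    have p3 := hG.inner_fderiv_nonneg h3.hasFDerivAt
    have hxr := hAr hxA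
    set σ := α * Real.exp (α * (Γ x - V x)) with hσdef
    have hσ0 : 0 < σ := by positivity
    have hσ2 := hσ x hxA
    obtain ⟨hgrad, hsec⟩ := touching_conditions hU hV hG hUK.continuous hVK.continuous
      hGK.continuous h1.hasFDerivAt h2.hasFDerivAt h3.hasFDerivAt
      (Filter.mem_of_superset (Metric.isOpen_ball.mem_nhds hxr)
        fun y hy => hle y (Metric.ball_subset_closedBall hy)) (heq x hxA) hσdef
    have hd2 := det_nonneg_of_psd h2s p2
    have hdetne : (fderiv ℝ sv x).det ≠ 0 := by
      intro h0
      simp [hZ, h0] at hxZ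
    have hn1 := subgrad_norm_le hVK (hV.mem x)
    have hn2 := subgrad_norm_le hGK (hG.mem x)
    have hPQ : (fderiv ℝ su x).det ≤ (1 + C₁ * σ) * (fderiv ℝ sv x).det := by
      refine (hH hxr).trans (mul_le_mul_of_nonneg_right ?_ hd2)
      have e1 : ‖su x - sv x‖ ≤ σ * (K + ρ) := by
        rw [hgrad, norm_smul, norm_neg, Real.norm_eq_abs, abs_of_pos hσ0]
        exact mul_le_mul_of_nonneg_left ((norm_sub_le _ _).trans (add_le_add hn1 hn2)) hσ0.le
      have e2 : U x - V x ≤ σ := by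
        have := heq x hxA
        have e3 : Real.exp (α * (Γ x - V x)) ≤ σ :=
          le_mul_of_one_le_left (Real.exp_pos _).le hα
        linarith
      have e4 : L * ((U x - V x) + ‖su x - sv x‖) ≤ L * (σ + σ * (K + ρ)) := by gcongr
      rw [hC₁]
      linarith
    have hcomp := det_comparison_op (C := C₁) h1s h2s h3s p2 p3 hdetne hα0.le hσ0 hσ2 hsec hPQ
    refine ⟨hcomp.1, le_trans ?_ hcomp.2, det_nonneg_of_psd h3s p3, hd2⟩
    have := hξ x hxA
    gcongr
  calc MAm univ Γ A ≤ MAm univ Γ A₁ + MAm univ Γ (A \ A₁) := by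
        unfold MAm
        refine le_trans (measure_mono ?_) (measure_union_le _ _)
        intro p hp
        obtain ⟨x, hx, hpx⟩ := mem_iUnion₂.1 hp
        by_cases h : x ∈ A₁
        · exact Or.inl (mem_iUnion₂.2 ⟨x, h, hpx⟩)
        · exact Or.inr (mem_iUnion₂.2 ⟨x, ⟨hx, h⟩, hpx⟩)
    _ = MAm univ Γ A₁ := by rw [hbad, add_zero]
    _ ≤ ∫⁻ x in A₁, ENNReal.ofReal |(fderiv ℝ sg x).det| :=
        hG.MAm_le_lintegral_det hA₁m fun x hx => (hT x hx.1.2).1.2.1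
    _ ≤ ∫⁻ x in A₁, ENNReal.ofReal ((2 ^ N * (C₁ + N)) ^ N) *
          ENNReal.ofReal |(fderiv ℝ sv x).det| := by
        refine setLIntegral_mono' hA₁m fun x hx => ?_
        obtain ⟨h1, -, h3, h4⟩ := hpt x hx
        rw [abs_of_nonneg h3, abs_of_nonneg h4, ← ENNReal.ofReal_mul (by positivity)]
        exact ENNReal.ofReal_le_ofReal h1
    _ = ENNReal.ofReal ((2 ^ N * (C₁ + N)) ^ N) *
          ∫⁻ x in A₁, ENNReal.ofReal |(fderiv ℝ sv x).det| :=
        lintegral_const_mul _ (measurable_ofReal_abs_det_fderiv sv)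
    _ ≤ _ := by
        gcongr
        intro x hx
        exact ⟨hAr hx.1.1, (hpt x hx).2.1⟩

end

section

open Filter Topology Measure

variable {N : ℕ}

/-- The Aleksandrov–Bakelman–Pucci type estimate at a fixed exponent. -/
lemma volume_closedBall_le_of_contact {U V : En N → ℝ} {su sv : En N → En N} (hU : IsSel U su)
    (hV : IsSel V sv) {K : NNReal} (hUK : LipschitzWith K U) (hVK : LipschitzWith K V)
    {x₀ y : En N} {r C m η c₁ L : ℝ} (hr : 0 < r)
    (hle : ∀ x ∈ Metric.closedBall x₀ r, V x ≤ U x) (hC : 0 < C)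
    (hsph : ∀ x ∈ Metric.sphere x₀ r, C ≤ U x) (hx₀ : U x₀ = V x₀) (hx₀C : U x₀ ≤ C / 2)
    (hy : y ∈ Metric.closedBall x₀ r) (hVy : V y ≤ 0) (hm : 0 < m)
    (hφ : ∀ x ∈ Metric.closedBall x₀ r ∩ Metric.ball y η, m ≤ U x - V x) (hc₁ : 0 < c₁)
    (hUc₁ : ∀ x ∈ Metric.closedBall x₀ r \ Metric.ball y η, c₁ ≤ U x) (hL : 0 ≤ L)
    (H1 : ∀ᵐ x, x ∈ Metric.ball x₀ r → (fderiv ℝ su x).det ≤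
      (1 + L * ((U x - V x) + ‖su x - sv x‖)) * (fderiv ℝ sv x).det)
    (H2 : ∀ S ⊆ Metric.ball x₀ r, MeasurableSet S →
      (∀ᵐ x, x ∈ S → (fderiv ℝ sv x).det = 0) → MAm univ U S = 0) {ρ : NNReal}
    (hρ1 : ρ * r ≤ C / 4) (hρ2 : ρ ≤ c₁ / (8 * r)) {α : ℝ} (hα : 1 ≤ α) :
    volume (Metric.closedBall (0 : En N) ρ) ≤
      ENNReal.ofReal ((2 ^ N * (L * (1 + K + ρ) + N)) ^ N) *
      ∫⁻ x in Metric.ball x₀ r ∩ {x | α * (c₁ / (8 * r)) ^ 2 ≤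
        2 ^ N * (L * (1 + K + ρ) + N) * opTrace (fderiv ℝ sv x)},
        ENNReal.ofReal |(fderiv ℝ sv x).det| := by
  have hα0 : 0 < α := by linarith
  have hρ0 : (0 : ℝ) ≤ ρ := ρ.2
  have hDc : IsCompact (Metric.closedBall x₀ r) := isCompact_closedBall x₀ r
  have hx₀D : x₀ ∈ Metric.closedBall x₀ r := Metric.mem_closedBall_self hr.le
  obtain ⟨M', hM'⟩ := hDc.exists_bound_of_continuousOn hVK.continuous.continuousOn
  obtain ⟨M, hM⟩ := hDc.exists_bound_of_continuousOn
    (hUK.continuous.sub hVK.continuous).continuousOn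
  have hM'0 : 0 ≤ M' := (norm_nonneg _).trans (hM' x₀ hx₀D)
  have hM0 : 0 ≤ M := (norm_nonneg _).trans (hM x₀ hx₀D)
  set δ : ℝ := min (min (m / 2) (c₁ / 2)) (1 / (2 * α)) with hδ
  have hδ0 : 0 < δ := by positivity
  have hδm : δ ≤ m / 2 := (min_le_left _ _).trans (min_le_left _ _)
  have hδc : δ ≤ c₁ / 2 := (min_le_left _ _).trans (min_le_right _ _)
  have hδα : α * δ ≤ 1 / 2 := by
    calc α * δ ≤ α * (1 / (2 * α)) := mul_le_mul_of_nonneg_left (min_le_right _ _) hα0.le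
      _ = 1 / 2 := by field_simp
  set K₀ : ℝ := C + M' + M with hK₀
  obtain ⟨T, hT⟩ : ∃ T : ℝ, Real.exp (α * (K₀ - T)) = δ := by
    refine ⟨K₀ - Real.log δ / α, ?_⟩
    rw [sub_sub_cancel, mul_div_cancel₀ _ hα0.ne', Real.exp_log hδ0]
  have hexp : ∀ s, s ≤ K₀ - T → Real.exp (α * s) ≤ δ := by
    intro s hs
    rw [← hT]
    gcongr
  set ε : ℝ := Real.exp (-(α * T)) with hε
  have hε0 : 0 < ε := Real.exp_pos _
  have hφ0 : ∀ x ∈ Metric.closedBall x₀ r, 0 ≤ U x - V x := fun x hx => sub_nonneg.2 (hle x hx)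
  set Φ : En N → ℝ := fun x => V x + Real.log (U x - V x + ε) / α with hΦ
  have hΦexp : ∀ x ∈ Metric.closedBall x₀ r, Real.exp (α * (Φ x - V x)) = U x - V x + ε := by
    intro x hx
    have : α * (Φ x - V x) = Real.log (U x - V x + ε) := by
      simp only [hΦ]
      rw [add_sub_cancel_left, mul_div_cancel₀ _ hα0.ne']
    rw [this, Real.exp_log (by linarith [hφ0 x hx])]
  have hΦc : ContinuousOn Φ (Metric.closedBall x₀ r) := by
    refine hVK.continuous.continuousOn.add (ContinuousOn.div_const (ContinuousOn.log ?_ ?_) α)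
    · exact ((hUK.continuous.sub hVK.continuous).add continuous_const).continuousOn
    · intro x hx
      have := hφ0 x hx
      exact ne_of_gt (by linarith)
  have hΦU : ∀ x ∈ Metric.closedBall x₀ r, U x - T ≤ Φ x := by
    intro x hx
    have h0 := hφ0 x hx
    have h1 : U x - V x ≤ M := (le_abs_self _).trans (hM x hx)
    set φ := U x - V x with hφdef
    have h2 : ε * Real.exp (α * φ) ≤ φ + ε := by
      have e1 := Real.add_one_le_exp (-(α * φ))
      have e2 := mul_le_mul_of_nonneg_right e1 (Real.exp_pos (α * φ)).le
      rw [← Real.exp_add, neg_add_cancel, Real.exp_zero] at e2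
      have e3 : ε * Real.exp (α * φ) ≤ δ := by
        rw [hε, ← Real.exp_add]
        have := hexp (φ - T) (by linarith)
        refine le_trans (le_of_eq ?_) this
        ring_nf
      have e4 : α * φ * (ε * Real.exp (α * φ)) ≤ φ := by
        calc α * φ * (ε * Real.exp (α * φ)) ≤ α * φ * δ := by gcongr
          _ = φ * (α * δ) := by ring
          _ ≤ φ * (1 / 2) := by gcongr
          _ ≤ φ := by linarith
      have e5 := mul_le_mul_of_nonneg_left e2 hε0.le
      linarith
    have h3 := Real.log_le_log (by positivity) h2
    rw [Real.log_mul hε0.ne' (Real.exp_pos _).ne', Real.log_exp, hε, Real.log_exp] at h3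
    have h4 : φ - T ≤ Real.log (φ + Real.exp (-(α * T))) / α := by
      rw [le_div_iff₀ hα0]
      linarith
    simp only [hΦ]
    linarith
  have hΦx₀ : Φ x₀ = V x₀ - T := by
    simp only [hΦ]
    rw [hx₀, sub_self, zero_add, hε, Real.log_exp]
    field_simp
    ring
  obtain ⟨Γ, hΓc, hΓK, hΓΦ, hΓq⟩ := exists_envelope hDc ⟨x₀, hx₀D⟩ hΦc ρ
  obtain ⟨sg, hG⟩ := exists_isSel hΓc hΓK.continuous
  set A : Set (En N) := {x | x ∈ Metric.closedBall x₀ r ∧ Γ x = Φ x ∧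
    Φ x ≤ Φ x₀ + ρ * dist x x₀} with hA
  have hAm : MeasurableSet A := by
    have h1 : ContinuousOn (fun x => (Γ x - Φ x, Φ x - Φ x₀ - ρ * dist x x₀))
        (Metric.closedBall x₀ r) := by
      refine (hΓK.continuous.continuousOn.sub hΦc).prodMk
        ((hΦc.sub continuousOn_const).sub ?_)
      fun_prop
    have h2 := h1.preimage_isClosed_of_isClosed Metric.isClosed_closedBall
      ((isClosed_singleton (x := (0 : ℝ))).prod (isClosed_Iic (a := (0 : ℝ))))
    convert h2.measurableSet using 1
    ext x
    simp only [hA, mem_ofPred_eq, mem_inter_iff, mem_preimage, mem_prod, mem_singleton_iff, mem_Iic,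
      sub_eq_zero]
    refine and_congr_right fun _ => and_congr_right fun _ => ?_
    constructor <;> intro h <;> linarith
  have hρd : ∀ x ∈ Metric.closedBall x₀ r, ρ * dist x x₀ ≤ C / 4 := fun x hx =>
    (mul_le_mul_of_nonneg_left (Metric.mem_closedBall.1 hx) hρ0).trans hρ1
  have hΓle : ∀ x ∈ Metric.closedBall x₀ r, Γ x ≤ 3 * C / 4 - T := by
    intro x hx
    have h1 := (le_abs_self _).trans (hΓK.dist_le_mul x x₀)
    have h2 := hΓΦ x₀ hx₀D
    have h3 := hρd x hx
    linarith
  have hbox : ∀ x ∈ Metric.closedBall x₀ r, Real.exp (α * (Γ x - V x)) ≤ δ := by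
    intro x hx
    refine hexp _ ?_
    have h1 := hΓle x hx
    have h2 := (abs_le.1 (hM' x hx)).1
    linarith
  have hσ : ∀ x ∈ Metric.closedBall x₀ r, α * Real.exp (α * (Γ x - V x)) ≤ 1 / 2 := fun x hx =>
    (mul_le_mul_of_nonneg_left (hbox x hx) hα0.le).trans hδα
  have hAexp : ∀ x ∈ A, Real.exp (α * (Γ x - V x)) = U x - V x + ε := by
    rintro x ⟨hxD, hxe, -⟩
    rw [hxe, hΦexp x hxD]
  have hAr : A ⊆ Metric.ball x₀ r := by
    rintro x ⟨hxD, hxe, hxl⟩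
    refine lt_of_le_of_ne (Metric.mem_closedBall.1 hxD) fun hd => ?_
    have h1 := hsph x hd
    have h2 := hΦU x hxD
    have h3 := hρd x hxD
    linarith
  have hsub : Metric.closedBall (0 : En N) ρ ⊆ ⋃ x ∈ A, subgrad univ Γ x := by
    intro q hq
    obtain ⟨x, hxD, hxe, hqx, hqm⟩ := hΓq q (by simpa using hq)
    refine mem_iUnion₂.2 ⟨x, ⟨hxD, hxe, ?_⟩, hqx⟩
    have h1 := hqm x₀ hx₀D
    have h2 := (abs_le.1 (abs_real_inner_le_norm q (x₀ - x))).1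
    have h3 : ‖q‖ * ‖x₀ - x‖ ≤ ρ * ‖x₀ - x‖ :=
      mul_le_mul_of_nonneg_right (by simpa using hq) (norm_nonneg _)
    rw [dist_comm, dist_eq_norm]
    linarith
  refine (measure_mono hsub).trans (MAm_envelope_le hU hV hG hUK hVK hΓK hα hε0.le hL
    (by positivity) (fun x hx => (hσ x hx).trans (by norm_num)) (ε := ε) (fun x hx => ?_) hAm hAr
    (fun x hx => ?_) (fun x hx => hσ x hx.1) (fun x hx => ?_) H1 H2)
  · have h1 : Real.exp (α * (Γ x - V x)) ≤ U x - V x + ε := by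
      rw [← hΦexp x hx]
      have := hΓΦ x hx
      gcongr
    linarith
  · rw [hAexp x hx]; ring
  · have hxD := hx.1
    have h1 := hbox x hxD
    rw [hAexp x hx] at h1
    have hxy : x ∉ Metric.ball y η := by
      intro hxy
      have := hφ x ⟨hxD, hxy⟩
      linarith
    have h2 := hUc₁ x ⟨hxD, hxy⟩
    have h3 : c₁ / 2 ≤ V x := by linarith
    have h4 := hV x y
    have h5 := (abs_le.1 (abs_real_inner_le_norm (sv x) (y - x))).1
    have h6 : ‖y - x‖ ≤ 2 * r := by
      rw [← dist_eq_norm]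
      have := dist_triangle_right y x x₀
      have e1 := Metric.mem_closedBall.1 hy
      have e2 := Metric.mem_closedBall.1 hxD
      linarith
    have h7 : c₁ / 2 ≤ ‖sv x‖ * (2 * r) := by
      have := mul_le_mul_of_nonneg_left h6 (norm_nonneg (sv x))
      linarith
    have h8 : c₁ / (4 * r) ≤ ‖sv x‖ := by
      rw [div_le_iff₀ (by positivity)]; linarith
    have h9 := subgrad_norm_le hΓK (hG.mem x)
    have h10 := norm_sub_norm_le (sv x) (sg x)
    have h11 : c₁ / (4 * r) = 2 * (c₁ / (8 * r)) := by field_simp; ring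
    linarith

/-- The configuration ruled out by the maximum principle. -/
theorem false_of_contact {U V : En N → ℝ} {su sv : En N → En N} (hU : IsSel U su)
    (hV : IsSel V sv) {K : NNReal} (hUK : LipschitzWith K U) (hVK : LipschitzWith K V)
    {x₀ y : En N} {r C m η c₁ L : ℝ} (hr : 0 < r)
    (hle : ∀ x ∈ Metric.closedBall x₀ r, V x ≤ U x) (hC : 0 < C)
    (hsph : ∀ x ∈ Metric.sphere x₀ r, C ≤ U x) (hx₀ : U x₀ = V x₀) (hx₀C : U x₀ ≤ C / 2)
    (hy : y ∈ Metric.closedBall x₀ r) (hVy : V y ≤ 0) (hm : 0 < m)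
    (hφ : ∀ x ∈ Metric.closedBall x₀ r ∩ Metric.ball y η, m ≤ U x - V x) (hc₁ : 0 < c₁)
    (hUc₁ : ∀ x ∈ Metric.closedBall x₀ r \ Metric.ball y η, c₁ ≤ U x) (hL : 0 ≤ L)
    (H1 : ∀ᵐ x, x ∈ Metric.ball x₀ r → (fderiv ℝ su x).det ≤
      (1 + L * ((U x - V x) + ‖su x - sv x‖)) * (fderiv ℝ sv x).det)
    (H2 : ∀ S ⊆ Metric.ball x₀ r, MeasurableSet S →
      (∀ᵐ x, x ∈ S → (fderiv ℝ sv x).det = 0) → MAm univ U S = 0) : False := by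
  set ρ : NNReal := (min (C / (4 * r)) (c₁ / (8 * r))).toNNReal with hρ
  have hρ0 : 0 < min (C / (4 * r)) (c₁ / (8 * r)) := by positivity
  have hρc : (ρ : ℝ) = min (C / (4 * r)) (c₁ / (8 * r)) := Real.coe_toNNReal _ hρ0.le
  have hρ1 : ρ * r ≤ C / 4 := by
    have : (ρ : ℝ) ≤ C / (4 * r) := hρc ▸ min_le_left _ _
    calc ρ * r ≤ C / (4 * r) * r := mul_le_mul_of_nonneg_right this hr.le
      _ = C / 4 := by field_simp
  have hρ2 : ρ ≤ c₁ / (8 * r) := hρc ▸ min_le_right _ _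
  set C₂ : ℝ := 2 ^ N * (L * (1 + K + ρ) + N) with hC₂
  set c : ℝ := (c₁ / (8 * r)) ^ 2 with hc
  have hc0 : 0 < c := by positivity
  set S : ℕ → Set (En N) := fun k => Metric.ball x₀ r ∩
    {x | ((k : ℝ) + 1) * c ≤ C₂ * opTrace (fderiv ℝ sv x)} with hS
  have hSm : ∀ k, MeasurableSet (S k) := fun k => measurableSet_ball.inter
    (measurableSet_le measurable_const ((measurable_opTrace_fderiv sv).const_mul C₂))
  set μ := (volume : Measure (En N)).withDensity
    fun x => ENNReal.ofReal |(fderiv ℝ sv x).det| with hμ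
  have hSa : Antitone S := by
    refine antitone_nat_of_succ_le fun k => ?_
    rintro x ⟨hx, hx'⟩
    refine ⟨hx, ?_⟩
    simp only [mem_ofPred_eq] at hx' ⊢
    push_cast at hx'
    nlinarith
  have hSe : ⋂ k, S k = ∅ := by
    refine eq_empty_of_forall_notMem fun x hx => ?_
    obtain ⟨k, hk⟩ := exists_nat_gt (C₂ * opTrace (fderiv ℝ sv x) / c)
    have h1 := (mem_iInter.1 hx k).2
    rw [div_lt_iff₀ hc0] at hk
    simp only [mem_ofPred_eq] at h1
    linarith
  have hfin : μ (S 0) ≠ ∞ := by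
    rw [hμ, withDensity_apply _ (hSm 0)]
    refine ((lintegral_mono_set (inter_subset_left.trans Metric.ball_subset_closedBall)).trans
      (hV.lintegral_det_le_MAm hV.convexOn hVK measurableSet_closedBall)).trans_lt ?_ |>.ne
    exact (isCompact_subgrad_image hVK (isCompact_closedBall x₀ r)).measure_lt_top
  have hlim : Tendsto (fun k => μ (S k)) atTop (𝓝 0) := by
    have := tendsto_measure_iInter_atTop (μ := μ) (fun k => (hSm k).nullMeasurableSet) hSa
      ⟨0, hfin⟩
    rwa [hSe, measure_empty] at this
  have hlim2 : Tendsto (fun k => ENNReal.ofReal (C₂ ^ N) * μ (S k)) atTop (𝓝 0) := by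
    have := ENNReal.Tendsto.const_mul (a := ENNReal.ofReal (C₂ ^ N)) hlim
      (Or.inr ENNReal.ofReal_ne_top)
    rwa [mul_zero] at this
  have hbound : ∀ k, volume (Metric.closedBall (0 : En N) ρ) ≤
      ENNReal.ofReal (C₂ ^ N) * μ (S k) := by
    intro k
    rw [hμ, withDensity_apply _ (hSm k)]
    exact volume_closedBall_le_of_contact hU hV hUK hVK hr hle hC hsph hx₀ hx₀C hy hVy hm hφ hc₁
      hUc₁ hL H1 H2 hρ1 hρ2 (by linarith [(Nat.cast_nonneg k : (0 : ℝ) ≤ k)])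
  have h0 := ge_of_tendsto' hlim2 hbound
  have hpos : 0 < volume (Metric.closedBall (0 : En N) ρ) :=
    Metric.measure_closedBall_pos volume _ (by rw [hρc]; exact hρ0)
  exact absurd h0 (not_le.2 hpos)

end

section

open Filter Topology

variable {N : ℕ}

lemma exists_local_extension {Ω : Set (En N)} (hΩ : IsOpen Ω) {u : En N → ℝ}
    (hu : ConvexOn ℝ Ω u) {x₀ : En N} {r : ℝ} (hr : 0 < r) (hball : Metric.closedBall x₀ r ⊆ Ω) :
    ∃ (g : En N → ℝ) (s : En N → En N) (K : NNReal), IsSel g s ∧ LipschitzWith K g ∧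
      ∀ x ∈ Metric.closedBall x₀ r, g x = u x := by
  obtain ⟨K, hK⟩ := ((hu.locallyLipschitzOn hΩ).mono hball).exists_lipschitzOnWith_of_compact
    (isCompact_closedBall x₀ r)
  obtain ⟨g, hg, hgK, hgu⟩ := exists_convex_extension
    ⟨x₀, Metric.mem_closedBall_self hr.le⟩ (hu.subset hball (convex_closedBall x₀ r)) hK
  obtain ⟨s, hs⟩ := exists_isSel hg hgK.continuous
  exact ⟨g, s, K, hs, hgK, hgu⟩

lemma subgrad_eq_of_extension {Ω : Set (En N)} {u g : En N → ℝ}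
    (hu : ConvexOn ℝ Ω u) {s : En N → En N} (hs : IsSel g s) {x₀ : En N} {r : ℝ}
    (hball : Metric.closedBall x₀ r ⊆ Ω) (hgu : ∀ x ∈ Metric.closedBall x₀ r, g x = u x)
    {x : En N} (hx : x ∈ Metric.ball x₀ r) : subgrad Ω u x = subgrad univ g x :=
  subgrad_eq_of_eqOn hu hs.convexOn (Metric.isOpen_ball.mem_nhds hx)
    (Metric.ball_subset_closedBall.trans hball) (subset_univ _)
    fun y hy => (hgu y (Metric.ball_subset_closedBall hy)).symm

lemma legendreT_eq_of_mem {Ω : Set (En N)} {u : En N → ℝ} {x p : En N} (hx : x ∈ Ω)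
    (hp : p ∈ subgrad Ω u x) : legendreT Ω u p = ⟪x, p⟫ - u x := by
  refine IsGreatest.csSup_eq ⟨⟨x, hx, rfl⟩, ?_⟩
  rintro _ ⟨y, hy, rfl⟩
  have := hp y hy
  rw [inner_sub_right, real_inner_comm, real_inner_comm x p] at this
  simp only
  linarith

lemma measurable_gradient (g : En N → ℝ) : Measurable (gradient g) :=
  (InnerProductSpace.toDual ℝ (En N)).symm.continuous.measurable.comp (measurable_fderiv ℝ g)

/-- The right-hand side of the equation, written with a selection of the subgradient. -/
def selDensity (f : En N → ℝ) (F G : En N × ℝ → ℝ) (g : En N → ℝ) (s : En N → En N)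
    (x : En N) : ℝ :=
  f x * F (x, g x) / G (s x, ⟪x, s x⟫ - g x)

lemma IsGenSol.selDensity {Ω : Set (En N)} {f : En N → ℝ}
    {F G : En N × ℝ → ℝ} {u g : En N → ℝ} (hu : ConvexOn ℝ Ω u) (hMu : IsGenSol Ω f F G u)
    {s : En N → En N} (hs : IsSel g s) {K : NNReal} (hK : LipschitzWith K g) {x₀ : En N} {r : ℝ}
    (hball : Metric.closedBall x₀ r ⊆ Ω) (hgu : ∀ x ∈ Metric.closedBall x₀ r, g x = u x)
    {E : Set (En N)} (hE : E ⊆ Metric.ball x₀ r) (hEm : MeasurableSet E) :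
    MAm univ g E = ∫⁻ x in E, ENNReal.ofReal (selDensity f F G g s x) := by
  have hEΩ : E ⊆ Ω := hE.trans (Metric.ball_subset_closedBall.trans hball)
  have h1 : MAm univ g E = MAm Ω u E := by
    unfold MAm
    congr 1
    exact iUnion₂_congr fun x hx => (subgrad_eq_of_extension hu hs hball hgu (hE hx)).symm
  rw [h1, hMu E hEΩ hEm]
  refine lintegral_congr_ae ?_
  filter_upwards [ae_restrict_of_ae (hs.ae_differentiableAt hs.convexOn hK),
    ae_restrict_mem hEm] with x hx hxE
  have hg : HasGradientAt g (s x) x := hs.hasGradientAt hx.1.continuousAt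
  have hev : u =ᶠ[𝓝 x] g := by
    filter_upwards [Metric.isOpen_ball.mem_nhds (hE hxE)] with y hy
    exact (hgu y (Metric.ball_subset_closedBall hy)).symm
  have hgr : gradient u x = s x := (hg.congr_of_eventuallyEq hev).gradient
  have hmem : s x ∈ subgrad Ω u x := by
    rw [subgrad_eq_of_extension hu hs hball hgu (hE hxE)]
    exact hs.mem x
  rw [hgr, legendreT_eq_of_mem (hEΩ hxE) hmem, _root_.selDensity,
    hgu x (Metric.ball_subset_closedBall (hE hxE))]

lemma aemeasurable_selDensity {f : En N → ℝ} (hf : Measurable f) {F G : En N × ℝ → ℝ}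
    (hF : Continuous F) (hG : Continuous G) {g : En N → ℝ} {s : En N → En N} (hs : IsSel g s)
    {K : NNReal} (hK : LipschitzWith K g) : AEMeasurable (selDensity f F G g s) := by
  have hgm : Measurable g := hK.continuous.measurable
  have hgr := measurable_gradient g
  refine ⟨selDensity f F G g (gradient g), ?_, ?_⟩
  · unfold selDensity
    refine (hf.mul (hF.measurable.comp (measurable_id.prodMk hgm))).div
      (hG.measurable.comp (hgr.prodMk ((measurable_id.inner hgr).sub hgm)))
  · filter_upwards [hs.ae_differentiableAt hs.convexOn hK] with x hx
    rw [selDensity, selDensity, (hs.hasGradientAt hx.1.continuousAt).gradient]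

lemma IsGenSol.det_ae_eq {Ω : Set (En N)} {f : En N → ℝ} (hf : Measurable f)
    (hf0 : ∀ x, 0 ≤ f x) {F G : En N × ℝ → ℝ} (hF : Continuous F) (hG : Continuous G)
    (hF0 : ∀ z, 0 ≤ F z) (hG0 : ∀ z, 0 ≤ G z) {u g : En N → ℝ} (hu : ConvexOn ℝ Ω u)
    (hMu : IsGenSol Ω f F G u) {s : En N → En N} (hs : IsSel g s) {K : NNReal}
    (hK : LipschitzWith K g) {x₀ : En N} {r : ℝ}
    (hball : Metric.closedBall x₀ r ⊆ Ω) (hgu : ∀ x ∈ Metric.closedBall x₀ r, g x = u x) :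
    ∀ᵐ x, x ∈ Metric.ball x₀ r →
      (fderiv ℝ s x).det = _root_.selDensity f F G g s x := by
  have h := hs.det_ae_eq hs.convexOn hK Metric.isOpen_ball.measurableSet
    (aemeasurable_selDensity hf hF hG hs hK).ennreal_ofReal.restrict
    fun E hE hEm => hMu.selDensity hu hs hK hball hgu hE hEm
  rw [ae_restrict_iff' Metric.isOpen_ball.measurableSet] at h
  filter_upwards [h, hs.ae_differentiableAt hs.convexOn hK] with x hx hd hxb
  have h1 := hx hxb
  have hdet : 0 ≤ (fderiv ℝ s x).det :=
    det_nonneg_of_psd hd.2 (hs.inner_fderiv_nonneg hd.1.hasFDerivAt)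
  rw [abs_of_nonneg hdet] at h1
  refine (ENNReal.ofReal_eq_ofReal_iff hdet ?_).1 h1
  exact div_nonneg (mul_nonneg (hf0 x) (hF0 _)) (hG0 _)

lemma exists_selDensity_le {f : En N → ℝ} (hf0 : ∀ x, 0 ≤ f x) {F G : En N × ℝ → ℝ}
    (hF : LocallyLipschitz F) (hG : LocallyLipschitz G) {lam Lam : ℝ} (hlam : 0 < lam)
    (hFb : ∀ z, lam ≤ F z ∧ F z ≤ Lam) (hGb : ∀ z, lam ≤ G z ∧ G z ≤ Lam)
    {g h : En N → ℝ} {s t : En N → En N} (hs : IsSel g s) (ht : IsSel h t) {K : NNReal}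
    (hgK : LipschitzWith K g) (hhK : LipschitzWith K h) (x₀ : En N) (r : ℝ) :
    ∃ L, 0 ≤ L ∧ ∀ x ∈ Metric.closedBall x₀ r, h x ≤ g x →
      selDensity f F G g s x ≤ (1 + L * ((g x - h x) + ‖s x - t x‖)) * selDensity f F G h t x := by
  obtain ⟨A, hA⟩ := (isCompact_closedBall x₀ r).exists_bound_of_continuousOn
    hgK.continuous.continuousOn
  obtain ⟨B, hB⟩ := (isCompact_closedBall x₀ r).exists_bound_of_continuousOn
    hhK.continuous.continuousOn
  obtain ⟨X, hX⟩ := (isCompact_closedBall x₀ r).exists_bound_of_continuousOn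
    (continuous_id (X := En N)).continuousOn
  set M : ℝ := |A| + |B| + |X| + K + |X| * K with hM
  have hM1 : ∀ x ∈ Metric.closedBall x₀ r, ∀ (w : En N → ℝ) (p : En N),
      ‖w x‖ ≤ |A| + |B| → ‖p‖ ≤ K →
      (x, w x) ∈ Metric.closedBall (0 : En N × ℝ) M ∧
      (p, ⟪x, p⟫ - w x) ∈ Metric.closedBall (0 : En N × ℝ) M := by
    intro x hx w p hw hp
    have hx' : ‖x‖ ≤ |X| := (hX x hx).trans (le_abs_self X)
    have hK0 : (0 : ℝ) ≤ K := K.2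
    have h0 : 0 ≤ |X| * K := by positivity
    have hAB : 0 ≤ |A| + |B| := by positivity
    have hX0 : 0 ≤ |X| := abs_nonneg X
    simp only [mem_closedBall_zero_iff, Prod.norm_def, sup_le_iff]
    refine ⟨⟨?_, ?_⟩, ?_, ?_⟩
    · linarith
    · linarith
    · linarith
    · refine (norm_sub_le _ _).trans ?_
      have h1 : ‖⟪x, p⟫‖ ≤ |X| * K :=
        (norm_inner_le_norm x p).trans (mul_le_mul hx' hp (norm_nonneg _) hX0)
      linarith
  obtain ⟨LF, hLF⟩ := (hF.locallyLipschitzOn (s := Metric.closedBall (0 : En N × ℝ) M)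
    ).exists_lipschitzOnWith_of_compact (isCompact_closedBall _ _)
  obtain ⟨LG, hLG⟩ := (hG.locallyLipschitzOn (s := Metric.closedBall (0 : En N × ℝ) M)
    ).exists_lipschitzOnWith_of_compact (isCompact_closedBall _ _)
  have hLam : 0 < Lam := hlam.trans_le ((hFb 0).1.trans (hFb 0).2)
  refine ⟨Lam * (LF + LG * (1 + |X|)) / lam ^ 2, by positivity, fun x hx hle => ?_⟩
  have hx' : ‖x‖ ≤ |X| := (hX x hx).trans (le_abs_self X)
  have hX0 : 0 ≤ |X| := abs_nonneg X
  obtain ⟨g1, g2⟩ := hM1 x hx g (s x)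
    ((hA x hx).trans ((le_abs_self A).trans (by linarith [abs_nonneg B])))
    (subgrad_norm_le hgK (hs.mem x))
  obtain ⟨h1, h2⟩ := hM1 x hx h (t x)
    ((hB x hx).trans ((le_abs_self B).trans (by linarith [abs_nonneg A])))
    (subgrad_norm_le hhK (ht.mem x))
  set δ := (g x - h x) + ‖s x - t x‖ with hδ
  have hn := norm_nonneg (s x - t x)
  have hδ0 : 0 ≤ δ := by linarith
  have eF : |F (x, g x) - F (x, h x)| ≤ LF * δ := by
    have := hLF.dist_le_mul _ g1 _ h1
    rw [Real.dist_eq, dist_eq_norm] at this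
    refine this.trans (mul_le_mul_of_nonneg_left ?_ LF.2)
    simp only [Prod.norm_def, Prod.mk_sub_mk, sub_self, norm_zero, sup_le_iff, Real.norm_eq_abs]
    exact ⟨hδ0, by rw [abs_of_nonneg (by linarith)]; linarith⟩
  have eG : |G (t x, ⟪x, t x⟫ - h x) - G (s x, ⟪x, s x⟫ - g x)| ≤ LG * ((1 + |X|) * δ) := by
    have := hLG.dist_le_mul _ h2 _ g2
    rw [Real.dist_eq, dist_eq_norm] at this
    refine this.trans (mul_le_mul_of_nonneg_left ?_ LG.2)
    simp only [Prod.norm_def, Prod.mk_sub_mk, sup_le_iff]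
    refine ⟨by rw [norm_sub_rev]; nlinarith, ?_⟩
    have e1 : ⟪x, t x⟫ - h x - (⟪x, s x⟫ - g x) = (g x - h x) - ⟪x, s x - t x⟫ := by
      rw [inner_sub_right]; ring
    rw [e1]
    refine (norm_sub_le _ _).trans ?_
    have e2 : ‖⟪x, s x - t x⟫‖ ≤ |X| * ‖s x - t x‖ :=
      (norm_inner_le_norm x _).trans (mul_le_mul_of_nonneg_right hx' hn)
    rw [Real.norm_eq_abs, abs_of_nonneg (by linarith : 0 ≤ g x - h x)]
    have : 0 ≤ |X| * (g x - h x) := mul_nonneg hX0 (by linarith)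
    rw [hδ]
    linarith
  unfold selDensity
  obtain ⟨b1, b2⟩ := hFb (x, h x)
  obtain ⟨c1, c2⟩ := hGb (s x, ⟪x, s x⟫ - g x)
  obtain ⟨d1, d2⟩ := hGb (t x, ⟪x, t x⟫ - h x)
  set a := F (x, g x)
  set b := F (x, h x)
  set c := G (s x, ⟪x, s x⟫ - g x)
  set d := G (t x, ⟪x, t x⟫ - h x)
  set L := Lam * (LF + LG * (1 + |X|)) / lam ^ 2 with hL
  have hL0 : 0 ≤ L := by positivity
  have hLe : L * lam ^ 2 = Lam * (LF + LG * (1 + |X|)) := by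
    rw [hL]; field_simp
  have hc : 0 < c := by linarith
  have hd : 0 < d := by linarith
  have hb : 0 < b := by linarith
  have k1 : (a - b) * d ≤ LF * δ * Lam :=
    mul_le_mul ((le_abs_self _).trans eF) d2 hd.le (mul_nonneg LF.2 hδ0)
  have k2 : (d - c) * b ≤ LG * ((1 + |X|) * δ) * Lam :=
    mul_le_mul ((le_abs_self _).trans eG) b2 hb.le (mul_nonneg LG.2 (by positivity))
  have k3 : lam ^ 2 ≤ b * c := by rw [sq]; exact mul_le_mul b1 c1 hlam.le hb.le
  have k4 : L * δ * lam ^ 2 ≤ L * δ * (b * c) :=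
    mul_le_mul_of_nonneg_left k3 (mul_nonneg hL0 hδ0)
  have k5 : L * δ * lam ^ 2 = Lam * (LF + LG * (1 + |X|)) * δ := by rw [← hLe]; ring
  have k6 : a * d ≤ (1 + L * δ) * (b * c) := by linarith
  rw [← mul_div_assoc, div_le_div_iff₀ hc hd]
  have := mul_le_mul_of_nonneg_left k6 (hf0 x)
  linarith

theorem false_of_local_contact {Ω : Set (En N)} (hΩ : IsOpen Ω) {f : En N → ℝ}
    (hf : Measurable f) (hf0 : ∀ x, 0 ≤ f x) {F G : En N × ℝ → ℝ}
    (hF : LocallyLipschitz F) (hG : LocallyLipschitz G) {lam Lam : ℝ} (hlam : 0 < lam)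
    (hFb : ∀ z, lam ≤ F z ∧ F z ≤ Lam) (hGb : ∀ z, lam ≤ G z ∧ G z ≤ Lam)
    {u v : En N → ℝ} (hu : ConvexOn ℝ Ω u) (hv : ConvexOn ℝ Ω v)
    (huv : ∀ x ∈ Ω, v x ≤ u x) (hMu : IsGenSol Ω f F G u) (hMv : IsGenSol Ω f F G v)
    {x₀ y p : En N} {r a C m η c₁ : ℝ} (hr : 0 < r) (hball : Metric.closedBall x₀ r ⊆ Ω)
    (hC : 0 < C) (hsph : ∀ x ∈ Metric.sphere x₀ r, a + ⟪p, x - y⟫ + C ≤ u x)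
    (hx₀ : u x₀ = v x₀) (hx₀C : u x₀ ≤ a + ⟪p, x₀ - y⟫ + C / 2)
    (hy : y ∈ Metric.closedBall x₀ r) (hvy : v y ≤ a) (hm : 0 < m)
    (hφ : ∀ x ∈ Metric.closedBall x₀ r ∩ Metric.ball y η, m ≤ u x - v x) (hc₁ : 0 < c₁)
    (huc₁ : ∀ x ∈ Metric.closedBall x₀ r \ Metric.ball y η, a + ⟪p, x - y⟫ + c₁ ≤ u x) :
    False := by
  obtain ⟨g, s, Kg, hs, hgK, hgu⟩ := exists_local_extension hΩ hu hr hball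
  obtain ⟨h, t, Kh, ht, hhK, hhv⟩ := exists_local_extension hΩ hv hr hball
  set K := max Kg Kh
  replace hgK : LipschitzWith K g := hgK.weaken (le_max_left _ _)
  replace hhK : LipschitzWith K h := hhK.weaken (le_max_right _ _)
  obtain ⟨L, hL0, hL⟩ := exists_selDensity_le hf0 hF hG hlam hFb hGb hs ht hgK hhK x₀ r
  have dg := hMu.det_ae_eq hf hf0 hF.continuous hG.continuous
    (fun z => hlam.le.trans (hFb z).1) (fun z => hlam.le.trans (hGb z).1) hu hs hgK hball hgu
  have dh := hMv.det_ae_eq hf hf0 hF.continuous hG.continuous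
    (fun z => hlam.le.trans (hFb z).1) (fun z => hlam.le.trans (hGb z).1) hv ht hhK hball hhv
  have key : ∀ {w : En N → ℝ} {q : En N → En N}, IsSel w q →
      IsSel (fun x => w x - (a + ⟪p, x - y⟫)) (fun x => q x - p) := by
    intro w q hw x z
    have h1 := hw x z
    have h2 : ⟪p, z - y⟫ = ⟪p, x - y⟫ + ⟪p, z - x⟫ := by rw [← inner_add_right]; simp
    simp only [inner_sub_left, h2]
    linarith
  have keyL : ∀ {w : En N → ℝ} {q : En N → En N}, IsSel w q → LipschitzWith K w →
      LipschitzWith (K + ‖p‖₊) (fun x => w x - (a + ⟪p, x - y⟫)) := by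
    intro w q hw hwK
    refine (key hw).lipschitzWith fun x => (norm_sub_le _ _).trans ?_
    have := subgrad_norm_le hwK (hw.mem x)
    push_cast
    simpa using this
  have hcb := Metric.ball_subset_closedBall (x := x₀) (ε := r)
  refine false_of_contact (key hs) (key ht) (keyL hs hgK) (keyL ht hhK) (L := L) (η := η) hr
    (fun x hx => ?_) hC (fun x hx => ?_) ?_ ?_ hy ?_ hm (fun x hx => ?_) hc₁ (fun x hx => ?_)
    hL0 ?_ ?_
  · rw [hgu x hx, hhv x hx]
    linarith [huv x (hball hx)]
  · rw [hgu x (Metric.sphere_subset_closedBall hx)]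
    linarith [hsph x hx]
  · rw [hgu x₀ (Metric.mem_closedBall_self hr.le), hhv x₀ (Metric.mem_closedBall_self hr.le), hx₀]
  · rw [hgu x₀ (Metric.mem_closedBall_self hr.le)]
    linarith
  · rw [hhv y hy]
    simpa using hvy
  · rw [hgu x hx.1, hhv x hx.1]
    linarith [hφ x hx]
  · rw [hgu x hx.1]
    linarith [huc₁ x hx]
  · filter_upwards [dg, dh] with x h1 h2 hx
    rw [fderiv_sub_const, fderiv_sub_const, h1 hx, h2 hx]
    have h3 := hL x (hcb hx) (by
      rw [hgu x (hcb hx), hhv x (hcb hx)]; exact huv x (hball (hcb hx)))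
    simpa using h3
  · intro S hS hSm hz
    have hshift : MAm univ (fun x => g x - (a + ⟪p, x - y⟫)) S = MAm univ g S := by
      unfold MAm
      rw [← measure_preimage_add_right volume p (⋃ x ∈ S, subgrad univ g x)]
      congr 1
      ext q
      simp only [mem_iUnion, mem_preimage, exists_prop, mem_subgrad_univ]
      refine exists_congr fun x => and_congr_right fun _ => forall_congr' fun z => ?_
      have h2 : ⟪p, z - y⟫ = ⟪p, x - y⟫ + ⟪p, z - x⟫ := by rw [← inner_add_right]; simp
      rw [inner_add_left, h2]
      constructor <;> intro h <;> linarith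
    rw [hshift, hMu.selDensity hu hs hgK hball hgu hS hSm]
    refine (setLIntegral_congr_fun_ae hSm ?_).trans lintegral_zero
    filter_upwards [dh, hz] with x h1 h2 hx
    have h3 := h2 hx
    rw [fderiv_sub_const, h1 (hS hx)] at h3
    have hfx : f x = 0 := by
      unfold selDensity at h3
      have hFp := hlam.trans_le (hFb (x, h x)).1
      have hGp := hlam.trans_le (hGb (t x, ⟪x, t x⟫ - h x)).1
      have h5 := (div_eq_zero_iff.1 h3).resolve_right hGp.ne'
      exact (mul_eq_zero.1 h5).resolve_right hFp.ne'
    simp [selDensity, hfx]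

end

section

open Filter Topology

variable {N : ℕ}

lemma centroid_ball (z : En N) {ρ : ℝ} (hρ : 0 < ρ) : centroid (Metric.ball z ρ) = z := by
  have hint : IntegrableOn (fun x : En N => x) (Metric.ball z ρ) :=
    (continuous_id.continuousOn.integrableOn_compact (isCompact_closedBall z ρ)).mono_set
      Metric.ball_subset_closedBall
  have hv : volume (Metric.ball z ρ) ≠ ∞ := Metric.isBounded_ball.measure_lt_top.ne
  have hv0 : (volume (Metric.ball z ρ)).toReal ≠ 0 :=
    (ENNReal.toReal_pos (Metric.measure_ball_pos _ _ hρ).ne' hv).ne'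
  have hpre : (fun x => (2 : ℝ) • z - x) ⁻¹' Metric.ball z ρ = Metric.ball z ρ := by
    ext x
    have : (2 : ℝ) • z - x - z = -(x - z) := by module
    simp only [mem_preimage, Metric.mem_ball, dist_eq_norm, this, norm_neg]
  have h1 := (Measure.measurePreserving_sub_left (volume : Measure (En N)) ((2 : ℝ) • z)
    ).setIntegral_preimage_emb (Homeomorph.subLeft ((2 : ℝ) • z)).measurableEmbedding
    (fun x => x) (Metric.ball z ρ)
  have hc : IntegrableOn (fun _ : En N => (2 : ℝ) • z) (Metric.ball z ρ) :=
    integrableOn_const hv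
  rw [hpre, integral_sub hc hint, setIntegral_const] at h1
  have h2 : ∫ x in Metric.ball z ρ, x = (volume (Metric.ball z ρ)).toReal • z := by
    have h3 : (2 : ℝ) • ∫ x in Metric.ball z ρ, x =
        (2 : ℝ) • ((volume (Metric.ball z ρ)).toReal • z) := by
      rw [two_smul]
      nth_rewrite 1 [← h1]
      rw [Measure.real, sub_add_cancel, smul_comm]
    exact smul_right_injective _ (two_ne_zero' ℝ) h3
  rw [centroid, h2, smul_smul, inv_mul_cancel₀ hv0, one_smul]

/-- A doubling measure vanishing near one point of a connected open set vanishes near all. -/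
lemma Doubling.measure_eq_zero {Ω : Set (En N)} (hΩo : IsOpen Ω) (hΩc : IsConnected Ω)
    {ν : Measure (En N)} (hd : Doubling (fun s => ν s) Ω) {O : Set (En N)} (hO : IsOpen O)
    (hOΩ : O ⊆ Ω) (hne : O.Nonempty) (h0 : ν O = 0) : ν Ω = 0 := by
  obtain ⟨c, b, hc, hb, hd⟩ := hd
  have hball : ∀ z ρ, 0 < ρ → Metric.ball z ρ ⊆ Ω → ν (Metric.ball z (c * ρ)) = 0 →
      ν (Metric.ball z ρ) = 0 := by
    intro z ρ hρ hz h
    have h1 := hd _ hz (convex_ball z ρ) Metric.isBounded_ball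
      (by rw [Metric.isOpen_ball.interior_eq]; exact Metric.nonempty_ball.2 hρ)
    have h2 : (fun y => centroid (Metric.ball z ρ) + c • (y - centroid (Metric.ball z ρ))) ''
        Metric.ball z ρ ⊆ Metric.ball z (c * ρ) := by
      rintro _ ⟨y, hy, rfl⟩
      rw [centroid_ball z hρ, Metric.mem_ball, dist_eq_norm, add_sub_cancel_left, norm_smul,
        Real.norm_of_nonneg hc.1.le]
      rw [Metric.mem_ball, dist_eq_norm] at hy
      exact mul_lt_mul_of_pos_left hy hc.1
    have h3 := le_antisymm (h1.trans ((measure_mono h2).trans h.le)) zero_le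
    rcases mul_eq_zero.1 h3 with h4 | h4
    · exact absurd h4 (ENNReal.ofReal_pos.2 hb).ne'
    · exact h4
  have hiter : ∀ (k : ℕ) z ρ, 0 < ρ → Metric.ball z ρ ⊆ Ω →
      ν (Metric.ball z (c ^ k * ρ)) = 0 → ν (Metric.ball z ρ) = 0 := by
    intro k
    induction k with
    | zero => intro z ρ _ _ h; simpa using h
    | succ k ih =>
      intro z ρ hρ hz h
      refine hball z ρ hρ hz (ih z (c * ρ) (mul_pos hc.1 hρ) ?_ ?_)
      · exact (Metric.ball_subset_ball (by nlinarith [hc.2])).trans hz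
      · rwa [← mul_assoc, ← pow_succ]
  set Z : Set (En N) := {x | ∃ ε > 0, ν (Metric.ball x ε) = 0} with hZ
  have hZo : IsOpen Z := by
    refine Metric.isOpen_iff.2 ?_
    rintro x ⟨ε, hε, hx⟩
    refine ⟨ε / 2, by positivity, fun y hy => ⟨ε / 2, by positivity, measure_mono_null ?_ hx⟩⟩
    refine Metric.ball_subset_ball' ?_
    rw [Metric.mem_ball] at hy
    linarith
  have hsub : Ω ⊆ Z := by
    refine hΩc.isPreconnected.subset_of_closure_inter_subset hZo ?_ ?_
    · obtain ⟨x, hx⟩ := hne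
      obtain ⟨ε, hε, hxO⟩ := Metric.isOpen_iff.1 hO x hx
      exact ⟨x, hOΩ hx, ε, hε, measure_mono_null hxO h0⟩
    · rintro x ⟨hxZ, hxΩ⟩
      obtain ⟨R, hR, hxR⟩ := Metric.isOpen_iff.1 hΩo x hxΩ
      obtain ⟨z, ⟨ε, hε, hz⟩, hxz⟩ := Metric.mem_closure_iff.1 hxZ (R / 4) (by positivity)
      have hk : ∃ k : ℕ, c ^ k * (R / 2) ≤ ε := by
        obtain ⟨k, hk⟩ := exists_pow_lt_of_lt_one (show 0 < ε / (R / 2) by positivity) hc.2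
        exact ⟨k, ((lt_div_iff₀ (by positivity)).1 hk).le⟩
      obtain ⟨k, hk⟩ := hk
      have h1 := hiter k z (R / 2) (by positivity)
        ((Metric.ball_subset_ball' (by rw [dist_comm]; linarith)).trans hxR)
        (measure_mono_null (Metric.ball_subset_ball hk) hz)
      exact ⟨R / 4, by positivity,
        measure_mono_null (Metric.ball_subset_ball' (by linarith)) h1⟩
  refine measure_null_of_locally_null Ω fun x hx => ?_
  obtain ⟨ε, hε, h⟩ := hsub hx
  exact ⟨_, mem_nhdsWithin_of_mem_nhds (Metric.ball_mem_nhds x hε), h⟩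

lemma exists_pos_lower_bound {D : Set (En N)} (hD : IsCompact D) {w : En N → ℝ}
    (hw : ContinuousOn w D) (h : ∀ x ∈ D, 0 < w x) : ∃ C > 0, ∀ x ∈ D, C ≤ w x := by
  rcases D.eq_empty_or_nonempty with rfl | hne
  · exact ⟨1, one_pos, fun _ h => h.elim⟩
  · obtain ⟨x, hx, hmin⟩ := hD.exists_isMinOn hne hw
    exact ⟨w x, h x hx, fun y hy => hmin hy⟩

lemma IsStrictConvexPt.lt_of_mem_subgrad {Ω : Set (En N)} {B : En N → ℝ} {x₀ p x : En N}
    (hB : ConvexOn ℝ Ω B) (h : IsStrictConvexPt Ω B x₀) (hx₀ : x₀ ∈ Ω)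
    (hp : p ∈ subgrad Ω B x₀) (hx : x ∈ Ω) (hne : x ≠ x₀) :
    B x₀ + ⟪p, x - x₀⟫ < B x := by
  have hm : (1 / 2 : ℝ) • (x + x₀) ∈ Ω := by
    rw [smul_add]
    exact hB.1 hx hx₀ (by norm_num) (by norm_num) (by norm_num)
  have h1 := hp _ hm
  have h2 := h x hx hne
  have h3 : (1 / 2 : ℝ) • (x + x₀) - x₀ = (1 / 2 : ℝ) • (x - x₀) := by module
  rw [h3, inner_smul_right] at h1
  linarith

lemma subgrad_nonempty_of_isOpen {Ω : Set (En N)} (hΩ : IsOpen Ω) {B : En N → ℝ}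
    (hB : ConvexOn ℝ Ω B) {x : En N} (hx : x ∈ Ω) : (subgrad Ω B x).Nonempty := by
  obtain ⟨r, hr, hball⟩ := Metric.nhds_basis_closedBall.mem_iff.1 (hΩ.mem_nhds hx)
  obtain ⟨g, s, K, hs, -, hgu⟩ := exists_local_extension hΩ hB hr hball
  refine ⟨s x, ?_⟩
  rw [subgrad_eq_of_extension hB hs hball hgu (Metric.mem_ball_self hr)]
  exact hs.mem x

lemma ball_subset_iUnion_subgrad {Ω : Set (En N)} {B : En N → ℝ}
    (hB : ConvexOn ℝ Ω B) (hBc : ContinuousOn B Ω) {x₀ p : En N} {r C : ℝ} (hr : 0 < r)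
    (hball : Metric.closedBall x₀ r ⊆ Ω)
    (hsph : ∀ x ∈ Metric.sphere x₀ r, C ≤ B x - (B x₀ + ⟪p, x - x₀⟫)) :
    Metric.ball p (C / r) ⊆ ⋃ x ∈ Metric.ball x₀ r, subgrad Ω B x := by
  intro q hq
  have hc : ContinuousOn (fun x => B x - ⟪q, x⟫) (Metric.closedBall x₀ r) :=
    (hBc.mono hball).sub (by fun_prop)
  obtain ⟨z, hz, hmin⟩ := (isCompact_closedBall x₀ r).exists_isMinOn
    ⟨x₀, Metric.mem_closedBall_self hr.le⟩ hc
  have hmin' : ∀ y ∈ Metric.closedBall x₀ r, B z - ⟪q, z⟫ ≤ B y - ⟪q, y⟫ := fun y hy => hmin hy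
  have hzb : z ∈ Metric.ball x₀ r := by
    rcases (Metric.mem_closedBall.1 hz).lt_or_eq with h | h
    · exact h
    · exfalso
      have h1 := hsph z h
      have h2 := hmin' x₀ (Metric.mem_closedBall_self hr.le)
      rw [dist_eq_norm] at h
      have h3 : |⟪q - p, z - x₀⟫| ≤ ‖q - p‖ * r := h ▸ abs_real_inner_le_norm _ _
      rw [Metric.mem_ball, dist_eq_norm, lt_div_iff₀ hr] at hq
      have h4 := (le_abs_self _).trans h3
      rw [inner_sub_left, inner_sub_right q] at h4
      linarith
  refine mem_iUnion₂.2 ⟨z, hzb, ?_⟩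
  refine mem_subgrad_of_local hB (h := B) (Metric.isOpen_ball.mem_nhds hzb) (hball hz)
    (fun _ _ => le_rfl) rfl fun y hy => ?_
  have := hmin' y (Metric.ball_subset_closedBall hy)
  rw [inner_sub_right]
  linarith

/-- The Monge–Ampère measure charges every nonempty open set. -/
theorem MAm_pos_of_isOpen {Ω : Set (En N)} (hΩo : IsOpen Ω) (hΩc : IsConnected Ω)
    {f : En N → ℝ} (hfm : Measurable f) (hf0 : ∀ x, 0 ≤ f x) {F G : En N × ℝ → ℝ}
    {lam Lam : ℝ} (hlam : 0 < lam)
    (hFb : ∀ z, lam ≤ F z ∧ F z ≤ Lam) (hGb : ∀ z, lam ≤ G z ∧ G z ≤ Lam)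
    (hdoub : Doubling (fun s => ∫⁻ x in s, ENNReal.ofReal (f x)) Ω) {B : En N → ℝ}
    (hB : ConvexOn ℝ Ω B) (hMB : IsGenSol Ω f F G B) {x₀ : En N} (hx₀ : x₀ ∈ Ω)
    (hst : IsStrictConvexPt Ω B x₀) {O : Set (En N)} (hO : IsOpen O) (hOΩ : O ⊆ Ω)
    (hne : O.Nonempty) : 0 < MAm Ω B O := by
  refine pos_iff_ne_zero.2 fun h0 => ?_
  have hLam : 0 < Lam := hlam.trans_le ((hFb 0).1.trans (hFb 0).2)
  have hfe : Measurable fun x => ENNReal.ofReal (f x) := hfm.ennreal_ofReal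
  have hν : ∀ s, volume.withDensity (fun x => ENNReal.ofReal (f x)) s =
      ∫⁻ x in s, ENNReal.ofReal (f x) := fun s => withDensity_apply' _ s
  have hνO : volume.withDensity (fun x => ENNReal.ofReal (f x)) O = 0 := by
    rw [hν]
    rw [hMB O hOΩ hO.measurableSet] at h0
    have h1 : ∫⁻ x in O, ENNReal.ofReal (lam / Lam) * ENNReal.ofReal (f x) ≤ 0 := by
      rw [← h0]
      refine lintegral_mono fun x => ?_
      rw [← ENNReal.ofReal_mul (by positivity)]
      refine ENNReal.ofReal_le_ofReal ?_
      obtain ⟨g1, g2⟩ := hGb (gradient B x, legendreT Ω B (gradient B x))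
      rw [div_mul_eq_mul_div, mul_comm]
      exact div_le_div₀ (mul_nonneg (hf0 x) (hlam.le.trans (hFb _).1))
        (mul_le_mul_of_nonneg_left (hFb _).1 (hf0 x)) (hlam.trans_le g1) g2
    rw [lintegral_const_mul _ hfe] at h1
    rcases mul_eq_zero.1 (le_antisymm h1 zero_le) with h2 | h2
    · exact absurd h2 (ENNReal.ofReal_pos.2 (by positivity)).ne'
    · exact h2
  have hνΩ := Doubling.measure_eq_zero hΩo hΩc (by simpa only [hν] using hdoub) hO hOΩ hne hνO
  rw [hν, lintegral_eq_zero_iff hfe] at hνΩ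
  have hM0 : MAm Ω B Ω = 0 := by
    rw [hMB Ω subset_rfl hΩo.measurableSet]
    refine (lintegral_congr_ae ?_).trans lintegral_zero
    filter_upwards [hνΩ] with x hx
    have hfx : f x = 0 := le_antisymm (ENNReal.ofReal_eq_zero.1 hx) (hf0 x)
    simp [hfx]
  obtain ⟨r, hr, hball⟩ := Metric.nhds_basis_closedBall.mem_iff.1 (hΩo.mem_nhds hx₀)
  obtain ⟨p, hp⟩ := subgrad_nonempty_of_isOpen hΩo hB hx₀
  have hBc : ContinuousOn B Ω := hB.continuousOn hΩo
  obtain ⟨C, hC, hsph⟩ := exists_pos_lower_bound (isCompact_sphere x₀ r)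
    (w := fun x => B x - (B x₀ + ⟪p, x - x₀⟫))
    ((hBc.mono (Metric.sphere_subset_closedBall.trans hball)).sub (by fun_prop))
    fun x hx => sub_pos.2 (hst.lt_of_mem_subgrad hB hx₀ hp
      (hball (Metric.sphere_subset_closedBall hx)) (Metric.ne_of_mem_sphere hx hr.ne'))
  have hsub := (ball_subset_iUnion_subgrad hB hBc hr hball hsph).trans
    (biUnion_subset_biUnion_left (Metric.ball_subset_closedBall.trans hball))
  exact (Metric.measure_ball_pos volume p (div_pos hC hr)).ne' (measure_mono_null hsub hM0)

end

section

open Filter Topology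

variable {N : ℕ}

/-- Almost every slope touches the graph of `B` over a compact set at one point only. -/
lemma exists_unique_contact {Ω D : Set (En N)} (hD : IsCompact D) (hDΩ : D ⊆ Ω) {B : En N → ℝ}
    (hBc : ContinuousOn B Ω) {O : Set (En N)} (hOD : O ⊆ D) (hpos : 0 < MAm Ω B O) :
    ∃ y ∈ O, ∃ p ∈ subgrad Ω B y, ∀ x ∈ D, x ≠ y → B y + ⟪p, x - y⟫ < B x := by
  set β : En N → ℝ := fun q => sSup ((fun x => ⟪q, x⟫ - B x) '' D) with hβ
  have hbdd : ∀ q, BddAbove ((fun x => ⟪q, x⟫ - B x) '' D) := fun q =>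
    hD.bddAbove_image (ContinuousOn.sub (by fun_prop) (hBc.mono hDΩ))
  have hle : ∀ q, ∀ x ∈ D, ⟪q, x⟫ - B x ≤ β q := fun q x hx => le_csSup (hbdd q) ⟨x, hx, rfl⟩
  obtain ⟨R, hR⟩ := hD.exists_bound_of_continuousOn (continuous_id (X := En N)).continuousOn
  rcases D.eq_empty_or_nonempty with rfl | hne
  · rw [subset_empty_iff.1 hOD] at hpos
    simp [MAm] at hpos
  have hlip : LipschitzWith R.toNNReal β := by
    refine LipschitzWith.of_le_add_mul _ fun q q' => ?_
    refine csSup_le (hne.image _) ?_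
    rintro _ ⟨x, hx, rfl⟩
    have h1 := hle q' x hx
    have h2 : ⟪q - q', x⟫ ≤ ‖q - q'‖ * ‖x‖ := real_inner_le_norm _ _
    have h3 : ‖x‖ ≤ R.toNNReal := (hR x hx).trans (Real.le_coe_toNNReal R)
    have h4 := mul_le_mul_of_nonneg_left h3 (norm_nonneg (q - q'))
    rw [inner_sub_left] at h2
    simp only [dist_eq_norm]
    linarith
  have hder : ∀ p, DifferentiableAt ℝ β p → ∀ x ∈ D, β p ≤ ⟪p, x⟫ - B x →
      fderiv ℝ β p = innerSL ℝ x := by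
    intro p hp x hx hxp
    have hmin : IsLocalMin (fun q => β q - innerSL ℝ x q) p := by
      refine Eventually.of_forall fun q => ?_
      have h1 := hle q x hx
      simp only [innerSL_apply_apply]
      rw [real_inner_comm] at h1 hxp
      linarith
    have h2 := hmin.fderiv_eq_zero
    rw [fderiv_fun_sub hp (innerSL ℝ x).differentiableAt, ContinuousLinearMap.fderiv] at h2
    exact sub_eq_zero.1 h2
  have hae : ∀ᵐ p : En N, DifferentiableAt ℝ β p := hlip.ae_differentiableAt
  obtain ⟨p, hp, hpd⟩ : ∃ p ∈ ⋃ x ∈ O, subgrad Ω B x, DifferentiableAt ℝ β p := by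
    by_contra! h
    exact hpos.ne' (measure_mono_null (fun p hp => h p hp) hae)
  obtain ⟨y, hy, hpy⟩ := mem_iUnion₂.1 hp
  refine ⟨y, hy, p, hpy, fun x hx hxy => ?_⟩
  by_contra! hcon
  have hyβ : β p ≤ ⟪p, y⟫ - B y := by
    refine csSup_le (hne.image _) ?_
    rintro _ ⟨z, hz, rfl⟩
    have h1 := hpy z (hDΩ hz)
    rw [inner_sub_right] at h1
    simp only
    linarith
  have hxβ : β p ≤ ⟪p, x⟫ - B x := by
    rw [inner_sub_right] at hcon
    linarith
  have h1 := (hder p hpd x hx hxβ).symm.trans (hder p hpd y (hOD hy) hyβ)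
  refine hxy (ext_inner_right ℝ fun w => ?_)
  simpa using congrArg (fun T : En N →L[ℝ] ℝ => T w) h1

/-- Supporting planes at points close to a strictly convex point separate from the graph on a
sphere by much more than they do at the centre. -/
lemma exists_separating_plane {Ω : Set (En N)} (hΩ : IsOpen Ω) {B : En N → ℝ}
    (hB : ConvexOn ℝ Ω B) {x₀ : En N} {r : ℝ} (hr : 0 < r) (hball : Metric.closedBall x₀ r ⊆ Ω)
    (hst : IsStrictConvexPt Ω B x₀) {y p : ℕ → En N} (hy : ∀ k, y k ∈ Metric.ball x₀ r)
    (hlim : Tendsto y atTop (𝓝 x₀)) (hp : ∀ k, p k ∈ subgrad Ω B (y k)) :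
    ∃ C > 0, ∃ k, (∀ x ∈ Metric.sphere x₀ r, B (y k) + ⟪p k, x - y k⟫ + C ≤ B x) ∧
      B x₀ ≤ B (y k) + ⟪p k, x₀ - y k⟫ + C / 2 := by
  have hx₀ : x₀ ∈ Ω := hball (Metric.mem_closedBall_self hr.le)
  obtain ⟨g, s, K, hs, hgK, hgu⟩ := exists_local_extension hΩ hB hr hball
  have hpK : ∀ k, ‖p k‖ ≤ K := fun k => subgrad_norm_le hgK (x := y k) (by
    rw [← subgrad_eq_of_extension hB hs hball hgu (hy k)]; exact hp k)
  obtain ⟨q, -, φ, hφ, hq⟩ := tendsto_subseq_of_bounded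
    (Metric.isBounded_closedBall (x := (0 : En N)) (r := K)) (x := p)
    fun k => mem_closedBall_zero_iff.2 (hpK k)
  have hyφ : Tendsto (fun k => y (φ k)) atTop (𝓝 x₀) := hlim.comp hφ.tendsto_atTop
  have hpφ : Tendsto (fun k => p (φ k)) atTop (𝓝 q) := hq
  have hBc : ContinuousOn B Ω := hB.continuousOn hΩ
  have hBy : Tendsto (fun k => B (y (φ k))) atTop (𝓝 (B x₀)) :=
    ((hBc.continuousAt (hΩ.mem_nhds hx₀)).tendsto).comp hyφ
  have hpl : ∀ x, Tendsto (fun k => B (y (φ k)) + ⟪p (φ k), x - y (φ k)⟫) atTop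
      (𝓝 (B x₀ + ⟪q, x - x₀⟫)) := fun x =>
    hBy.add (hpφ.inner (tendsto_const_nhds.sub hyφ))
  have hqm : q ∈ subgrad Ω B x₀ := fun x hx =>
    le_of_tendsto (hpl x) (Eventually.of_forall fun k => hp (φ k) x hx)
  obtain ⟨C, hC, hsph⟩ := exists_pos_lower_bound (isCompact_sphere x₀ r)
    (w := fun x => B x - (B x₀ + ⟪q, x - x₀⟫))
    ((hBc.mono (Metric.sphere_subset_closedBall.trans hball)).sub (by fun_prop))
    fun x hx => sub_pos.2 (hst.lt_of_mem_subgrad hB hx₀ hqm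
      (hball (Metric.sphere_subset_closedBall hx)) (Metric.ne_of_mem_sphere hx hr.ne'))
  have e1 : ∀ᶠ k in atTop, B x₀ - C / 4 < B (y (φ k)) + ⟪p (φ k), x₀ - y (φ k)⟫ := by
    have := hpl x₀
    rw [sub_self, inner_zero_right, add_zero] at this
    exact this.eventually_const_lt (by linarith)
  have e2 : ∀ᶠ k in atTop, B (y (φ k)) + ⟪p (φ k), x₀ - y (φ k)⟫ < B x₀ + C / 4 := by
    have := hpl x₀
    rw [sub_self, inner_zero_right, add_zero] at this
    exact this.eventually_lt_const (by linarith)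
  have e3 : ∀ᶠ k in atTop, ‖p (φ k) - q‖ < C / (4 * r) := by
    have : Tendsto (fun k => ‖p (φ k) - q‖) atTop (𝓝 0) :=
      tendsto_iff_norm_sub_tendsto_zero.1 hpφ
    exact this.eventually_lt_const (by positivity)
  obtain ⟨k, h1, h2, h3⟩ := (e1.and (e2.and e3)).exists
  refine ⟨C / 2, by positivity, φ k, fun x hx => ?_, by linarith⟩
  have h4 := hsph x hx
  have hxr : ‖x - x₀‖ = r := by rw [← dist_eq_norm]; exact hx
  have h5 : ⟪p (φ k) - q, x - x₀⟫ ≤ ‖p (φ k) - q‖ * r := hxr ▸ real_inner_le_norm _ _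
  have h6 : ‖p (φ k) - q‖ * r ≤ C / 4 := by
    have := mul_le_mul_of_nonneg_right h3.le hr.le
    have h7 : C / (4 * r) * r = C / 4 := by field_simp
    linarith
  have h8 : ⟪p (φ k), x - y (φ k)⟫ = ⟪p (φ k), x₀ - y (φ k)⟫ + ⟪p (φ k), x - x₀⟫ := by
    rw [← inner_add_right]; simp
  rw [inner_sub_left] at h5
  rw [h8]
  linarith

/-- The touching set is a neighbourhood of each strictly convex point in it. -/
theorem eventually_eq_of_contact {Ω : Set (En N)} (hΩo : IsOpen Ω) (hΩc : IsConnected Ω)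
    {f : En N → ℝ} (hf : Measurable f) (hf0 : ∀ x, 0 ≤ f x) {F G : En N × ℝ → ℝ}
    (hF : LocallyLipschitz F) (hG : LocallyLipschitz G) {lam Lam : ℝ} (hlam : 0 < lam)
    (hFb : ∀ z, lam ≤ F z ∧ F z ≤ Lam) (hGb : ∀ z, lam ≤ G z ∧ G z ≤ Lam)
    (hdoub : Doubling (fun s => ∫⁻ x in s, ENNReal.ofReal (f x)) Ω)
    {u v B : En N → ℝ} (hu : ConvexOn ℝ Ω u) (hv : ConvexOn ℝ Ω v) (hB : ConvexOn ℝ Ω B)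
    (hBu : ∀ x ∈ Ω, B x ≤ u x) (hvB : ∀ x ∈ Ω, v x ≤ B x) (hMu : IsGenSol Ω f F G u)
    (hMv : IsGenSol Ω f F G v) (hMB : IsGenSol Ω f F G B) {x₀ : En N} (hx₀ : x₀ ∈ Ω)
    (hst : IsStrictConvexPt Ω B x₀) (heq : u x₀ = v x₀) : ∀ᶠ x in 𝓝 x₀, u x = v x := by
  by_contra hcon
  obtain ⟨r, hr, hball⟩ := Metric.nhds_basis_closedBall.mem_iff.1 (hΩo.mem_nhds hx₀)
  have huc : ContinuousOn u Ω := hu.continuousOn hΩo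
  have hvc : ContinuousOn v Ω := hv.continuousOn hΩo
  have hBc : ContinuousOn B Ω := hB.continuousOn hΩo
  have hballΩ : Metric.ball x₀ r ⊆ Ω := Metric.ball_subset_closedBall.trans hball
  have hlt : IsOpen {x ∈ Metric.ball x₀ r | v x < u x} := by
    have := ((huc.mono hballΩ).sub (hvc.mono hballΩ)).isOpen_inter_preimage Metric.isOpen_ball
      (isOpen_Ioi (a := (0 : ℝ)))
    convert this using 1
    ext x
    simp
  have hcont : ∀ k : ℕ, ∃ y ∈ {x ∈ Metric.ball x₀ r | v x < u x} ∩
      Metric.ball x₀ (1 / ((k : ℝ) + 1)), ∃ p ∈ subgrad Ω B y,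
        ∀ x ∈ Metric.closedBall x₀ r, x ≠ y → B y + ⟪p, x - y⟫ < B x := by
    intro k
    have hsub : {x ∈ Metric.ball x₀ r | v x < u x} ∩ Metric.ball x₀ (1 / ((k : ℝ) + 1)) ⊆
        Metric.ball x₀ r := fun x hx => hx.1.1
    refine exists_unique_contact (isCompact_closedBall x₀ r) hball hBc
      (hsub.trans Metric.ball_subset_closedBall)
      (MAm_pos_of_isOpen hΩo hΩc hf hf0 hlam hFb hGb hdoub hB hMB hx₀ hst
        (hlt.inter Metric.isOpen_ball) (hsub.trans hballΩ) ?_)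
    by_contra hemp
    rw [not_nonempty_iff_eq_empty] at hemp
    refine hcon ?_
    filter_upwards [Metric.ball_mem_nhds x₀ hr,
      Metric.ball_mem_nhds x₀ (show 0 < 1 / ((k : ℝ) + 1) by positivity)] with x h1 h2
    by_contra hne
    have hvu : v x < u x :=
      lt_of_le_of_ne ((hvB x (hballΩ h1)).trans (hBu x (hballΩ h1))) (Ne.symm hne)
    exact eq_empty_iff_forall_notMem.1 hemp x ⟨⟨h1, hvu⟩, h2⟩
  choose y hy p hp hpu using hcont
  have hlim : Tendsto y atTop (𝓝 x₀) := by
    rw [tendsto_iff_dist_tendsto_zero]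
    exact squeeze_zero (fun _ => dist_nonneg) (fun k => (Metric.mem_ball.1 (hy k).2).le)
      tendsto_one_div_add_atTop_nhds_zero_nat
  obtain ⟨C, hC, k, hsph, hcen⟩ := exists_separating_plane hΩo hB hr hball hst
    (fun k => (hy k).1.1) hlim hp
  have hyb := (hy k).1.1
  have hyΩ : y k ∈ Ω := hballΩ hyb
  have hBx₀ : u x₀ = B x₀ :=
    le_antisymm (heq.le.trans (hvB x₀ hx₀)) (hBu x₀ hx₀)
  set m := (u (y k) - v (y k)) / 2 with hm
  have hm0 : 0 < m := by linarith [(hy k).1.2]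
  have hev : ∀ᶠ x in 𝓝 (y k), m < u x - v x :=
    ((huc.continuousAt (hΩo.mem_nhds hyΩ)).sub (hvc.continuousAt (hΩo.mem_nhds hyΩ))
      ).eventually_const_lt (show m < u (y k) - v (y k) by linarith)
  obtain ⟨η, hη, hηm⟩ := Metric.eventually_nhds_iff_ball.1 hev
  obtain ⟨c₁, hc₁, hc₁B⟩ := exists_pos_lower_bound
    ((isCompact_closedBall x₀ r).diff (Metric.isOpen_ball (x := y k) (ε := η)))
    (w := fun x => B x - (B (y k) + ⟪p k, x - y k⟫))
    ((hBc.mono (sdiff_subset.trans hball)).sub (by fun_prop))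
    fun x hx => sub_pos.2 (hpu k x hx.1 fun h => hx.2 (h ▸ Metric.mem_ball_self hη))
  refine false_of_local_contact hΩo hf hf0 hF hG hlam hFb hGb hu hv
    (fun x hx => (hvB x hx).trans (hBu x hx)) hMu hMv (η := η) hr hball hC
    (fun x hx => (hsph x hx).trans (hBu x (hball (Metric.sphere_subset_closedBall hx)))) heq
    (hBx₀.le.trans hcen) (Metric.ball_subset_closedBall hyb) (hvB _ hyΩ) hm0
    (fun x hx => (hηm x hx.2).le) hc₁ fun x hx => ?_
  linarith [hc₁B x hx, hBu x (hball hx.1)]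

end

/-- Theorem 5.5 (Theorem `thm:smp dege 35`): strong maximum principle when `f` satisfies
the EDT property and `f dx` satisfies the doubling condition, on each connected component
of `Ω \ (Σ_u ∩ Σ_v)`. -/
theorem statement_16 {n : ℕ} (Ω : Set (En (n + 1))) (hΩo : IsOpen Ω) (hΩc : IsConnected Ω)
    (f : En (n + 1) → ℝ) (hfm : Measurable f) (hfnn : ∀ x, 0 ≤ f x)
    (F G : En (n + 1) × ℝ → ℝ)
    (lam Lam : ℝ) (hlam : 0 < lam) (hLam : lam ≤ Lam)
    (hFb : ∀ p : En (n + 1) × ℝ, lam ≤ F p ∧ F p ≤ Lam)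
    (hGb : ∀ p : En (n + 1) × ℝ, lam ≤ G p ∧ G p ≤ Lam)
    (hFlip : LocallyLipschitz F) (hGlip : LocallyLipschitz G)
    (hEDT : EDTprop f)
    (hdoub : Doubling (fun s => ∫⁻ x in s, ENNReal.ofReal (f x)) Ω)
    (u v : En (n + 1) → ℝ) (hu : ConvexOn ℝ Ω u) (hv : ConvexOn ℝ Ω v)
    (huv : ∀ x ∈ Ω, v x ≤ u x)
    (hMu : IsGenSol Ω f F G u) (hMv : IsGenSol Ω f F G v) :
    ∀ x ∈ Ω \ (SigmaSet Ω u ∩ SigmaSet Ω v),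
      (∀ y ∈ connectedComponentIn (Ω \ (SigmaSet Ω u ∩ SigmaSet Ω v)) x, u y = v y) ∨
      (∀ y ∈ connectedComponentIn (Ω \ (SigmaSet Ω u ∩ SigmaSet Ω v)) x, v y < u y) := by
  have huc : ContinuousOn u Ω := hu.continuousOn hΩo
  have hvc : ContinuousOn v Ω := hv.continuousOn hΩo
  have hcontact : ∀ x ∈ Ω \ (SigmaSet Ω u ∩ SigmaSet Ω v), u x = v x →
      x ∈ interior {y | u y = v y} := by
    rintro x ⟨hxΩ, hx⟩ heq
    rw [mem_interior_iff_mem_nhds]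
    rcases not_and_or.1 hx with h | h
    · have hst : IsStrictConvexPt Ω u x := by
        by_contra hn
        exact h ⟨hxΩ, hn⟩
      exact eventually_eq_of_contact hΩo hΩc hfm hfnn hFlip hGlip hlam hFb hGb hdoub hu hv hu
        (fun _ _ => le_rfl) huv hMu hMv hMu hxΩ hst heq
    · have hst : IsStrictConvexPt Ω v x := by
        by_contra hn
        exact h ⟨hxΩ, hn⟩
      exact eventually_eq_of_contact hΩo hΩc hfm hfnn hFlip hGlip hlam hFb hGb hdoub hu hv hv
        huv (fun _ _ => le_rfl) hMu hMv hMv hxΩ hst heq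
  have hopen : IsOpen {y ∈ Ω | v y < u y} := by
    have := (huc.sub hvc).isOpen_inter_preimage hΩo (isOpen_Ioi (a := (0 : ℝ)))
    convert this using 1
    ext y
    simp
  intro x _
  set S := connectedComponentIn (Ω \ (SigmaSet Ω u ∩ SigmaSet Ω v)) x
  have hS : S ⊆ Ω \ (SigmaSet Ω u ∩ SigmaSet Ω v) := connectedComponentIn_subset _ _
  by_cases h1 : (S ∩ interior {y | u y = v y}).Nonempty
  · left
    intro y hy
    by_contra hne
    have hlt : v y < u y := lt_of_le_of_ne (huv y (hS hy).1) (Ne.symm hne)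
    obtain ⟨z, -, hz, hz'⟩ := isPreconnected_connectedComponentIn (interior {y | u y = v y})
      {y ∈ Ω | v y < u y} isOpen_interior hopen (fun z hz => by
        by_cases heq : u z = v z
        · exact Or.inl (hcontact z (hS hz) heq)
        · exact Or.inr ⟨(hS hz).1, lt_of_le_of_ne (huv z (hS hz).1) (Ne.symm heq)⟩)
      h1 ⟨y, hy, (hS hy).1, hlt⟩
    have hz1 : z ∈ {y | u y = v y} := interior_subset hz
    exact hz'.2.ne' hz1
  · right
    intro y hy
    refine lt_of_le_of_ne (huv y (hS hy).1) fun heq => h1 ⟨y, hy, hcontact y (hS hy) heq.symm⟩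
end
end

section
/- Let Ω ⊆ ℝⁿ be a bounded open set, let u be a convex function on Ω, let x₀ ∈ Ω, and suppose there exist r > 0 and c > 0 with B_r(x₀) ⊆ Ω and Mu(E) ≥ c·|E| for every Borel set E ⊆ B_r(x₀). Then there exists a constant C > 0, depending only on n, c, r and the diameter of Ω, such that for every subgradient p ∈ ∂u(x₀) and all sufficiently small t > 0, the section satisfies |S^u_{t,p}(x₀)| ≤ C·t^{n/2}, where |·| is Lebesgue measure. -/
open MeasureTheory Set
open scoped RealInnerProductSpace ENNReal

noncomputable section

/-- The section `S^u_{t,p}(x₀)` of `u` at `x₀` with height `t` for the subgradient `p`. -/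
def maSection {n : ℕ} (Ω : Set (En n)) (u : En n → ℝ) (x₀ p : En n) (t : ℝ) : Set (En n) :=
  {x ∈ Ω | u x < u x₀ + ⟪p, x - x₀⟫ + t}

/-- The standard basis of `ℝⁿ`. -/
abbrev stdBasis (n : ℕ) : Module.Basis (Fin n) ℝ (En n) :=
  (EuclideanSpace.basisFun (Fin n) ℝ).toBasis

/-- The linear map sending the standard basis to the family `w`. -/
def frameMap {n : ℕ} (w : Fin n → En n) : En n →ₗ[ℝ] En n :=
  (stdBasis n).constr ℝ w

lemma frameMap_apply {n : ℕ} (w : Fin n → En n) (a : En n) :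
    frameMap w a = ∑ i, a i • w i := by
  simp [frameMap, Module.Basis.constr_apply_fintype]

lemma det_frameMap {n : ℕ} (w : Fin n → En n) :
    LinearMap.det (frameMap w) = (stdBasis n).det w := by
  have h := (stdBasis n).det_comp (frameMap w) (stdBasis n)
  rw [Module.Basis.det_self, mul_one] at h
  rw [← h]
  congr 1
  ext1 i
  simp only [frameMap, Function.comp_apply, Module.Basis.constr_basis]

lemma adjoint_frameMap_apply {n : ℕ} (w : Fin n → En n) (q : En n) (i : Fin n) :
    (LinearMap.adjoint (frameMap w) q) i = ⟪q, w i⟫ := by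
  have h : frameMap w (EuclideanSpace.single i 1) = w i := by
    rw [frameMap_apply, Finset.sum_eq_single i] <;> simp +contextual
  rw [← h, ← LinearMap.adjoint_inner_left, EuclideanSpace.inner_single_right]
  simp

lemma det_adjoint_frameMap {n : ℕ} (w : Fin n → En n) :
    LinearMap.det (LinearMap.adjoint (frameMap w)) = (stdBasis n).det w := by
  rw [← det_frameMap, ← LinearMap.det_toMatrix (stdBasis n),
    LinearMap.toMatrix_adjoint, Matrix.det_conjTranspose, LinearMap.det_toMatrix]
  simp

/-- The coordinate cube `[a, b]ⁿ`. -/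
def cube (n : ℕ) (a b : ℝ) : Set (En n) := {x | ∀ i, x i ∈ Icc a b}

lemma volume_cube (n : ℕ) {a b : ℝ} (hab : a ≤ b) :
    volume (cube n a b) = ENNReal.ofReal ((b - a) ^ n) := by
  have h : cube n a b = WithLp.ofLp ⁻¹' (Set.pi univ fun _ : Fin n => Icc a b) := by
    ext x
    simp only [cube, mem_ofPred_eq, mem_preimage, mem_univ_pi]
  rw [h, (PiLp.volume_preserving_ofLp (Fin n)).measure_preimage
    (MeasurableSet.univ_pi fun _ => measurableSet_Icc).nullMeasurableSet, volume_pi_pi,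
    ENNReal.ofReal_pow (by linarith)]
  simp

lemma isCompact_cube (n : ℕ) (a b : ℝ) : IsCompact (cube n a b) := by
  have h : cube n a b = WithLp.toLp 2 '' (Set.pi univ fun _ : Fin n => Icc a b) := by
    ext x
    constructor
    · exact fun hx => ⟨x.ofLp, fun i _ => hx i, rfl⟩
    · rintro ⟨y, hy, rfl⟩ i
      exact hy i trivial
  rw [h]
  exact (isCompact_univ_pi fun _ => isCompact_Icc).image (PiLp.continuous_toLp 2 _)

/-- A bounded neighbourhood of the origin contains a frame whose determinant is at least half of
the supremum over all frames in the set. -/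
lemma exists_almost_maximal_frame {n : ℕ} {T : Set (En n)} {d : ℝ} (hT : ∀ v ∈ T, ‖v‖ ≤ d)
    (hT0 : T ∈ nhds 0) :
    ∃ w : Fin n → En n, (∀ i, w i ∈ T) ∧ (stdBasis n).det w ≠ 0 ∧
      ∀ w' : Fin n → En n, (∀ i, w' i ∈ T) →
        |(stdBasis n).det w'| ≤ 2 * |(stdBasis n).det w| := by
  set F : Set ℝ := (fun w : Fin n → En n => |(stdBasis n).det w|) '' {w | ∀ i, w i ∈ T} with hF
  have hcont : Continuous fun w : Fin n → En n => |(stdBasis n).det w| := by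
    simp only [Module.Basis.det_apply]
    refine (Continuous.matrix_det (continuous_matrix fun i j => ?_)).abs
    simp only [Module.Basis.toMatrix_apply, OrthonormalBasis.coe_toBasis_repr_apply,
      EuclideanSpace.basisFun_repr]
    fun_prop
  have hbdd : BddAbove F := by
    have hK : IsCompact (Set.pi univ fun _ : Fin n => Metric.closedBall (0 : En n) d) :=
      isCompact_univ_pi fun _ => isCompact_closedBall _ _
    refine (hK.image hcont).bddAbove.mono (image_mono ?_)
    exact fun w hw i _ => by simpa using hT _ (hw i)
  obtain ⟨ε, hε, hball⟩ := Metric.mem_nhds_iff.1 hT0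
  have hmem : ∀ i, (ε / 2) • stdBasis n i ∈ T := fun i => hball (by
    simp [norm_smul, abs_of_pos hε]; linarith)
  have hpos : 0 < |(stdBasis n).det fun i => (ε / 2) • stdBasis n i| := by
    rw [abs_pos, AlternatingMap.map_smul_univ, Module.Basis.det_self]
    simp [hε.ne']
  have hsup : 0 < sSup F := hpos.trans_le (le_csSup hbdd ⟨_, hmem, rfl⟩)
  obtain ⟨_, ⟨w, hw, rfl⟩, hlt⟩ :=
    exists_lt_of_lt_csSup (⟨_, _, hmem, rfl⟩ : F.Nonempty) (half_lt_self hsup)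
  refine ⟨w, hw, ?_, fun w' hw' => ?_⟩
  · rw [← abs_pos]
    exact (half_pos hsup).trans hlt
  · have := le_csSup hbdd ⟨w', hw', rfl⟩
    dsimp only at hlt this
    linarith

lemma det_update_frameMap {n : ℕ} (w : Fin n → En n) (a : En n) (i : Fin n) :
    (stdBasis n).det (Function.update w i (frameMap w a)) = a i * (stdBasis n).det w := by
  rw [frameMap_apply, AlternatingMap.map_update_sum, Finset.sum_eq_single i]
  · rw [AlternatingMap.map_update_smul, Function.update_eq_self, smul_eq_mul]
  · intro j _ hj
    rw [AlternatingMap.map_update_smul, (stdBasis n).det.map_update_self w hj.symm, smul_zero]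
  · simp

/-- A set all of whose frames have determinant at most twice that of `w` lies in the
parallelepiped with coordinates in `[-2, 2]` relative to `w`. -/
lemma subset_image_cube {n : ℕ} {T : Set (En n)} {w : Fin n → En n} (hw : ∀ i, w i ∈ T)
    (hdet : (stdBasis n).det w ≠ 0)
    (hmax : ∀ w' : Fin n → En n, (∀ i, w' i ∈ T) →
      |(stdBasis n).det w'| ≤ 2 * |(stdBasis n).det w|) :
    T ⊆ frameMap w '' cube n (-2) 2 := by
  intro x hx
  have hsurj : Function.Surjective (frameMap w) := by
    rw [← det_frameMap] at hdet
    exact (LinearMap.equivOfDetNeZero _ hdet).surjective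
  obtain ⟨a, rfl⟩ := hsurj x
  refine ⟨a, fun i => ?_, rfl⟩
  have h := hmax (Function.update w i (frameMap w a)) fun j => by
    rcases eq_or_ne j i with rfl | hj
    · simpa using hx
    · simpa [hj] using hw j
  rw [det_update_frameMap, abs_mul] at h
  exact abs_le.1 (le_of_mul_le_mul_right h (abs_pos.2 hdet))

lemma convex_maSection {n : ℕ} {Ω : Set (En n)} {u : En n → ℝ} (hu : ConvexOn ℝ Ω u)
    (x₀ p : En n) (t : ℝ) : Convex ℝ (maSection Ω u x₀ p t) := by
  rintro x ⟨hx, hxu⟩ y ⟨hy, hyu⟩ a b ha hb hab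
  refine ⟨hu.1 hx hy ha hb hab, (hu.2 hx hy ha hb hab).trans_lt ?_⟩
  have e : a • x + b • y - x₀ = a • (x - x₀) + b • (y - x₀) := by
    rw [smul_sub, smul_sub, sub_add_sub_comm, ← add_smul, hab, one_smul]
  rw [e, inner_add_right, inner_smul_right, inner_smul_right, smul_eq_mul, smul_eq_mul]
  have h : u x₀ + (a * ⟪p, x - x₀⟫ + b * ⟪p, y - x₀⟫) + t =
      a * (u x₀ + ⟪p, x - x₀⟫ + t) + b * (u x₀ + ⟪p, y - x₀⟫ + t) := by
    linear_combination (-(u x₀) - t) * hab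
  rw [h]
  rcases ha.eq_or_lt with rfl | ha'
  · have : b = 1 := by linarith
    subst this
    linarith
  · nlinarith [mul_lt_mul_of_pos_left hxu ha', mul_le_mul_of_nonneg_left hyu.le hb]

lemma maSection_mem_nhds {n : ℕ} {Ω : Set (En n)} {u : En n → ℝ} {x₀ : En n} (hΩ : IsOpen Ω)
    (hu : ConvexOn ℝ Ω u) (hx₀ : x₀ ∈ Ω) (p : En n) {t : ℝ} (ht : 0 < t) :
    maSection Ω u x₀ p t ∈ nhds x₀ := by
  have hc : ContinuousAt u x₀ := (hu.continuousOn hΩ).continuousAt (hΩ.mem_nhds hx₀)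
  have hc' : ContinuousAt (fun x => u x₀ + ⟪p, x - x₀⟫ + t) x₀ := by fun_prop
  filter_upwards [hΩ.mem_nhds hx₀, hc.eventually_lt hc' (by simpa using ht)] with x h1 h2
  exact ⟨h1, h2⟩

/-- If the endpoints `x₀ + w i` lie in the section, so does every small nonnegative combination. -/
lemma add_frameMap_mem_maSection {n : ℕ} {Ω : Set (En n)} {u : En n → ℝ} {x₀ p : En n} {t : ℝ}
    (hu : ConvexOn ℝ Ω u) (h0 : x₀ ∈ maSection Ω u x₀ p t) {w : Fin n → En n}
    (hw : ∀ i, x₀ + w i ∈ maSection Ω u x₀ p t) {a : En n} (ha : ∀ i, 0 ≤ a i)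
    (ha1 : ∑ i, a i ≤ 1) : x₀ + frameMap w a ∈ maSection Ω u x₀ p t := by
  have hconv := convex_maSection hu x₀ p t
  have h := hconv.sum_mem (t := (Finset.univ : Finset (Option (Fin n))))
    (w := fun o => o.elim (1 - ∑ i, a i) a) (z := fun o => o.elim x₀ fun i => x₀ + w i)
    (by rintro (_ | i) _ <;> simp [ha1, ha])
    (by simp [Fintype.sum_option])
    (by rintro (_ | i) _ <;> simp [h0, hw])
  convert h using 1
  simp [Fintype.sum_option, frameMap_apply, Finset.sum_add_distrib, sub_smul, ← Finset.sum_smul]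
  abel

lemma abs_inner_sub_le {n : ℕ} {Ω : Set (En n)} {u : En n → ℝ} {x₀ p x q v : En n} {t : ℝ}
    (hp : p ∈ subgrad Ω u x₀) (hx : x ∈ Ω) (hq : q ∈ subgrad Ω u x)
    (h1 : x + v ∈ maSection Ω u x₀ p t) (h2 : x - v ∈ maSection Ω u x₀ p t) :
    |⟪q - p, v⟫| ≤ t := by
  have e0 := hp x hx
  have e1 := hq _ h1.1
  have e2 := hq _ h2.1
  have f1 := h1.2
  have f2 := h2.2
  rw [add_sub_cancel_left] at e1
  rw [sub_sub_cancel_left, inner_neg_right] at e2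
  rw [add_sub_right_comm, inner_add_right] at f1
  rw [sub_right_comm, inner_sub_right] at f2
  rw [inner_sub_left, abs_le]
  constructor <;> linarith

lemma frameMap_add_single {n : ℕ} (w : Fin n → En n) (a : En n) (i : Fin n) (s : ℝ) :
    frameMap w (a + EuclideanSpace.single i s) = frameMap w a + s • w i := by
  rw [map_add]
  congr 1
  rw [frameMap_apply, Finset.sum_eq_single i] <;> simp +contextual

/-- Subgradients at the points of a small parallelepiped inside a section of height `t` lie in
the dual parallelepiped centred at `p`. -/
lemma iUnion_subgrad_subset {n : ℕ} {Ω : Set (En n)} {u : En n → ℝ} {x₀ p : En n} {t δ : ℝ}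
    (hu : ConvexOn ℝ Ω u) (hp : p ∈ subgrad Ω u x₀) (h0 : x₀ ∈ maSection Ω u x₀ p t)
    {w : Fin n → En n} (hw : ∀ i, x₀ + w i ∈ maSection Ω u x₀ p t) (hδ : 0 < δ)
    (hδn : 4 * δ * n ≤ 1) :
    (⋃ x ∈ (x₀ + ·) '' (frameMap w '' cube n δ (3 * δ)), subgrad Ω u x) ⊆
      (· - p) ⁻¹' (LinearMap.adjoint (frameMap w) ⁻¹' cube n (-(t / δ)) (t / δ)) := by
  intro q hq
  simp only [mem_iUnion] at hq
  obtain ⟨_, ⟨_, ⟨a, ha, rfl⟩, rfl⟩, hq⟩ := hq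
  have key : ∀ b : En n, (∀ i, b i ∈ Icc 0 (4 * δ)) →
      x₀ + frameMap w b ∈ maSection Ω u x₀ p t := fun b hb => by
    refine add_frameMap_mem_maSection hu h0 hw (fun i => (hb i).1) ?_
    calc ∑ i, b i ≤ ∑ _i : Fin n, 4 * δ := Finset.sum_le_sum fun i _ => (hb i).2
      _ = 4 * δ * n := by simp [mul_comm]
      _ ≤ 1 := hδn
  intro i
  rw [adjoint_frameMap_apply]
  have hs : ∀ s : ℝ, |s| ≤ δ → x₀ + (frameMap w a + s • w i) ∈ maSection Ω u x₀ p t := by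
    intro s hs
    rw [← frameMap_add_single]
    refine key _ fun j => ?_
    have hs' := abs_le.1 hs
    have hj := ha j
    rcases eq_or_ne j i with rfl | hne
    · simp only [PiLp.add_apply, PiLp.single_apply, if_true]
      constructor <;> linarith [hj.1, hj.2]
    · simp only [PiLp.add_apply, PiLp.single_apply, if_neg hne, add_zero]
      constructor <;> linarith [hj.1, hj.2]
  have hx : x₀ + frameMap w a ∈ maSection Ω u x₀ p t := by
    simpa using hs 0 (by simpa using hδ.le)
  have h := abs_inner_sub_le (v := δ • w i) hp hx.1 hq
    (by simpa [add_assoc] using hs δ (by rw [abs_of_pos hδ]))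
    (by simpa [add_assoc, sub_eq_add_neg] using hs (-δ) (by rw [abs_neg, abs_of_pos hδ]))
  rw [inner_smul_right, abs_mul, abs_of_pos hδ, mul_comm, ← le_div_iff₀ hδ] at h
  exact abs_le.1 h

lemma norm_frameMap_le {n : ℕ} {w : Fin n → En n} {d δ : ℝ} (hw : ∀ i, ‖w i‖ ≤ d)
    (hδ : 0 < δ) {a : En n} (ha : a ∈ cube n δ (3 * δ)) : ‖frameMap w a‖ ≤ 3 * δ * d * n := by
  rw [frameMap_apply]
  calc ‖∑ i, a i • w i‖ ≤ ∑ i, ‖a i • w i‖ := norm_sum_le _ _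
    _ ≤ ∑ _i : Fin n, 3 * δ * d := Finset.sum_le_sum fun i _ => by
        rw [norm_smul, Real.norm_of_nonneg (hδ.le.trans (ha i).1)]
        exact mul_le_mul (ha i).2 (hw i) (norm_nonneg _) (by linarith)
    _ = 3 * δ * d * n := by simp [mul_comm]

lemma le_of_mul_le_mul_inv {n : ℕ} {c δ t D : ℝ} (hc : 0 < c) (hδ : 0 < δ) (ht : 0 < t)
    (hD : 0 < D) (h : c * (D * (2 * δ) ^ n) ≤ D⁻¹ * (2 * (t / δ)) ^ n) :
    D ≤ (δ ^ n)⁻¹ * (√c)⁻¹ * t ^ ((n : ℝ) / 2) := by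
  have hK : 0 ≤ (δ ^ n)⁻¹ * (√c)⁻¹ * t ^ ((n : ℝ) / 2) := by positivity
  have ht2 : (t ^ ((n : ℝ) / 2)) ^ 2 = t ^ n := by
    rw [← Real.rpow_natCast, ← Real.rpow_mul ht.le, ← Real.rpow_natCast]
    congr 1
    push_cast
    ring
  refine abs_le_of_sq_le_sq' ?_ hK |>.2
  rw [mul_pow, mul_pow, ht2, inv_pow, inv_pow, Real.sq_sqrt hc.le]
  have h2 : (0 : ℝ) < 2 ^ n := by positivity
  have hδ' : 0 < δ ^ n := by positivity
  rw [mul_pow, mul_pow, div_pow] at h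
  field_simp at h ⊢
  nlinarith

/-- Lemma 6.1 (Lemma `lem:section n`): if `Mu ≥ c·Lebesgue` on a ball around `x₀`, then
`|S^u_{t,p}(x₀)| ≤ C t^{n/2}` for all small `t`, with `C` depending only on `n`, `c`, `r`
and the diameter of `Ω`. -/
theorem statement_17 (n : ℕ) (c r d : ℝ) (hc : 0 < c) (hr : 0 < r) (hd : 0 < d) :
    ∃ C : ℝ, 0 < C ∧
      ∀ (Ω : Set (En n)) (u : En n → ℝ) (x₀ : En n),
        IsOpen Ω → Bornology.IsBounded Ω → Metric.diam Ω ≤ d →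
        ConvexOn ℝ Ω u → x₀ ∈ Ω → Metric.ball x₀ r ⊆ Ω →
        (∀ s : Set (En n), s ⊆ Metric.ball x₀ r → MeasurableSet s →
          ENNReal.ofReal c * volume s ≤ MAm Ω u s) →
        ∃ t₀ : ℝ, 0 < t₀ ∧
          ∀ p ∈ subgrad Ω u x₀, ∀ t : ℝ, 0 < t → t < t₀ →
            volume (maSection Ω u x₀ p t) ≤ ENNReal.ofReal (C * t ^ ((n : ℝ) / 2)) := by
  set δ : ℝ := min (1 / (4 * (n + 1))) (r / (4 * d * (n + 1))) with hδ_def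
  have hδ : 0 < δ := by positivity
  have hδn : 4 * δ * n ≤ 1 := by
    have h := min_le_left (1 / (4 * ((n : ℝ) + 1))) (r / (4 * d * (n + 1)))
    rw [← hδ_def, le_div_iff₀ (by positivity)] at h
    nlinarith
  have hδr : 3 * δ * d * n < r := by
    have h := min_le_right (1 / (4 * ((n : ℝ) + 1))) (r / (4 * d * (n + 1)))
    rw [← hδ_def, le_div_iff₀ (by positivity)] at h
    have h1 : 0 < δ * d := by positivity
    have h2 : 0 ≤ δ * d * n := by positivity
    nlinarith
  refine ⟨4 ^ n * ((δ ^ n)⁻¹ * (√c)⁻¹), by positivity, ?_⟩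
  intro Ω u x₀ hΩ hb hdiam hu hx₀ _ hMA
  refine ⟨1, one_pos, fun p hp t ht _ => ?_⟩
  have h0 : x₀ ∈ maSection Ω u x₀ p t := ⟨hx₀, by simpa using ht⟩
  have hT : ∀ v ∈ (x₀ + ·) ⁻¹' maSection Ω u x₀ p t, ‖v‖ ≤ d := fun v hv => by
    simpa using (Metric.dist_le_diam_of_mem hb hv.1 hx₀).trans hdiam
  have hT0 : (x₀ + ·) ⁻¹' maSection Ω u x₀ p t ∈ nhds 0 :=
    (continuous_const_add x₀).continuousAt.preimage_mem_nhds
      (by simpa using maSection_mem_nhds hΩ hu hx₀ p ht)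
  obtain ⟨w, hw, hdet, hmax⟩ := exists_almost_maximal_frame hT hT0
  have hD : 0 < |(stdBasis n).det w| := abs_pos.2 hdet
  set D := |(stdBasis n).det w|
  have hvol : volume (maSection Ω u x₀ p t) ≤ ENNReal.ofReal (D * 4 ^ n) := by
    rw [← measure_preimage_add volume x₀]
    refine (measure_mono (subset_image_cube hw hdet hmax)).trans_eq ?_
    rw [Measure.addHaar_image_linearMap, det_frameMap, volume_cube n (by norm_num),
      ← ENNReal.ofReal_mul (abs_nonneg _)]
    norm_num [D]
  have hMA' := hMA ((x₀ + ·) '' (frameMap w '' cube n δ (3 * δ)))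
    (by
      rintro _ ⟨_, ⟨a, ha, rfl⟩, rfl⟩
      simpa using (norm_frameMap_le (fun i => hT _ (hw i)) hδ ha).trans_lt hδr)
    (((isCompact_cube n _ _).image (frameMap w).continuous_of_finiteDimensional).image
      (continuous_const_add x₀)).measurableSet
  have hle := hMA'.trans (measure_mono (iUnion_subgrad_subset hu hp h0 hw hδ hδn))
  rw [image_add_left, measure_preimage_add, Measure.addHaar_image_linearMap, det_frameMap,
    volume_cube n (by linarith), (measurePreserving_sub_right volume p).measure_preimage_emb
      (MeasurableEquiv.subRight p).measurableEmbedding,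
    Measure.addHaar_preimage_linearMap _ (by rwa [det_adjoint_frameMap]), det_adjoint_frameMap,
    volume_cube n (by linarith [div_pos ht hδ]), ← ENNReal.ofReal_mul (abs_nonneg _),
    ← ENNReal.ofReal_mul hc.le, ← ENNReal.ofReal_mul (abs_nonneg _),
    ENNReal.ofReal_le_ofReal_iff (by rw [sub_neg_eq_add]; positivity), abs_inv] at hle
  have hDle := le_of_mul_le_mul_inv (n := n) hc hδ ht hD (by convert hle using 3 <;> ring)
  refine hvol.trans (ENNReal.ofReal_le_ofReal ?_)
  rw [mul_comm, mul_assoc]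
  exact mul_le_mul_of_nonneg_left hDle (by positivity)
end
end
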